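/- arXiv:math/0407088 — 6 statements merged into one kernel-verified Lean document; each statement's English description precedes it below -/
import Mathlib

section
/- Let K̄ be an algebraically closed field of characteristic p, where p = 0 or p > 2, and let G be a finite subgroup of PGL₂(K̄) such that p = 0 or |G| is relatively prime to p. Then G is conjugate in PGL₂(K̄) to one of the following groups: G_{C_n} for some n ≥ 1, G_{D_{2n}} for some n > 2, G_{V₄}, G_{A₄}, G_{S₄}, or G_{A₅}. In particular, G is cyclic, dihedral, or isomorphic to A₄, S₄, or A₅. -/
open Matrix

/-- The projective general linear group `PGL₂(K) = GL₂(K)/center`. -/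
abbrev PGL2 (K : Type*) [Field K] : Type _ :=
  GL (Fin 2) K ⧸ Subgroup.center (GL (Fin 2) K)

/-- The natural projection `GL₂(K) → PGL₂(K)`. -/
def toPGL2 (K : Type*) [Field K] : GL (Fin 2) K →* PGL2 K :=
  QuotientGroup.mk' (Subgroup.center (GL (Fin 2) K))

/-- The set of images in `PGL₂(K)` of the invertible matrices lying in `S`. -/
def imgSet {K : Type*} [Field K] (S : Set (Matrix (Fin 2) (Fin 2) K)) : Set (PGL2 K) :=
  { x | ∃ M : GL (Fin 2) K, (M : Matrix (Fin 2) (Fin 2) K) ∈ S ∧ x = toPGL2 K M }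


/-- The subgroup `G_{V₄}` of `PGL₂(K)`: images of `[[±1,0],[0,1]]` and `[[0,±1],[1,0]]`. -/
def GV4 (K : Type*) [Field K] : Set (PGL2 K) :=
  imgSet { A | A = !![(1 : K), 0; 0, 1] ∨ A = !![(-1 : K), 0; 0, 1] ∨
    A = !![(0 : K), 1; 1, 0] ∨ A = !![(0 : K), -1; 1, 0] }

/-- The subgroup `G_{S₄}` of `PGL₂(K)`: images of `[[i^ν,0],[0,1]]`, `[[0,i^ν],[1,0]]` and
`[[i^ν,−i^{ν+ν'}],[1,i^{ν'}]]` for `ν, ν' = 0,1,2,3`, where `i` is a primitive 4th root of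
unity. -/
def GS4 (K : Type*) [Field K] (i : K) : Set (PGL2 K) :=
  imgSet { A | ∃ ν ν' : ℕ, A = !![i ^ ν, 0; 0, 1] ∨ A = !![0, i ^ ν; 1, 0] ∨
    A = !![i ^ ν, -i ^ (ν + ν'); 1, i ^ ν'] }

/-- The subgroup `G_{A₄}` of `PGL₂(K)`: images of `[[±1,0],[0,1]]`, `[[0,±1],[1,0]]`,
`[[i^ν,i^ν],[1,−1]]`, `[[i^ν,−i^ν],[1,1]]`, `[[1,i^ν],[1,−i^ν]]`, `[[−1,−i^ν],[1,−i^ν]]`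
for `ν = 1, 3`, where `i` is a primitive 4th root of unity. -/
def GA4 (K : Type*) [Field K] (i : K) : Set (PGL2 K) :=
  imgSet ({ A | A = !![(1 : K), 0; 0, 1] ∨ A = !![(-1 : K), 0; 0, 1] ∨
      A = !![(0 : K), 1; 1, 0] ∨ A = !![(0 : K), -1; 1, 0] } ∪
    { A | ∃ ν ∈ ({1, 3} : Set ℕ),
      A = !![i ^ ν, i ^ ν; 1, -1] ∨ A = !![i ^ ν, -i ^ ν; 1, 1] ∨
      A = !![1, i ^ ν; 1, -i ^ ν] ∨ A = !![-1, -i ^ ν; 1, -i ^ ν] })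

/-- The subgroup `G_{A₅}` of `PGL₂(K)`: images of `[[ε^r,0],[0,1]]`, `[[0,ε^r],[−1,0]]`,
`[[ε^rω, ε^{r−s}],[1,−ε^{−s}ω]]` and `[[ε^rω̄, ε^{r−s}],[1,−ε^{−s}ω̄]]` for
`r, s = 0,1,2,3,4`, where `ε` is a primitive 5th root of unity and `ω, ω̄` are the two
roots of `z² + z − 1 = 0`. -/
def GA5 (K : Type*) [Field K] (ε ω ωb : K) : Set (PGL2 K) :=
  imgSet { A | ∃ r s : ℕ,
    A = !![ε ^ r, 0; 0, 1] ∨ A = !![0, ε ^ r; -1, 0] ∨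
    A = !![ε ^ r * ω, ε ^ r * (ε ^ s)⁻¹; 1, -((ε ^ s)⁻¹ * ω)] ∨
    A = !![ε ^ r * ωb, ε ^ r * (ε ^ s)⁻¹; 1, -((ε ^ s)⁻¹ * ωb)] }

/-- The subgroup `G_{C_n}` of `PGL₂(K)`: images of the matrices `[[ζ^r,0],[0,1]]`. -/
def GCn (K : Type*) [Field K] (ζ : K) : Set (PGL2 K) :=
  imgSet { A | ∃ r : ℕ, A = !![ζ ^ r, 0; 0, 1] }

/-- The subgroup `G_{D_{2n}}` of `PGL₂(K)`: images of the matrices `[[ζ^r,0],[0,1]]` and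
`[[0,ζ^r],[1,0]]` where `ζ` is a primitive `n`-th root of unity. -/
def GD2n (K : Type*) [Field K] (ζ : K) : Set (PGL2 K) :=
  imgSet { A | ∃ r : ℕ, A = !![ζ ^ r, 0; 0, 1] ∨ A = !![0, ζ ^ r; 1, 0] }

section
open MulAction

structure TwoFix (G X : Type*) [Group G] [MulAction G X] : Prop where
  two : ∀ g : G, g ≠ 1 → ∃ x y : X, x ≠ y ∧ ∀ z, g • z = z ↔ z = x ∨ z = y
  share : ∀ g h : G, g ≠ 1 → ∀ x y : X, g • x = x → g • y = y → h • x = x → h • y = y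

noncomputable def eS (G : Type*) {X : Type*} [Group G] [MulAction G X] (x : X) : ℕ :=
  Nat.card (stabilizer G x)

def Tri (G X : Type*) [Group G] [MulAction G X] (a b c : ℕ) : Prop :=
  ∃ x y z : X, eS G x = a ∧ eS G y = b ∧ eS G z = c ∧
    ∀ w : X, (∃ g : G, g ≠ 1 ∧ g • w = w) → w ∈ orbit G x ∨ w ∈ orbit G y ∨ w ∈ orbit G z

section
variable {G X : Type*} [Group G] [MulAction G X]

lemma eS_orbit_mul [Finite G] (x : X) : (orbit G x).ncard * eS G x = Nat.card G := by
  rw [eS, ← index_stabilizer, Subgroup.index_mul_card]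

lemma eS_pos [Finite G] (x : X) : 0 < eS G x := Nat.card_pos

lemma eS_smul (g : G) (x : X) : eS G (g • x) = eS G x :=
  (Nat.card_congr (stabilizerEquivStabilizer (g := g) (a := x) (b := g • x) rfl).toEquiv).symm

lemma eS_of_mem_orbit {x y : X} (h : y ∈ orbit G x) : eS G y = eS G x := by
  obtain ⟨g, rfl⟩ := h
  exact eS_smul g x

lemma eS_gt_one [Finite G] {x : X} : 1 < eS G x ↔ ∃ g : G, g ≠ 1 ∧ g • x = x := by
  rw [eS, Finite.one_lt_card_iff_nontrivial]
  constructor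
  · intro h
    obtain ⟨g, hg⟩ := exists_ne (1 : stabilizer G x)
    exact ⟨g, fun h' => hg (Subtype.ext h'), g.2⟩
  · rintro ⟨g, hg, h⟩
    exact ⟨⟨⟨g, h⟩, 1, fun h' => hg (congrArg Subtype.val h')⟩⟩

lemma orbit_finite [Finite G] (x : X) : (orbit G x).Finite := Set.finite_range _

open Classical in
lemma dc_eq [Fintype G] (S : Finset X) :
    ∑ w ∈ S, (eS G w - 1) =
      ∑ g ∈ (Finset.univ : Finset G).erase 1, (S.filter (fun w => g • w = w)).card := by
  rw [show (∑ g ∈ (Finset.univ : Finset G).erase 1, (S.filter (fun w => g • w = w)).card) = _ from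
    Finset.sum_card_bipartiteAbove_eq_sum_card_bipartiteBelow (fun (g : G) (w : X) => g • w = w)]
  · refine Finset.sum_congr rfl fun w _ => ?_
    have : (Finset.bipartiteBelow (fun (g : G) (w : X) => g • w = w)
        ((Finset.univ : Finset G).erase 1) w) = (Finset.univ.filter (fun g : G => g • w = w)).erase 1 := by
      ext g; simp [Finset.bipartiteBelow]
    rw [this, Finset.card_erase_of_mem (by simp), eS, Nat.card_eq_fintype_card,
      Fintype.card_subtype]
    simp [mem_stabilizer_iff]

open Classical in
lemma TwoFix.dc_le (h : TwoFix G X) [Finite G] (S : Finset X) :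
    ∑ w ∈ S, (eS G w - 1) ≤ 2 * (Nat.card G - 1) := by
  have := Fintype.ofFinite G
  rw [dc_eq]
  calc _ ≤ ∑ g ∈ (Finset.univ : Finset G).erase 1, 2 := by
        refine Finset.sum_le_sum fun g hg => ?_
        obtain ⟨x, y, hxy, H⟩ := h.two g (by simpa using hg)
        calc _ ≤ ({x, y} : Finset X).card := Finset.card_le_card (by
              intro z; simp [H])
          _ ≤ 2 := Finset.card_le_two
    _ = _ := by simp [Finset.card_erase_of_mem, mul_comm]

open Classical in
lemma TwoFix.dc_full (h : TwoFix G X) [Finite G] (S : Finset X)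
    (hS : ∀ w : X, (∃ g : G, g ≠ 1 ∧ g • w = w) → w ∈ S) :
    ∑ w ∈ S, (eS G w - 1) = 2 * (Nat.card G - 1) := by
  have := Fintype.ofFinite G
  rw [dc_eq]
  calc _ = ∑ g ∈ (Finset.univ : Finset G).erase 1, 2 := by
        refine Finset.sum_congr rfl fun g hg => ?_
        have hg : g ≠ 1 := by simpa using hg
        obtain ⟨x, y, hxy, H⟩ := h.two g hg
        rw [← Finset.card_pair hxy]
        congr 1
        ext z
        simp only [Finset.mem_filter, H, Finset.mem_insert, Finset.mem_singleton]
        exact ⟨fun h => h.2, fun h => ⟨hS _ ⟨g, hg, (H z).2 h⟩, h⟩⟩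
    _ = _ := by simp [Finset.card_erase_of_mem, mul_comm]

lemma sum_orbit [Finite G] (x : X) :
    ∑ w ∈ (orbit_finite (G := G) x).toFinset, (eS G w - 1) + (orbit G x).ncard = Nat.card G := by
  rw [Finset.sum_congr rfl (g := fun _ => eS G x - 1), Finset.sum_const, smul_eq_mul,
    ← Set.ncard_eq_toFinset_card _ (orbit_finite x), ← eS_orbit_mul x]
  · obtain ⟨k, hk⟩ := Nat.exists_eq_add_of_lt (eS_pos (G := G) x)
    rw [hk]; simp; ring
  · intro w hw
    rw [eS_of_mem_orbit (by simpa using hw)]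

lemma arith {N n₁ n₂ n₃ a b c : ℕ} (ha : 1 < a) (hab : a ≤ b) (hbc : b ≤ c)
    (h1 : n₁ * a = N) (h2 : n₂ * b = N) (h3 : n₃ * c = N) (_ : 0 < N)
    (h : n₁ + n₂ + n₃ = N + 2) :
    (a = 2 ∧ b = 2 ∧ N = 2 * c) ∨ (a = 2 ∧ b = 3 ∧ c = 3 ∧ N = 12) ∨
      (a = 2 ∧ b = 3 ∧ c = 4 ∧ N = 24) ∨ (a = 2 ∧ b = 3 ∧ c = 5 ∧ N = 60) := by
  have ha2 : a = 2 := by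
    by_contra hne
    have : 3 ≤ a := by omega
    have e1 : n₁ * 3 ≤ N := by nlinarith
    have e2 : n₂ * 3 ≤ N := by nlinarith
    have e3 : n₃ * 3 ≤ N := by nlinarith
    omega
  subst ha2
  have hb3 : b ≤ 3 := by
    by_contra hne
    have : 4 ≤ b := by omega
    have e2 : n₂ * 4 ≤ N := by nlinarith
    have e3 : n₃ * 4 ≤ N := by nlinarith
    omega
  interval_cases b
  · left
    have : n₃ = 2 := by omega
    subst this; omega
  · right
    have hc : c ≤ 5 := by
      by_contra hne
      have : 6 ≤ c := by omega
      have e3 : n₃ * 6 ≤ N := by nlinarith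
      omega
    interval_cases c <;> omega

def Alt (G X : Type*) [Group G] [MulAction G X] : Prop :=
  (∃ x : X, eS G x = Nat.card G) ∨
  (∃ n, 2 ≤ n ∧ Nat.card G = 2 * n ∧ ∃ x : X, eS G x = n) ∨
  (Nat.card G = 12 ∧ Tri G X 2 3 3) ∨ (Nat.card G = 24 ∧ Tri G X 2 3 4) ∨
  (Nat.card G = 60 ∧ Tri G X 2 3 5)

lemma alt_of_three [Finite G] {x y z : X} (ha : 1 < eS G x) (hab : eS G x ≤ eS G y)
    (hbc : eS G y ≤ eS G z)
    (h : (orbit G x).ncard + (orbit G y).ncard + (orbit G z).ncard = Nat.card G + 2)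
    (H : ∀ w : X, (∃ g : G, g ≠ 1 ∧ g • w = w) →
      w ∈ orbit G x ∨ w ∈ orbit G y ∨ w ∈ orbit G z) : Alt G X := by
  rcases arith ha hab hbc (eS_orbit_mul x) (eS_orbit_mul y) (eS_orbit_mul z) Nat.card_pos h with
    ⟨h1, h2, h3⟩ | ⟨h1, h2, h3, h4⟩ | ⟨h1, h2, h3, h4⟩ | ⟨h1, h2, h3, h4⟩
  · right; left
    exact ⟨eS G z, by omega, h3, z, rfl⟩
  · exact Or.inr (Or.inr (Or.inl ⟨h4, x, y, z, h1, h2, h3, H⟩))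
  · exact Or.inr (Or.inr (Or.inr (Or.inl ⟨h4, x, y, z, h1, h2, h3, H⟩)))
  · exact Or.inr (Or.inr (Or.inr (Or.inr ⟨h4, x, y, z, h1, h2, h3, H⟩)))

lemma alt_of_three' [Finite G] {x y z : X} (hx : 1 < eS G x) (hy : 1 < eS G y)
    (hz : 1 < eS G z)
    (h : (orbit G x).ncard + (orbit G y).ncard + (orbit G z).ncard = Nat.card G + 2)
    (H : ∀ w : X, (∃ g : G, g ≠ 1 ∧ g • w = w) →
      w ∈ orbit G x ∨ w ∈ orbit G y ∨ w ∈ orbit G z) : Alt G X := by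
  rcases le_total (eS G x) (eS G y) with h1 | h1 <;>
  rcases le_total (eS G y) (eS G z) with h2 | h2 <;>
  rcases le_total (eS G x) (eS G z) with h3 | h3
  · exact alt_of_three hx h1 h2 h H
  · exact alt_of_three hx h1 h2 h H
  · exact alt_of_three hx h3 h2 (by omega) (fun w hw => by have := H w hw; tauto)
  · exact alt_of_three hz h3 h1 (by omega) (fun w hw => by have := H w hw; tauto)
  · exact alt_of_three hy h1 h3 (by omega) (fun w hw => by have := H w hw; tauto)
  · exact alt_of_three hy h2 h3 (by omega) (fun w hw => by have := H w hw; tauto)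
  · exact alt_of_three hz h2 h1 (by omega) (fun w hw => by have := H w hw; tauto)
  · exact alt_of_three hz h2 h1 (by omega) (fun w hw => by have := H w hw; tauto)

open Classical in
theorem TwoFix.alt (h : TwoFix G X) [Finite G] (hN : 1 < Nat.card G) : Alt G X := by
  have hfin : {w : X | ∃ g : G, g ≠ 1 ∧ g • w = w}.Finite := by
    have : {w : X | ∃ g : G, g ≠ 1 ∧ g • w = w} = ⋃ g ∈ {g : G | g ≠ 1}, {w | g • w = w} := by
      ext; simp
    rw [this]
    refine Set.Finite.biUnion (Set.toFinite _) fun g hg => ?_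
    obtain ⟨x, y, hxy, H⟩ := h.two g hg
    exact (Set.toFinite {x, y}).subset fun z hz => by simpa using (H z).1 hz
  set F := hfin.toFinset with hF
  have memF : ∀ w, w ∈ F ↔ ∃ g : G, g ≠ 1 ∧ g • w = w := fun w => by simp [F]
  have tot := h.dc_full F (fun w hw => (memF w).2 hw)
  have nt : Nontrivial G := Finite.one_lt_card_iff_nontrivial.1 hN
  let O : X → Finset X := fun x => (orbit_finite (G := G) x).toFinset
  have memO : ∀ (x w : X), w ∈ O x ↔ w ∈ orbit G x := fun x w => by simp [O]
  have sumO : ∀ x : X, ∑ w ∈ O x, (eS G w - 1) + (orbit G x).ncard = Nat.card G := sum_orbit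
  have gt : ∀ x ∈ F, 1 < eS G x := fun x hx => eS_gt_one.2 ((memF x).1 hx)
  have half : ∀ x ∈ F, 2 * (orbit G x).ncard ≤ Nat.card G := fun x hx => by
    have := gt x hx
    rw [← eS_orbit_mul x]; nlinarith
  have pos : ∀ x : X, 0 < (orbit G x).ncard := fun x =>
    (Set.ncard_pos (orbit_finite x)).2 ⟨x, mem_orbit_self x⟩
  have OF : ∀ x ∈ F, O x ⊆ F := fun x hx w hw => by
    rw [memO] at hw
    rw [memF, ← eS_gt_one, eS_of_mem_orbit hw]
    exact gt x hx
  have disj : ∀ x y : X, y ∉ orbit G x → Disjoint (O x) (O y) := fun x y hxy => by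
    rw [Finset.disjoint_left]
    intro w h1 h2
    rw [memO] at h1 h2
    exact hxy ((orbit_eq_iff.2 h1).symm.trans (orbit_eq_iff.2 h2) ▸ mem_orbit_self y)
  obtain ⟨g, hg⟩ := exists_ne (1 : G)
  obtain ⟨x, x', hxx, Hx⟩ := h.two g hg
  have hx : x ∈ F := (memF x).2 ⟨g, hg, (Hx x).2 (Or.inl rfl)⟩
  have sx := sumO x
  have px := pos x
  have hx2 := half x hx
  -- second orbit
  have : ∃ y ∈ F, y ∉ orbit G x := by
    by_contra! hcon
    have : O x = F := (OF x hx).antisymm fun w hw => (memO x w).2 (hcon w hw)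
    rw [this] at sx
    omega
  obtain ⟨y, hy, hyx⟩ := this
  have sy := sumO y
  have py := pos y
  have hy2 := half y hy
  by_cases h3 : ∃ z ∈ F, z ∉ orbit G x ∧ z ∉ orbit G y
  · obtain ⟨z, hz, hzx, hzy⟩ := h3
    have sz := sumO z
    have pz := pos z
    have hz2 := half z hz
    have dxy := disj x y hyx
    have dz : Disjoint (O x ∪ O y) (O z) :=
      Finset.disjoint_union_left.2 ⟨disj x z hzx, disj y z hzy⟩
    have s3 : ∑ w ∈ (O x ∪ O y) ∪ O z, (eS G w - 1) + ((orbit G x).ncard + (orbit G y).ncard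
        + (orbit G z).ncard) = 3 * Nat.card G := by
      rw [Finset.sum_union dz, Finset.sum_union dxy]; omega
    have ex : ∀ w ∈ F, w ∈ orbit G x ∨ w ∈ orbit G y ∨ w ∈ orbit G z := by
      by_contra! hcon
      obtain ⟨w, hw, hwx, hwy, hwz⟩ := hcon
      have sw := sumO w
      have hw2 := half w hw
      have dw : Disjoint ((O x ∪ O y) ∪ O z) (O w) :=
        Finset.disjoint_union_left.2
          ⟨Finset.disjoint_union_left.2 ⟨disj x w hwx, disj y w hwy⟩, disj z w hwz⟩
      have := h.dc_le (((O x ∪ O y) ∪ O z) ∪ O w)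
      rw [Finset.sum_union dw] at this
      omega
    have : (O x ∪ O y) ∪ O z = F := by
      apply Finset.Subset.antisymm
      · exact Finset.union_subset (Finset.union_subset (OF x hx) (OF y hy)) (OF z hz)
      · intro w hw
        have := ex w hw
        simp only [Finset.mem_union, memO]
        tauto
    rw [this, tot] at s3
    exact alt_of_three' (gt x hx) (gt y hy) (gt z hz) (by omega)
      (fun w hw => ex w ((memF w).2 hw))
  · left
    push Not at h3
    have : O x ∪ O y = F := by
      apply Finset.Subset.antisymm
      · exact Finset.union_subset (OF x hx) (OF y hy)
      · intro w hw
        have := h3 w hw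
        simp only [Finset.mem_union, memO]
        tauto
    rw [← this, Finset.sum_union (disj x y hyx)] at tot
    have h1 : (orbit G x).ncard = 1 := by omega
    refine ⟨x, ?_⟩
    rw [← eS_orbit_mul x, h1, one_mul]

end
end

section
open MulAction
open scoped Pointwise

section
variable {G X : Type*} [Group G] [MulAction G X]

lemma emb_core [Finite G] (H : Subgroup G) {n : ℕ} (hn : H.index = n) (_ : n ≠ 0)
    (hc : H.normalCore = ⊥) :
    ∃ f : G →* Equiv.Perm (Fin n), Function.Injective f := by
  have : Nat.card (G ⧸ H) = n := hn
  have e : (G ⧸ H) ≃ Fin n := Finite.equivFinOfCardEq this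
  refine ⟨(e.permCongrHom).toMonoidHom.comp (MulAction.toPermHom G (G ⧸ H)), ?_⟩
  have h1 : Function.Injective (MulAction.toPermHom G (G ⧸ H)) := by
    rw [← MonoidHom.ker_eq_bot_iff, ← Subgroup.normalCore_eq_ker, hc]
  exact (e.permCongrHom).injective.comp h1

lemma emb_card [Finite G] (H : Subgroup G) {n : ℕ} (hn : H.index = n) (hn0 : n ≠ 0)
    (hc : H.normalCore = ⊥) : Nat.card G ≤ n.factorial := by
  obtain ⟨f, hf⟩ := emb_core H hn hn0 hc
  have := Nat.card_le_card_of_injective f hf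
  rwa [Nat.card_perm, Nat.card_fin] at this

lemma iso_perm [Finite G] (H : Subgroup G) {n : ℕ} (hn : H.index = n) (hn0 : n ≠ 0)
    (hc : H.normalCore = ⊥) (hG : Nat.card G = n.factorial) :
    Nonempty (G ≃* Equiv.Perm (Fin n)) := by
  obtain ⟨f, hf⟩ := emb_core H hn hn0 hc
  exact ⟨MulEquiv.ofBijective f ((Nat.bijective_iff_injective_and_card f).2
    ⟨hf, by rw [hG, Nat.card_perm]; simp⟩)⟩

lemma iso_alt [Finite G] (H : Subgroup G) {n : ℕ} (hn : H.index = n) (hn0 : n ≠ 0)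
    (hc : H.normalCore = ⊥) (hG : 2 * Nat.card G = n.factorial) :
    Nonempty (G ≃* alternatingGroup (Fin n)) := by
  obtain ⟨f, hf⟩ := emb_core H hn hn0 hc
  have e := MonoidHom.ofInjective hf
  have h2 : f.range = alternatingGroup (Fin n) := by
    apply Equiv.Perm.eq_alternatingGroup_of_index_eq_two
    have h3 := f.range.index_mul_card
    rw [← Nat.card_congr e.toEquiv, Nat.card_perm, Nat.card_fin, ← hG] at h3
    exact Nat.eq_of_mul_eq_mul_right Nat.card_pos h3
  exact ⟨e.trans (MulEquiv.subgroupCongr h2)⟩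

lemma TwoFix.orbit_le (h : TwoFix G X) {k : G} (hk : k ≠ 1) {y : X}
    (H : ∀ g : G, k • g • y = g • y) : (orbit G y).ncard ≤ 2 := by
  obtain ⟨a, b, hab, hf⟩ := h.two k hk
  calc _ ≤ ({a, b} : Set X).ncard := Set.ncard_le_ncard (by
        rintro _ ⟨g, rfl⟩
        simpa using (hf _).1 (H g)) (Set.toFinite _)
    _ ≤ 2 := (Set.ncard_pair hab).le

lemma TwoFix.partner (h : TwoFix G X) [Finite G] {y : X} (hy : 1 < eS G y) :
    ∃ y' : X, y' ≠ y ∧ (∀ g : G, g • y = y ↔ g • y' = y') ∧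
      ∀ g : G, g ≠ 1 → g • y = y → ∀ z : X, g • z = z → z = y ∨ z = y' := by
  obtain ⟨k, hk, hky⟩ := eS_gt_one.1 hy
  obtain ⟨a, b, hab, hf⟩ := h.two k hk
  have : ∃ y', y' ≠ y ∧ k • y' = y' ∧ ∀ z, k • z = z → z = y ∨ z = y' := by
    rcases (hf y).1 hky with rfl | rfl
    · exact ⟨b, hab.symm, (hf b).2 (Or.inr rfl), fun z => (hf z).1⟩
    · exact ⟨a, hab, (hf a).2 (Or.inl rfl), fun z hz => ((hf z).1 hz).symm⟩
  obtain ⟨y', hne, hky', hz⟩ := this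
  refine ⟨y', hne, fun g => ⟨h.share k g hk y y' hky hky', h.share k g hk y' y hky' hky⟩, ?_⟩
  intro g hg hgy z hgz
  exact hz z (h.share g k hg y z hgy hgz hky)

lemma TwoFix.partner_map {y y' : X}
    (h1 : ∀ g : G, g • y = y ↔ g • y' = y')
    (h2 : ∀ g : G, g ≠ 1 → g • y = y → ∀ z : X, g • z = z → z = y ∨ z = y')
    (hy : ∃ k : G, k ≠ 1 ∧ k • y = y) (hne : y' ≠ y) {g : G} (hg : g • y = y') : g • y' = y := by
  obtain ⟨k, hk, hky⟩ := hy
  have e1 : (g * k * g⁻¹) • y' = y' := by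
    rw [← hg]; simp [mul_smul, hky]
  have e2 : (g * k * g⁻¹) • (g • y') = g • y' := by
    simp [mul_smul, (h1 k).1 hky]
  rcases h2 _ (by simpa using hk) ((h1 _).2 e1) _ e2 with h | h
  · exact h
  · exact absurd (smul_left_cancel g (h.trans hg.symm)) hne

lemma mem_pairStab {y y' : X} {g : G} : g ∈ stabilizer G ({y, y'} : Set X) ↔
    (g • y = y ∧ g • y' = y') ∨ (g • y = y' ∧ g • y' = y) := by
  rw [mem_stabilizer_iff, Set.smul_set_insert, Set.smul_set_singleton, Set.pair_eq_pair_iff]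

lemma pair_card [Finite G] {y y' : X} (hy : 1 < eS G y) (hne : y' ≠ y)
    (h1 : ∀ g : G, g • y = y ↔ g • y' = y')
    (h2 : ∀ g : G, g ≠ 1 → g • y = y → ∀ z : X, g • z = z → z = y ∨ z = y')
    (ho : y' ∈ orbit G y) : Nat.card (stabilizer G ({y, y'} : Set X)) = 2 * eS G y := by
  set H := stabilizer G ({y, y'} : Set X) with hH
  rw [← eS_orbit_mul (G := H) y]
  congr 1
  · rw [← Set.ncard_pair hne.symm]
    congr 1
    ext z
    constructor
    · rintro ⟨⟨g, hg⟩, rfl⟩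
      rcases mem_pairStab.1 hg with h | h
      · left; exact h.1
      · right; exact h.1
    · rintro (rfl | rfl)
      · exact mem_orbit_self _
      · obtain ⟨g, hg⟩ := ho
        have hg : g • y = z := hg
        exact ⟨⟨g, mem_pairStab.2 (Or.inr ⟨hg,
          TwoFix.partner_map h1 h2 (eS_gt_one.1 hy) hne hg⟩)⟩, hg⟩
  · refine Nat.card_congr ⟨fun g => ⟨g.1.1, g.2⟩, fun g => ⟨⟨g.1, mem_pairStab.2
      (Or.inl ⟨g.2, (h1 _).1 g.2⟩)⟩, g.2⟩, fun g => rfl, fun g => rfl⟩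

lemma Tri.eS_mem {a b c : ℕ} (h : Tri G X a b c) {w : X} {g : G} (hg : g ≠ 1) (hw : g • w = w) :
    eS G w = a ∨ eS G w = b ∨ eS G w = c := by
  obtain ⟨x, y, z, hx, hy, hz, H⟩ := h
  rcases H w ⟨g, hg, hw⟩ with h | h | h
  · left; rw [eS_of_mem_orbit h, hx]
  · right; left; rw [eS_of_mem_orbit h, hy]
  · right; right; rw [eS_of_mem_orbit h, hz]

lemma pow_eS {w : X} {g : G} (hw : g • w = w) : g ^ eS G w = 1 := by
  have := pow_card_eq_one' (x := (⟨g, hw⟩ : stabilizer G w))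
  exact congrArg Subtype.val this

lemma iso_A4 [Finite G] (h : TwoFix G X) (hN : Nat.card G = 12) (ht : Tri G X 2 3 3) :
    Nonempty (G ≃* alternatingGroup (Fin 4)) := by
  obtain ⟨x, y, z, hx, hy, hz, H⟩ := ht
  have h1 := eS_orbit_mul (G := G) y
  rw [hy, hN] at h1
  refine iso_alt (stabilizer G y) (n := 4) (by rw [index_stabilizer]; omega) (by norm_num) ?_
    (by rw [hN]; rfl)
  rw [eq_bot_iff]
  intro k hk
  rw [Subgroup.mem_bot]
  by_contra hk1
  have : (orbit G y).ncard ≤ 2 := h.orbit_le hk1 fun g => by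
    have := hk g⁻¹
    rw [mem_stabilizer_iff, inv_inv, mul_smul, mul_smul, inv_smul_eq_iff] at this
    exact this
  omega

lemma iso_S4 [Finite G] (h : TwoFix G X) (hN : Nat.card G = 24) (ht : Tri G X 2 3 4) :
    Nonempty (G ≃* Equiv.Perm (Fin 4)) := by
  have ht' := ht
  obtain ⟨x, y, z, hx, hy, hz, H⟩ := ht
  have h1 := eS_orbit_mul (G := G) y
  rw [hy, hN] at h1
  have hy1 : 1 < eS G y := by omega
  obtain ⟨y', hne, p1, p2⟩ := h.partner hy1
  obtain ⟨c, hc, hcy⟩ := eS_gt_one.1 hy1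
  have hey' : eS G y' = 3 := by
    rw [← hy]
    exact Nat.card_congr ⟨fun g => ⟨g.1, (p1 _).2 g.2⟩, fun g => ⟨g.1, (p1 _).1 g.2⟩,
      fun _ => rfl, fun _ => rfl⟩
  have ho : y' ∈ orbit G y := by
    rcases H y' ⟨c, hc, (p1 c).1 hcy⟩ with h | h | h
    · rw [eS_of_mem_orbit h] at hey'; omega
    · exact h
    · rw [eS_of_mem_orbit h] at hey'; omega
  have hcard := pair_card hy1 hne p1 p2 ho
  have hidx := (stabilizer G ({y, y'} : Set X)).index_mul_card
  rw [hcard, hN, hy] at hidx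
  refine iso_perm (stabilizer G ({y, y'} : Set X)) (n := 4) (by omega) (by norm_num) ?_
    (by rw [hN]; rfl)
  rw [eq_bot_iff]
  intro k hk
  rw [Subgroup.mem_bot]
  by_contra hk1
  have key : ∀ k ∈ (stabilizer G ({y, y'} : Set X)).normalCore, k ≠ 1 →
      ∀ g : G, k • g • y = g • y' := by
    intro k hk hk1
    have a1 : ∀ g : G, (k • g • y = g • y ∧ k • g • y' = g • y') ∨
        (k • g • y = g • y' ∧ k • g • y' = g • y) := by
      intro g
      have := hk g⁻¹
      rw [mem_pairStab] at this
      simpa [mul_smul, inv_smul_eq_iff] using this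
    have a2 : k ^ 2 = 1 := by
      by_contra hk2
      have : (orbit G y).ncard ≤ 2 := h.orbit_le hk2 fun g => by
        rw [pow_two, mul_smul]
        rcases a1 g with ⟨b1, b2⟩ | ⟨b1, b2⟩
        · rw [b1, b1]
        · rw [b1, b2]
      omega
    intro g
    rcases a1 g with ⟨b1, b2⟩ | ⟨b1, b2⟩
    · exfalso
      have := pow_eS b1
      rw [eS_smul, hy, pow_succ, a2, one_mul] at this
      exact hk1 this
    · exact b1
  have cent : ∀ g : G, k * g = g * k := by
    intro g
    have m2 : g * k * g⁻¹ ∈ (stabilizer G ({y, y'} : Set X)).normalCore :=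
      (Subgroup.normalCore_normal _).conj_mem k hk g
    have n2 : g * k * g⁻¹ ≠ 1 := by simpa using hk1
    by_contra hne'
    have : k⁻¹ * (g * k * g⁻¹) ≠ 1 := by
      intro h
      rw [inv_mul_eq_one] at h
      apply hne'
      conv_lhs => rw [h]
      group
    have := h.orbit_le (y := y) this fun f => by
      rw [mul_smul, key _ m2 n2, inv_smul_eq_iff, key _ hk hk1]
    omega
  obtain ⟨w, w', _, hw⟩ := h.two k hk1
  have hkw : k • w = w := (hw w).2 (Or.inl rfl)
  have o1 := h.orbit_le (y := w) hk1 fun g => by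
    rw [← mul_smul, cent, mul_smul, hkw]
  have o2 := eS_orbit_mul (G := G) w
  rw [hN] at o2
  rcases ht'.eS_mem hk1 hkw with e | e | e <;> rw [e] at o2 <;> omega

end
end

section
open MulAction
open scoped Pointwise

section
variable {G X : Type*} [Group G] [MulAction G X]

lemma TwoFix.sub (h : TwoFix G X) (K : Subgroup G) : TwoFix K X where
  two g hg := h.two g.1 (fun h' => hg (Subtype.ext h'))
  share g k hg := h.share g.1 k.1 (fun h' => hg (Subtype.ext h'))

lemma A5_stab_le [Finite G] (h : TwoFix G X) (ht : Tri G X 2 3 5)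
    (K : Subgroup G) [K.Normal] {q : ℕ} (hq : q.Prime) (hqK : q ∣ Nat.card K) :
    ∃ w : X, eS G w = q ∧ ∀ w' : X, eS G w' = q → stabilizer G w' ≤ K := by
  have := Fact.mk hq
  obtain ⟨k, hk⟩ := exists_prime_orderOf_dvd_card' q hqK
  have hk' : orderOf k.1 = q := by rw [Subgroup.orderOf_coe, hk]
  have hk1 : k.1 ≠ 1 := by
    intro h; rw [h, orderOf_one] at hk'; exact hq.one_lt.ne hk'
  obtain ⟨w, _, _, hw⟩ := h.two k.1 hk1
  have hkw : k.1 • w = w := (hw w).2 (Or.inl rfl)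
  have hdvd : q ∣ eS G w := by rw [← hk']; exact orderOf_dvd_of_pow_eq_one (pow_eS hkw)
  have heq : eS G w = q := by
    rcases ht.eS_mem hk1 hkw with e | e | e <;> rw [e] at hdvd ⊢
    · exact ((Nat.prime_dvd_prime_iff_eq hq Nat.prime_two).1 hdvd).symm
    · exact ((Nat.prime_dvd_prime_iff_eq hq Nat.prime_three).1 hdvd).symm
    · exact ((Nat.prime_dvd_prime_iff_eq hq Nat.prime_five).1 hdvd).symm
  have hle : stabilizer G w ≤ K := by
    have : Subgroup.zpowers k.1 = stabilizer G w := by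
      apply Subgroup.eq_of_le_of_card_ge
      · rw [Subgroup.zpowers_le]; exact hkw
      · rw [Nat.card_zpowers, hk']; exact heq.le
    rw [← this, Subgroup.zpowers_le]; exact k.2
  refine ⟨w, heq, fun w' hw' => ?_⟩
  have ho : w' ∈ orbit G w := by
    obtain ⟨x, y, z, hx, hy, hz, H⟩ := ht
    have g1 := H w (eS_gt_one.1 (heq ▸ hq.one_lt))
    have g2 := H w' (eS_gt_one.1 (hw' ▸ hq.one_lt))
    have big : ∀ p : X, w ∈ orbit G p → w' ∈ orbit G p → w' ∈ orbit G w := fun p h1 h2 => by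
      rw [orbit_eq_iff.2 h1]; exact h2
    rcases g1 with g1 | g1 | g1 <;> rcases g2 with g2 | g2 | g2 <;>
    first
    | exact big _ g1 g2
    | (have e1 := eS_of_mem_orbit g1
       have e2 := eS_of_mem_orbit g2
       omega)
  obtain ⟨g, rfl⟩ := ho
  intro f hf
  have : g⁻¹ * f * g ∈ stabilizer G w := by
    rw [mem_stabilizer_iff, mul_smul, mul_smul]
    have hf : f • g • w = g • w := hf
    rw [hf, inv_smul_smul]
  have := ‹K.Normal›.conj_mem _ (hle this) g
  simpa [mul_assoc] using this

lemma A5_count [Finite G] (h : TwoFix G X) (hN : Nat.card G = 60) (ht : Tri G X 2 3 5)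
    (K : Subgroup G) [K.Normal] {q : ℕ} (hq : q.Prime) (hqK : q ∣ Nat.card K) {m : ℕ}
    (hm : m * q = 60) : m * (q - 1) ≤ 2 * (Nat.card K - 1) := by
  obtain ⟨w, hw, H⟩ := A5_stab_le h ht K hq hqK
  have o := eS_orbit_mul (G := G) w
  rw [hN, hw, ← hm] at o
  have o := Nat.eq_of_mul_eq_mul_right hq.pos o
  have := (h.sub K).dc_le (orbit_finite (G := G) w).toFinset
  rw [Finset.sum_congr rfl (g := fun _ => q - 1), Finset.sum_const, smul_eq_mul,
    ← Set.ncard_eq_toFinset_card _ (orbit_finite w), o] at this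
  · exact this
  · intro w' hw'
    have e : eS G w' = q := by rw [eS_of_mem_orbit (by simpa using hw'), hw]
    congr 1
    rw [← e]
    exact Nat.card_congr ⟨fun g => ⟨g.1.1, g.2⟩, fun g => ⟨⟨g.1, H w' e g.2⟩, g.2⟩,
      fun _ => rfl, fun _ => rfl⟩

lemma A5_simple [Finite G] (h : TwoFix G X) (hN : Nat.card G = 60) (ht : Tri G X 2 3 5)
    (K : Subgroup G) [K.Normal] : K = ⊥ ∨ K = ⊤ := by
  have c2 := fun d => A5_count h hN ht K (q := 2) Nat.prime_two d (m := 30) rfl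
  have c3 := fun d => A5_count h hN ht K (q := 3) Nat.prime_three d (m := 20) rfl
  have c5 := fun d => A5_count h hN ht K (q := 5) Nat.prime_five d (m := 12) rfl
  have hd : Nat.card K ∣ 60 := hN ▸ K.card_subgroup_dvd_card
  have : Nat.card K = 1 ∨ (2 ∣ Nat.card K ∧ 3 ∣ Nat.card K ∧ 5 ∣ Nat.card K) := by
    generalize Nat.card K = m at *
    have hm : m ∈ Nat.divisors 60 := by simp [hd]
    have : Nat.divisors 60 = {1, 2, 3, 4, 5, 6, 10, 12, 15, 20, 30, 60} := by decide
    rw [this] at hm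
    simp only [Finset.mem_insert, Finset.mem_singleton] at hm
    omega
  rcases this with h1 | ⟨d2, d3, d5⟩
  · left; exact Subgroup.card_eq_one.1 h1
  · right
    obtain ⟨_, _, H2⟩ := A5_stab_le h ht K Nat.prime_two d2
    obtain ⟨_, _, H3⟩ := A5_stab_le h ht K Nat.prime_three d3
    obtain ⟨_, _, H5⟩ := A5_stab_le h ht K Nat.prime_five d5
    rw [eq_top_iff]
    intro g _
    by_cases hg : g = 1
    · rw [hg]; exact K.one_mem
    · obtain ⟨w, _, _, hw⟩ := h.two g hg
      have hgw : g • w = w := (hw w).2 (Or.inl rfl)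
      rcases ht.eS_mem hg hgw with e | e | e
      · exact H2 w e hgw
      · exact H3 w e hgw
      · exact H5 w e hgw

lemma iso_A5 [Finite G] (h : TwoFix G X) (hN : Nat.card G = 60) (ht : Tri G X 2 3 5) :
    Nonempty (G ≃* alternatingGroup (Fin 5)) := by
  have simp' := fun (K : Subgroup G) [K.Normal] => A5_simple h hN ht K
  have ht' := ht
  obtain ⟨x, y, z, hx, hy, hz, H⟩ := ht
  have hx1 : 1 < eS G x := by omega
  obtain ⟨x', hne, p1, p2⟩ := h.partner hx1
  obtain ⟨s, hs, hsx⟩ := eS_gt_one.1 hx1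
  have only : ∀ w : X, eS G w = 2 → w ∈ orbit G x := fun w hw => by
    rcases H w (eS_gt_one.1 (by omega)) with h | h | h
    · exact h
    · rw [eS_of_mem_orbit h] at hw; omega
    · rw [eS_of_mem_orbit h] at hw; omega
  have uniq : ∀ (w : X), eS G w = 2 → ∀ a b : G, a ≠ 1 → b ≠ 1 → a • w = w → b • w = w → a = b := by
    intro w hw a b ha hb haw hbw
    rw [eS, Nat.card_eq_two_iff' (1 : stabilizer G w)] at hw
    have := hw.unique (y₁ := ⟨a, haw⟩) (y₂ := ⟨b, hbw⟩) (fun h => ha (congrArg Subtype.val h))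
      (fun h => hb (congrArg Subtype.val h))
    exact congrArg Subtype.val this
  have hex' : eS G x' = 2 := by
    rw [← hx]
    exact Nat.card_congr ⟨fun g => ⟨g.1, (p1 _).2 g.2⟩, fun g => ⟨g.1, (p1 _).1 g.2⟩,
      fun _ => rfl, fun _ => rfl⟩
  have hcard := pair_card hx1 hne p1 p2 (only x' hex')
  set P := stabilizer G ({x, x'} : Set X) with hP
  rw [hx] at hcard
  have memP : ∀ g : G, g ∈ P ↔ g * s = s * g := by
    intro g
    constructor
    · intro hg
      have : g * s * g⁻¹ = s := by
        apply uniq x hx _ _ (by simpa using hs) hs _ hsx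
        have := P.inv_mem hg
        rcases mem_pairStab.1 this with ⟨a, b⟩ | ⟨a, b⟩
        · rw [mul_smul, mul_smul, a, hsx, ← eq_inv_smul_iff, a]
        · rw [mul_smul, mul_smul, a, (p1 s).1 hsx, smul_eq_iff_eq_inv_smul, a]
      rw [mul_inv_eq_iff_eq_mul] at this
      exact this
    · intro hg
      have f1 : s • g • x = g • x := by rw [← mul_smul, ← hg, mul_smul, hsx]
      have f2 : s • g • x' = g • x' := by rw [← mul_smul, ← hg, mul_smul, (p1 s).1 hsx]
      rw [mem_pairStab]
      have nn : g • x ≠ g • x' := fun h => hne (smul_left_cancel g h).symm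
      rcases p2 s hs hsx _ f1 with a | a <;> rcases p2 s hs hsx _ f2 with b | b
      · exact absurd (a.trans b.symm) nn
      · exact Or.inl ⟨a, b⟩
      · exact Or.inr ⟨a, b⟩
      · exact absurd (a.trans b.symm) nn
  have hsP : s ∈ P := (memP s).2 rfl
  have comm : ∀ a ∈ P, ∀ b ∈ P, a * b = b * a := by
    have c2 : Nat.card P = 2 ^ 2 := by rw [hcard]; norm_num
    have := Fact.mk Nat.prime_two
    intro a ha b hb
    have := (IsPGroup.commGroupOfCardEqPrimeSq c2).mul_comm ⟨a, ha⟩ ⟨b, hb⟩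
    exact congrArg Subtype.val this
  -- another involution in P
  obtain ⟨t, htP, ht1, hts⟩ : ∃ t ∈ P, t ≠ 1 ∧ t ≠ s := by
    by_contra! hcon
    have hle : P ≤ stabilizer G x := by
      intro g hg
      by_cases h1 : g = 1
      · rw [h1]; exact one_mem _
      · rw [hcon g hg h1]; exact hsx
    have := Subgroup.card_le_of_le hle
    rw [hcard] at this
    have h2 : Nat.card (stabilizer G x) = 2 := hx
    omega
  obtain ⟨w, _, _, hw⟩ := h.two t ht1
  have htw : t • w = w := (hw w).2 (Or.inl rfl)
  have ht4 : t ^ 4 = 1 := by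
    have := pow_card_eq_one' (x := (⟨t, htP⟩ : P))
    rw [hcard] at this
    exact congrArg Subtype.val this
  have hew : eS G w = 2 := by
    have hp := pow_eS htw
    rcases ht'.eS_mem ht1 htw with e | e | e
    · exact e
    · exfalso; rw [e] at hp
      apply ht1
      calc t = t ^ 4 * (t ^ 3)⁻¹ := by group
        _ = 1 := by rw [hp, ht4]; simp
    · exfalso; rw [e] at hp
      apply ht1
      calc t = t ^ 5 * (t ^ 4)⁻¹ := by group
        _ = 1 := by rw [hp, ht4]; simp
  obtain ⟨g, rfl⟩ := only w hew
  have hgs : g * s * g⁻¹ = t := by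
    apply uniq _ hew _ _ (by simpa using hs) ht1 _ htw
    simp [mul_smul, hsx]
  have hgP : g ∉ P := by
    intro hg
    rw [memP] at hg
    rw [hg, mul_inv_cancel_right] at hgs
    exact hts hgs.symm
  have hle : P.map (MulAut.conj g⁻¹).toMonoidHom ≤ P := by
    rintro _ ⟨p, hp, rfl⟩
    rw [memP]
    have := comm p hp t htP
    rw [← hgs] at this
    simp only [MulEquiv.toMonoidHom_eq_coe, MonoidHom.coe_coe, MulAut.conj_apply, inv_inv]
    calc g⁻¹ * p * g * s = g⁻¹ * (p * (g * s * g⁻¹)) * g := by group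
      _ = _ := by rw [this]; group
  have heq : P.map (MulAut.conj g⁻¹).toMonoidHom = P := by
    apply Subgroup.eq_of_le_of_card_ge hle
    rw [Subgroup.card_map_of_injective (MulAut.conj g⁻¹).injective]
  have hgN : g ∈ Subgroup.normalizer (P : Set G) := by
    rw [← inv_mem_iff, Subgroup.mem_normalizer_iff]
    intro p
    constructor
    · intro hp
      exact hle ⟨p, hp, by simp⟩
    · intro hp
      rw [← heq] at hp
      obtain ⟨p', hp', e⟩ := hp
      simp at e
      rw [← e]; exact hp'
  have hPN : P ≤ Subgroup.normalizer (P : Set G) := Subgroup.le_normalizer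
  set Q := Subgroup.normalizer (P : Set G) with hQ
  have d1 : 4 ∣ Nat.card Q := by
    have := Subgroup.card_dvd_of_le hPN
    rwa [hcard] at this
  have d2 := Q.index_mul_card
  rw [hN] at d2
  have d3 : Nat.card Q ≠ 4 := by
    intro h4
    have : P = Q := Subgroup.eq_of_le_of_card_ge hPN (by rw [h4, hcard])
    rw [← this] at hgN
    exact hgP hgN
  have d4 : Q ≠ ⊤ := by
    intro htop
    have : P.Normal := Subgroup.normalizer_eq_top_iff.1 htop
    rcases simp' P with e | e
    · rw [e] at hcard; simp at hcard
    · rw [e] at hcard; simp [hN] at hcard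
  have core : Q.normalCore = ⊥ := by
    rcases simp' Q.normalCore with e | e
    · exact e
    · exact absurd (eq_top_iff.2 (e ▸ Q.normalCore_le)) d4
  have d5 : Q.index ≠ 1 := fun h => d4 (Subgroup.index_eq_one.1 h)
  have d6 : Q.index ≠ 3 := fun h => by
    have := emb_card Q h (by norm_num) core
    rw [hN] at this
    revert this; decide
  have d7 : Q.index = 5 := by
    obtain ⟨k, hk⟩ := d1
    rw [hk] at d2 d3
    have : Q.index * k = 15 := by nlinarith
    have hd : Q.index ∈ Nat.divisors 15 := Nat.mem_divisors.2 ⟨⟨k, this.symm⟩, by norm_num⟩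
    have h15 : Nat.divisors 15 = {1, 3, 5, 15} := by decide
    rw [h15] at hd
    simp only [Finset.mem_insert, Finset.mem_singleton] at hd
    rcases hd with e | e | e | e <;> rw [e] at this <;> omega
  exact iso_alt Q d7 (by norm_num) core (by rw [hN]; rfl)

end
end

section
open Matrix MulAction OnePoint

section PB
variable {K : Type*} [Field K]

open Classical in
noncomputable instance pglAction : MulAction (PGL2 K) (OnePoint K) :=
  MulAction.compHom (OnePoint K) (QuotientGroup.lift (Subgroup.center (GL (Fin 2) K))
    (MulAction.toPermHom (GL (Fin 2) K) (OnePoint K)) (by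
      intro M hM
      rw [GeneralLinearGroup.center_eq_range_scalar] at hM
      obtain ⟨u, rfl⟩ := hM
      ext x
      have hu : (u : K) ≠ 0 := u.ne_zero
      induction x using OnePoint.rec with
      | infty => simp [OnePoint.smul_infty_eq_ite]
      | coe z => simp [OnePoint.smul_some_eq_ite, hu]))

open Classical in
lemma toPGL2_smul (M : GL (Fin 2) K) (x : OnePoint K) : toPGL2 K M • x = M • x := rfl

noncomputable def mo (a b c d : K) (h : a * d - b * c ≠ 0) : PGL2 K :=
  toPGL2 K (GeneralLinearGroup.mkOfDetNeZero !![a, b; c, d] (by rwa [det_fin_two_of]))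

lemma exists_mo (g : PGL2 K) : ∃ a b c d h, g = mo (K := K) a b c d h := by
  obtain ⟨M, rfl⟩ := QuotientGroup.mk_surjective g
  have hd := M.det_ne_zero
  rw [det_fin_two] at hd
  refine ⟨M 0 0, M 0 1, M 1 0, M 1 1, hd, ?_⟩
  change toPGL2 K M = _
  unfold mo
  congr 1
  ext i j
  fin_cases i <;> fin_cases j <;> rfl

lemma mem_imgSet {S : Set (Matrix (Fin 2) (Fin 2) K)} {g : PGL2 K} :
    g ∈ imgSet S ↔ ∃ a b c d h, !![a, b; c, d] ∈ S ∧ g = mo a b c d h := by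
  constructor
  · rintro ⟨M, hM, rfl⟩
    have hd := M.det_ne_zero
    rw [det_fin_two] at hd
    refine ⟨M 0 0, M 0 1, M 1 0, M 1 1, hd, ?_, ?_⟩
    · convert hM using 1
      ext i j
      fin_cases i <;> fin_cases j <;> rfl
    · unfold mo
      congr 1
      ext i j
      fin_cases i <;> fin_cases j <;> rfl
  · rintro ⟨a, b, c, d, h, hS, rfl⟩
    exact ⟨_, hS, rfl⟩

lemma mo_mul {a b c d a' b' c' d' : K} (h h') :
    mo a b c d h * mo a' b' c' d' h' =
      mo (a * a' + b * c') (a * b' + b * d') (c * a' + d * c') (c * b' + d * d') (by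
        have := mul_ne_zero h h'
        intro h0; apply this; rw [← h0]; ring) := by
  unfold mo
  rw [← map_mul]
  congr 1
  ext i j
  fin_cases i <;> fin_cases j <;>
    simp [GeneralLinearGroup.mkOfDetNeZero, Matrix.mul_apply, Fin.sum_univ_two]

lemma mo_eq_one_iff {a b c d : K} (h) : mo a b c d h = 1 ↔ b = 0 ∧ c = 0 ∧ a = d := by
  unfold mo toPGL2
  rw [QuotientGroup.mk'_apply, QuotientGroup.eq_one_iff,
    GeneralLinearGroup.center_eq_range_scalar, MonoidHom.mem_range]
  constructor
  · rintro ⟨u, hu⟩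
    have hu := congrArg (fun M : GL (Fin 2) K => (M : Matrix (Fin 2) (Fin 2) K)) hu
    have e := fun i j => congrFun (congrFun hu i) j
    have e00 := e 0 0
    have e01 := e 0 1
    have e10 := e 1 0
    have e11 := e 1 1
    simp [GeneralLinearGroup.mkOfDetNeZero] at e00 e01 e10 e11
    exact ⟨e01.symm, e10.symm, e00.symm.trans e11⟩
  · rintro ⟨rfl, rfl, rfl⟩
    have ha : a ≠ 0 := by rintro rfl; simp at h
    refine ⟨Units.mk0 a ha, ?_⟩
    ext i j
    fin_cases i <;> fin_cases j <;> simp [GeneralLinearGroup.mkOfDetNeZero]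

lemma mo_eq_mo {a b c d a' b' c' d' : K} (h) (h') (l : K) (hl : l ≠ 0) (ha : a' = l * a)
    (hb : b' = l * b) (hc : c' = l * c) (hd : d' = l * d) :
    mo a b c d h = mo a' b' c' d' h' := by
  have e1 : mo l 0 0 l (by simpa using hl) = (1 : PGL2 K) := (mo_eq_one_iff _).2 ⟨rfl, rfl, rfl⟩
  rw [← one_mul (mo a b c d h), ← e1, mo_mul]
  subst ha hb hc hd
  congr 1 <;> ring

lemma mo_inv {a b c d : K} (h) :
    (mo a b c d h)⁻¹ = mo d (-b) (-c) a (by intro h0; apply h; rw [← h0]; ring) := by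
  rw [inv_eq_iff_mul_eq_one, mo_mul, mo_eq_one_iff]
  refine ⟨?_, ?_, ?_⟩ <;> ring

lemma mkd_coe {A : Matrix (Fin 2) (Fin 2) K} (h : A.det ≠ 0) (i j : Fin 2) :
    (GeneralLinearGroup.mkOfDetNeZero A h) i j = A i j := rfl

lemma act_inf_inf {a b c d : K} (h) : mo a b c d h • (∞ : OnePoint K) = ∞ ↔ c = 0 := by
  classical
  unfold mo
  rw [toPGL2_smul, OnePoint.smul_infty_eq_ite, mkd_coe, mkd_coe]
  by_cases hc : c = 0 <;> simp [hc]

lemma act_inf_coe {a b c d : K} (h) {w : K} :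
    mo a b c d h • (∞ : OnePoint K) = (w : OnePoint K) ↔ a = w * c := by
  classical
  unfold mo
  rw [toPGL2_smul, OnePoint.smul_infty_eq_ite, mkd_coe, mkd_coe]
  by_cases hc : c = 0
  · subst hc
    have : a ≠ 0 := by rintro rfl; simp at h
    simp [this]
  · simp [hc, div_eq_iff]

lemma act_coe_inf {a b c d : K} (h) {z : K} :
    mo a b c d h • (z : OnePoint K) = ∞ ↔ c * z + d = 0 := by
  classical
  unfold mo
  rw [toPGL2_smul, OnePoint.smul_some_eq_ite]
  simp only [mkd_coe]
  simp

lemma act_coe_coe {a b c d : K} (h) {z w : K} :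
    mo a b c d h • (z : OnePoint K) = (w : OnePoint K) ↔ a * z + b = w * (c * z + d) := by
  classical
  unfold mo
  rw [toPGL2_smul, OnePoint.smul_some_eq_ite]
  simp only [mkd_coe]
  by_cases hc : c * z + d = 0
  · have : a * z + b ≠ 0 := by
      intro h0
      apply h
      by_cases hc0 : c = 0
      · have hd : d = 0 := by simpa [hc0] using hc
        rw [hc0, hd]; ring
      · have : c * (a * d - b * c) = 0 := by linear_combination a * c * hc - c * c * h0
        simpa [hc0] using this
    simp [hc, this]
  · simp [hc, div_eq_iff]

end PB
end

section
open Matrix MulAction OnePoint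

section PC0
variable {P X : Type*} [Group P] [MulAction P X]

lemma eS_sub (G : Subgroup P) (x : X) : eS G x = {g : P | g ∈ G ∧ g • x = x}.ncard := by
  unfold eS
  rw [← Nat.card_coe_set_eq]
  refine Nat.card_congr ⟨fun g => ⟨g.1.1, g.1.2, g.2⟩, fun g => ⟨⟨g.1, g.2.1⟩, g.2.2⟩, ?_, ?_⟩
  · intro g; rfl
  · intro g; rfl

def Cj (u : P) (G : Subgroup P) : Subgroup P := G.map (MulAut.conj u).toMonoidHom

lemma mem_Cj {u : P} {G : Subgroup P} {g : P} : g ∈ Cj u G ↔ u⁻¹ * g * u ∈ G := by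
  unfold Cj
  constructor
  · rintro ⟨k, hk, rfl⟩
    simpa [mul_assoc] using hk
  · intro h
    exact ⟨_, h, by simp [mul_assoc]⟩

lemma Cj_mem {u : P} {G : Subgroup P} {g : P} (h : g ∈ G) : u * g * u⁻¹ ∈ Cj u G :=
  ⟨g, h, rfl⟩

lemma Cj_set (u : P) (G : Subgroup P) : (fun g => u * g * u⁻¹) '' (G : Set P) = (Cj u G : Set P) := rfl

noncomputable def Cj_equiv (u : P) (G : Subgroup P) : G ≃* Cj u G :=
  G.equivMapOfInjective _ (MulAut.conj u).injective

lemma Cj_card (u : P) (G : Subgroup P) : Nat.card (Cj u G) = Nat.card G :=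
  (Nat.card_congr (Cj_equiv u G).toEquiv).symm

lemma Cj_Cj (u v : P) (G : Subgroup P) : Cj u (Cj v G) = Cj (u * v) G := by
  ext g; simp [mem_Cj, mul_assoc]

lemma Cj_eS (u : P) (G : Subgroup P) (x : X) : eS (Cj u G) (u • x) = eS G x := by
  rw [eS_sub, eS_sub, ← Set.ncard_image_of_injective {g : P | g ∈ G ∧ g • x = x}
    (MulAut.conj u).injective]
  congr 1
  ext g
  constructor
  · rintro ⟨h1, h2⟩
    refine ⟨u⁻¹ * g * u, ⟨mem_Cj.1 h1, ?_⟩, by simp [mul_assoc]⟩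
    rw [mul_smul, mul_smul, h2, inv_smul_smul]
  · rintro ⟨k, ⟨h1, h2⟩, rfl⟩
    refine ⟨Cj_mem h1, ?_⟩
    simp [mul_smul, h2]

lemma mem_orb {G : Subgroup P} {x w : X} : w ∈ orbit G x ↔ ∃ g ∈ G, g • x = w := by
  constructor
  · rintro ⟨g, rfl⟩
    exact ⟨g, g.2, rfl⟩
  · rintro ⟨g, hg, rfl⟩
    exact ⟨⟨g, hg⟩, rfl⟩

lemma Cj_orb {u : P} {G : Subgroup P} {x w : X} (h : w ∈ orbit G x) :
    u • w ∈ orbit (Cj u G) (u • x) := by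
  rw [mem_orb] at h ⊢
  obtain ⟨g, hg, rfl⟩ := h
  exact ⟨_, Cj_mem hg, by simp [mul_smul]⟩

lemma Cj_Tri {u : P} {G : Subgroup P} {a b c : ℕ} (h : Tri G X a b c) : Tri (Cj u G) X a b c := by
  obtain ⟨x, y, z, hx, hy, hz, hw⟩ := h
  refine ⟨u • x, u • y, u • z, by rw [Cj_eS, hx], by rw [Cj_eS, hy], by rw [Cj_eS, hz], ?_⟩
  rintro w ⟨g, hg, hgw⟩
  have := hw (u⁻¹ • w) ⟨⟨u⁻¹ * g * u, mem_Cj.1 g.2⟩, ?_, ?_⟩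
  · rcases this with h | h | h
    · left; simpa using Cj_orb (u := u) h
    · right; left; simpa using Cj_orb (u := u) h
    · right; right; simpa using Cj_orb (u := u) h
  · intro h0
    apply hg
    have := congrArg Subtype.val h0
    simp only [Subgroup.coe_one] at this
    ext
    rw [mul_assoc, inv_mul_eq_one] at this
    have h2 : u = (g : P) * u := this
    simpa using h2.symm
  · change (u⁻¹ * (g : P) * u) • u⁻¹ • w = _
    have : (g : P) • w = w := hgw
    simp [mul_smul, this]

end PC0

section PC1
variable {K : Type*} [Field K]

lemma exists_to_inf (x : OnePoint K) : ∃ u : PGL2 K, u • x = ∞ := by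
  induction x using OnePoint.rec with
  | infty => exact ⟨1, one_smul _ _⟩
  | coe z => exact ⟨mo 0 1 1 (-z) (by simp), (act_coe_inf _).2 (by ring)⟩

lemma exists_to_inf_zero {x y : OnePoint K} (h : x ≠ y) :
    ∃ u : PGL2 K, u • x = ∞ ∧ u • y = ((0 : K) : OnePoint K) := by
  obtain ⟨u, hu⟩ := exists_to_inf x
  have hy : u • y ≠ ∞ := by
    rw [← hu]
    intro h0
    exact h (smul_left_cancel _ h0).symm
  obtain ⟨w, hw⟩ := OnePoint.ne_infty_iff_exists.1 hy
  refine ⟨mo 1 (-w) 0 1 (by simp) * u, ?_, ?_⟩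
  · rw [mul_smul, hu, act_inf_inf]
  · rw [mul_smul, ← hw, act_coe_coe]; ring

lemma exists_to_three {x y z : OnePoint K} (h : x ≠ y) (hx : z ≠ x) (hy : z ≠ y) {c : K}
    (hc : c ≠ 0) :
    ∃ u : PGL2 K, u • x = ∞ ∧ u • y = ((0 : K) : OnePoint K) ∧ u • z = (c : OnePoint K) := by
  obtain ⟨u, hu, hu2⟩ := exists_to_inf_zero h
  have hz : u • z ≠ ∞ := by
    rw [← hu]
    intro h0
    exact hx (smul_left_cancel _ h0)
  obtain ⟨w, hw⟩ := OnePoint.ne_infty_iff_exists.1 hz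
  have hw0 : w ≠ 0 := by
    rintro rfl
    rw [← hu2] at hw
    exact hy (smul_left_cancel _ hw).symm
  refine ⟨mo c 0 0 w (by simp [hc, hw0]) * u, ?_, ?_, ?_⟩
  · rw [mul_smul, hu, act_inf_inf]
  · rw [mul_smul, hu2, act_coe_coe]; ring
  · rw [mul_smul, ← hw, act_coe_coe]; ring

/-- translations -/
lemma trans_pow (b : K) (n : ℕ) : (mo 1 b 0 1 (by simp)) ^ n = mo 1 (n * b) 0 1 (by simp) := by
  induction n with
  | zero => symm; rw [pow_zero, mo_eq_one_iff]; simp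
  | succ n ih =>
    rw [pow_succ, ih, mo_mul]
    congr 1 <;> push_cast <;> ring

lemma no_trans {G : Subgroup (PGL2 K)} (hc : (Nat.card G : K) ≠ 0) {b : K} {h}
    (hb : mo 1 b 0 1 h ∈ G) : b = 0 := by
  have h1 : (mo 1 b 0 1 h) ^ Nat.card G = 1 := by
    have := pow_card_eq_one' (x := (⟨_, hb⟩ : G))
    exact congrArg Subtype.val this
  rw [trans_pow, mo_eq_one_iff] at h1
  simpa [hc] using h1.1

lemma Cj_hc {G : Subgroup (PGL2 K)} (hc : (Nat.card G : K) ≠ 0) (u) :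
    (Nat.card (Cj u G) : K) ≠ 0 := by rwa [Cj_card]

lemma finite_hc {G : Subgroup (PGL2 K)} (hc : (Nat.card G : K) ≠ 0) : Finite G := by
  apply Nat.finite_of_card_ne_zero
  intro h; apply hc; simp [h]

/-- elements fixing infinity -/
lemma fix_inf {g : PGL2 K} (h : g • (∞ : OnePoint K) = ∞) :
    ∃ a b, ∃ ha : a ≠ 0, g = mo a b 0 1 (by simpa using ha) := by
  obtain ⟨a, b, c, d, hd, rfl⟩ := exists_mo g
  rw [act_inf_inf] at h
  subst h
  have ha : a ≠ 0 := by rintro rfl; simp at hd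
  have hd0 : d ≠ 0 := by rintro rfl; simp at hd
  refine ⟨a / d, b / d, div_ne_zero ha hd0, ?_⟩
  apply mo_eq_mo _ _ d⁻¹ (inv_ne_zero hd0) <;> field_simp <;> ring

noncomputable def rot : Kˣ →* PGL2 K where
  toFun a := mo a 0 0 1 (by simp)
  map_one' := by rw [mo_eq_one_iff]; simp
  map_mul' a b := by rw [mo_mul]; congr 1 <;> simp

lemma rot_def (a : Kˣ) : rot a = mo (a : K) 0 0 1 (by simp) := rfl

lemma rot_inj : Function.Injective (rot (K := K)) := by
  rw [injective_iff_map_eq_one]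
  intro a ha
  rw [rot_def, mo_eq_one_iff] at ha
  ext; simpa using ha.2.2

lemma rot_inf (a : Kˣ) : rot a • (∞ : OnePoint K) = ∞ := by rw [rot_def, act_inf_inf]
lemma rot_coe (a : Kˣ) (z : K) : rot a • (z : OnePoint K) = ((a * z : K) : OnePoint K) := by
  rw [rot_def, act_coe_coe]; ring

lemma fix_inf_zero {g : PGL2 K} (h : g • (∞ : OnePoint K) = ∞)
    (h0 : g • ((0 : K) : OnePoint K) = ((0 : K) : OnePoint K)) : ∃ a : Kˣ, g = rot a := by
  obtain ⟨a, b, ha, rfl⟩ := fix_inf h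
  rw [act_coe_coe] at h0
  have hb : b = 0 := by simpa using h0
  subst hb
  exact ⟨Units.mk0 a ha, rfl⟩

lemma exists_fix [IsAlgClosed K] (h2 : (2 : K) ≠ 0) (g : PGL2 K) : ∃ x : OnePoint K, g • x = x := by
  obtain ⟨a, b, c, d, hd, rfl⟩ := exists_mo g
  by_cases hc : c = 0
  · exact ⟨∞, by rwa [act_inf_inf]⟩
  · obtain ⟨s, hs⟩ := IsAlgClosed.exists_pow_nat_eq ((d - a) ^ 2 + 4 * b * c) (n := 2) (by norm_num)
    refine ⟨(((a - d + s) / (2 * c) : K) : OnePoint K), ?_⟩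
    rw [act_coe_coe]
    field_simp
    linear_combination (-1) * hs

theorem twoFix [IsAlgClosed K] (h2 : (2 : K) ≠ 0) (G : Subgroup (PGL2 K))
    (hc : (Nat.card G : K) ≠ 0) : TwoFix G (OnePoint K) := by
  constructor
  · rintro ⟨g, hg⟩ hg1
    have hg1 : g ≠ 1 := fun h => hg1 (Subtype.ext h)
    obtain ⟨x, hx⟩ := exists_fix h2 g
    obtain ⟨u, hu⟩ := exists_to_inf x
    have hx' : x = u⁻¹ • ∞ := by rw [← hu, inv_smul_smul]
    have hf : (u * g * u⁻¹) • (∞ : OnePoint K) = ∞ := by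
      rw [mul_smul, mul_smul, ← hx', hx, hu]
    obtain ⟨a, b, ha, hab⟩ := fix_inf hf
    have ha1 : a ≠ 1 := by
      rintro rfl
      have hm := Cj_mem (u := u) hg
      rw [hab] at hm
      have := no_trans (Cj_hc hc u) hm
      subst this
      apply hg1
      rw [(mo_eq_one_iff _).2 ⟨rfl, rfl, rfl⟩] at hab
      rw [mul_inv_eq_one] at hab
      simpa using hab
    have ha1' : 1 - a ≠ 0 := sub_ne_zero.2 (Ne.symm ha1)
    have key : ∀ z : OnePoint K, g • z = z ↔ (u * g * u⁻¹) • u • z = u • z := by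
      intro z
      rw [mul_smul, mul_smul, inv_smul_smul]
      exact (smul_left_cancel_iff u).symm
    refine ⟨u⁻¹ • ∞, u⁻¹ • ((b / (1 - a) : K) : OnePoint K), ?_, ?_⟩
    · intro h0
      exact OnePoint.coe_ne_infty _ (smul_left_cancel _ h0).symm
    · intro z
      change g • z = z ↔ _
      rw [key, hab, eq_inv_smul_iff, eq_inv_smul_iff]
      generalize u • z = y
      induction y using OnePoint.rec with
      | infty => simp [act_inf_inf]
      | coe w =>
        rw [act_coe_coe]
        simp only [OnePoint.coe_ne_infty, false_or, OnePoint.coe_eq_coe]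
        rw [eq_div_iff ha1']
        constructor
        · intro h; linear_combination (-1) * h
        · intro h; linear_combination (-1) * h
  · rintro ⟨g, hg⟩ ⟨h, hh⟩ hg1 x y hgx hgy hhx
    have hg1 : g ≠ 1 := fun h => hg1 (Subtype.ext h)
    change g • x = x at hgx
    change g • y = y at hgy
    change h • x = x at hhx
    change h • y = y
    by_cases hxy : x = y
    · rwa [← hxy]
    obtain ⟨u, hux, huy⟩ := exists_to_inf_zero hxy
    have tr : ∀ (k : PGL2 K) (z : OnePoint K), k • z = z → (u * k * u⁻¹) • u • z = u • z := by
      intro k z hk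
      rw [mul_smul, mul_smul, inv_smul_smul, hk]
    have e1 := tr g x hgx
    have e2 := tr g y hgy
    have e3 := tr h x hhx
    rw [hux] at e1 e3
    rw [huy] at e2
    obtain ⟨α, β, hα, hab⟩ := fix_inf e3
    obtain ⟨a, ha⟩ := fix_inf_zero e1 e2
    have m1 := Cj_mem (u := u) hg
    have m2 := Cj_mem (u := u) hh
    have m3 := mul_mem (mul_mem m1 m2) (inv_mem (mul_mem m2 m1))
    have ha1 : (a : K) ≠ 1 := by
      intro h0
      apply hg1
      have : a = 1 := by ext; simpa using h0
      rw [this, map_one, mul_inv_eq_one] at ha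
      simpa using ha
    rw [hab, ha, rot_def, mo_mul, mo_mul, mo_inv, mo_mul] at m3
    have m4 : mo 1 ((a : K) * β - β) 0 1 (by simp) ∈ Cj u G := by
      convert m3 using 1
      apply mo_eq_mo _ _ (α * a) (by simp [hα]) <;> ring
    have h5 := no_trans (Cj_hc hc u) m4
    have hβ : β = 0 := by
      have : ((a : K) - 1) * β = 0 := by linear_combination h5
      simpa [sub_ne_zero.2 ha1] using this
    subst hβ
    have : (u * h * u⁻¹) • u • y = u • y := by
      rw [hab, huy, act_coe_coe]; ring
    rw [mul_smul, mul_smul, inv_smul_smul] at this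
    exact smul_left_cancel _ this

/-- the stabilizer of infinity -/
lemma stab_form {G : Subgroup (PGL2 K)} [Finite G]
    (hp : ∀ g ∈ G, g • (∞ : OnePoint K) = ∞ → g • ((0 : K) : OnePoint K) = ((0 : K) : OnePoint K)) :
    ∃ ζ : Kˣ, IsPrimitiveRoot ζ (eS G (∞ : OnePoint K)) ∧ rot ζ ∈ G ∧
      ∀ g ∈ G, g • (∞ : OnePoint K) = ∞ → ∃ k : ℕ, g = rot (ζ ^ k) := by
  let H : Subgroup Kˣ := G.comap rot
  have hH : Finite H := by
    refine Finite.of_injective (β := G) (fun a => ⟨rot a.1, a.2⟩) ?_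
    intro a b hab
    exact Subtype.ext (rot_inj (congrArg Subtype.val hab))
  have hcard : Nat.card H = eS G (∞ : OnePoint K) := by
    have e : {g : PGL2 K | g ∈ G ∧ g • (∞ : OnePoint K) = ∞} = rot '' (H : Set Kˣ) := by
      ext g
      constructor
      · rintro ⟨h1, h2⟩
        obtain ⟨a, rfl⟩ := fix_inf_zero h2 (hp g h1 h2)
        exact ⟨a, h1, rfl⟩
      · rintro ⟨a, h1, rfl⟩
        exact ⟨h1, rot_inf a⟩
    rw [eS_sub, e, Set.ncard_image_of_injective _ rot_inj, ← Nat.card_coe_set_eq]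
    rfl
  obtain ⟨ζ, hζ⟩ := (IsCyclic.exists_generator (α := H))
  have ho : orderOf (ζ : Kˣ) = eS G (∞ : OnePoint K) := by
    rw [← hcard, Subgroup.orderOf_coe]
    exact orderOf_eq_card_of_forall_mem_zpowers hζ
  refine ⟨ζ, ho ▸ IsPrimitiveRoot.orderOf _, ζ.2, ?_⟩
  intro g hg hgi
  obtain ⟨a, rfl⟩ := fix_inf_zero hgi (hp g hg hgi)
  have := hζ ⟨a, hg⟩
  rw [← mem_powers_iff_mem_zpowers] at this
  obtain ⟨k, hk⟩ := this
  exact ⟨k, by rw [← Subgroup.coe_pow]; congr 1; exact (congrArg Subtype.val hk).symm⟩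

end PC1
end

section
open Matrix MulAction OnePoint

section PD0
variable {G X : Type*} [Group G] [MulAction G X]

lemma Tri.rot3 {a b c : ℕ} (h : Tri G X a b c) : Tri G X c a b := by
  obtain ⟨x, y, z, hx, hy, hz, hw⟩ := h
  refine ⟨z, x, y, hz, hx, hy, fun w h => ?_⟩
  rcases hw w h with h | h | h <;> tauto

lemma Tri.orb [Finite G] {a b c : ℕ} (h : Tri G X a b c) (hab : a ≠ b) (hac : a ≠ c) (ha : 1 < a)
    {w w' : X} (hw : eS G w = a) (hw' : eS G w' = a) : w' ∈ orbit G w := by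
  obtain ⟨x, y, z, hx, hy, hz, H⟩ := h
  have key : ∀ v : X, eS G v = a → v ∈ orbit G x := by
    intro v hv
    rcases H v (eS_gt_one.1 (by omega)) with h | h | h
    · exact h
    · have := eS_of_mem_orbit h; omega
    · have := eS_of_mem_orbit h; omega
  exact orbit_eq_iff.2 (key w hw) ▸ key w' hw'
end PD0

section PD
variable {K : Type*} [Field K]

lemma img_elim {S : Set (Matrix (Fin 2) (Fin 2) K)} {g : PGL2 K} (h : g ∈ imgSet S) :
    ∃ A ∈ S, ∃ h : A.det ≠ 0, g = toPGL2 K (GeneralLinearGroup.mkOfDetNeZero A h) := by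
  obtain ⟨M, hM, rfl⟩ := h
  exact ⟨M, hM, M.det_ne_zero, congrArg _ (by ext i j; rfl)⟩

lemma img_intro {S : Set (Matrix (Fin 2) (Fin 2) K)} {a b c d : K} {h}
    (hS : !![a, b; c, d] ∈ S) : mo a b c d h ∈ imgSet S := mem_imgSet.2 ⟨a, b, c, d, h, hS, rfl⟩

noncomputable def swp (k : Kˣ) : PGL2 K := mo 0 k 1 0 (by simp)

lemma swp_def (k : Kˣ) : swp k = mo 0 (k : K) 1 0 (by simp) := rfl

lemma rot_mul_swp (a k : Kˣ) : rot a * swp k = swp (a * k) := by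
  rw [rot_def, swp_def, swp_def, mo_mul]; congr 1 <;> simp

lemma swp_mul_rot (a k : Kˣ) : swp k * rot a = swp (k * a⁻¹) := by
  rw [rot_def, swp_def, swp_def, mo_mul]
  apply mo_eq_mo _ _ (a⁻¹ : K) (by simp) <;> simp [mul_comm]

lemma swp_mul_swp (k l : Kˣ) : swp k * swp l = rot (k * l⁻¹) := by
  rw [rot_def, swp_def, swp_def, mo_mul]
  apply mo_eq_mo _ _ (l⁻¹ : K) (by simp) <;> simp [mul_comm]

lemma swp_sq (k : Kˣ) : swp k * swp k = 1 := by rw [swp_mul_swp]; simp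

lemma swp_ne (k : Kˣ) : swp k ≠ 1 := by
  rw [swp_def, Ne, mo_eq_one_iff]; simp

lemma swp_inf (k : Kˣ) : swp k • (∞ : OnePoint K) = ((0 : K) : OnePoint K) := by
  rw [swp_def, act_inf_coe]; simp

lemma swp_zero (k : Kˣ) : swp k • ((0 : K) : OnePoint K) = ∞ := by
  rw [swp_def, act_coe_inf]; simp

lemma swp_coe (k : Kˣ) {z w : K} (h : w * z = k) : swp k • (z : OnePoint K) = (w : OnePoint K) := by
  rw [swp_def, act_coe_coe]; simp [h]

lemma swap_form {g : PGL2 K} (h : g • (∞ : OnePoint K) = ((0 : K) : OnePoint K))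
    (h0 : g • ((0 : K) : OnePoint K) = ∞) : ∃ k : Kˣ, g = swp k := by
  obtain ⟨a, b, c, d, hd, rfl⟩ := exists_mo g
  rw [act_inf_coe] at h
  rw [act_coe_inf] at h0
  have ha : a = 0 := by simpa using h
  have hd0 : d = 0 := by simpa using h0
  subst ha hd0
  have hb : b ≠ 0 := by rintro rfl; simp at hd
  have hc : c ≠ 0 := by rintro rfl; simp at hd
  refine ⟨Units.mk0 (b / c) (div_ne_zero hb hc), ?_⟩
  apply mo_eq_mo _ _ c⁻¹ (inv_ne_zero hc) <;> simp [hc, div_eq_inv_mul]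

/-- normalised position -/
structure Nrm (G : Subgroup (PGL2 K)) (e : ℕ) (ζ : Kˣ) : Prop where
  two : TwoFix G (OnePoint K)
  fin : Finite G
  card : (Nat.card G : K) ≠ 0
  es : eS G (∞ : OnePoint K) = e
  prim : IsPrimitiveRoot ζ e
  mem : rot ζ ∈ G
  iff : ∀ g ∈ G, g • (∞ : OnePoint K) = ∞ ↔ g • ((0 : K) : OnePoint K) = ((0 : K) : OnePoint K)
  stab : ∀ g ∈ G, g • (∞ : OnePoint K) = ∞ → ∃ k : ℕ, g = rot (ζ ^ k)

lemma Nrm.of [IsAlgClosed K] (h2 : (2 : K) ≠ 0) {G : Subgroup (PGL2 K)}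
    (hc : (Nat.card G : K) ≠ 0) {x x' : OnePoint K}
    (hx : ∀ g : G, g • x = x ↔ g • x' = x') {u : PGL2 K} (hux : u • x = ∞)
    (hux' : u • x' = ((0 : K) : OnePoint K)) : ∃ ζ, Nrm (Cj u G) (eS G x) ζ := by
  have hc' := Cj_hc hc u
  have := finite_hc hc'
  have e1 : eS (Cj u G) (∞ : OnePoint K) = eS G x := by rw [← hux, Cj_eS]
  have hiff : ∀ g ∈ Cj u G, g • (∞ : OnePoint K) = ∞ ↔
      g • ((0 : K) : OnePoint K) = ((0 : K) : OnePoint K) := by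
    intro g hg
    have h1 := hx ⟨_, mem_Cj.1 hg⟩
    change (u⁻¹ * g * u) • x = x ↔ (u⁻¹ * g * u) • x' = x' at h1
    rw [mul_smul, mul_smul, mul_smul, mul_smul, inv_smul_eq_iff, inv_smul_eq_iff, hux, hux'] at h1
    exact h1
  obtain ⟨ζ, h3, h4, h5⟩ := stab_form (fun g hg => (hiff g hg).1)
  exact ⟨ζ, twoFix h2 _ hc', this, hc', e1, e1 ▸ h3, h4, hiff, h5⟩

lemma Nrm.pow_mem {G : Subgroup (PGL2 K)} {e ζ} (h : Nrm G e ζ) (k : ℕ) : rot (ζ ^ k) ∈ G := by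
  rw [map_pow]; exact Subgroup.pow_mem _ h.mem _

lemma Nrm.swp_of {G : Subgroup (PGL2 K)} {e ζ} (h : Nrm G e ζ) {g : PGL2 K} {κ : Kˣ} (hκ : swp κ ∈ G)
    (hg : g ∈ G) (h0 : g • (∞ : OnePoint K) = ((0 : K) : OnePoint K)) :
    ∃ k : ℕ, g = swp (ζ ^ k * κ) := by
  have : (g⁻¹ * swp κ) • (∞ : OnePoint K) = ∞ := by
    rw [mul_smul, swp_inf, ← h0, inv_smul_smul]
  obtain ⟨k, hk⟩ := h.stab _ (mul_mem (inv_mem hg) hκ) this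
  refine ⟨k, ?_⟩
  rw [inv_mul_eq_iff_eq_mul] at hk
  rw [eq_mul_inv_iff_mul_eq.2 hk.symm, ← map_inv, swp_mul_rot, inv_inv, mul_comm]

lemma mem_GCn {ζ : Kˣ} {g : PGL2 K} : g ∈ GCn K (ζ : K) ↔ ∃ k : ℕ, g = rot (ζ ^ k) := by
  constructor
  · intro h
    obtain ⟨A, ⟨r, rfl⟩, h, rfl⟩ := img_elim h
    refine ⟨r, ?_⟩
    rw [rot_def]
    simp only [Units.val_pow_eq_pow_val]
    rfl
  · rintro ⟨k, rfl⟩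
    rw [rot_def]
    exact img_intro ⟨k, by simp⟩

lemma cyc_case [IsAlgClosed K] (h2 : (2 : K) ≠ 0) {G : Subgroup (PGL2 K)}
    (hc : (Nat.card G : K) ≠ 0) {x : OnePoint K} (hx : eS G x = Nat.card G) :
    (∃ u : PGL2 K, ∃ n : ℕ, 1 ≤ n ∧ ∃ ζ : K, IsPrimitiveRoot ζ n ∧
        (Cj u G : Set (PGL2 K)) = GCn K ζ) ∧ IsCyclic G := by
  have := finite_hc hc
  have hall : ∀ g : G, g • x = x := by
    intro g
    have : stabilizer G x = ⊤ := Subgroup.eq_top_of_card_eq _ hx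
    have : g ∈ stabilizer G x := this ▸ Subgroup.mem_top g
    exact this
  have hx' : ∃ x' : OnePoint K, x' ≠ x ∧ ∀ g : G, g • x' = x' := by
    by_cases h1 : 1 < eS G x
    · obtain ⟨x', h3, h4, -⟩ := (twoFix h2 G hc).partner h1
      exact ⟨x', h3, fun g => (h4 g).1 (hall g)⟩
    · have : Subsingleton G := by
        rw [← Finite.card_le_one_iff_subsingleton]; omega
      obtain ⟨x', hx'⟩ := exists_ne x
      exact ⟨x', hx', fun g => by rw [Subsingleton.elim g 1, one_smul]⟩
  obtain ⟨x', hne, hx'⟩ := hx'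
  obtain ⟨u, hu, hu'⟩ := exists_to_inf_zero hne.symm
  obtain ⟨ζ, hN⟩ := Nrm.of h2 hc (fun g => ⟨fun _ => hx' g, fun _ => hall g⟩) hu hu'
  have hfix : ∀ g ∈ Cj u G, g • (∞ : OnePoint K) = ∞ := by
    intro g hg
    have h1 : (u⁻¹ * g * u) • x = x := hall ⟨_, mem_Cj.1 hg⟩
    rwa [mul_smul, mul_smul, inv_smul_eq_iff, hu] at h1
  refine ⟨⟨u, _, eS_pos x, ζ, IsPrimitiveRoot.coe_units_iff.2 hN.prim, ?_⟩, ?_⟩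
  · ext g
    rw [mem_GCn]
    constructor
    · intro hg
      exact hN.stab g hg (hfix g hg)
    · rintro ⟨k, rfl⟩
      exact hN.pow_mem k
  · have : IsCyclic (Cj u G) := by
      refine ⟨⟨_, hN.mem⟩, ?_⟩
      rintro ⟨g, hg⟩
      obtain ⟨k, rfl⟩ := hN.stab g hg (hfix g hg)
      exact ⟨k, Subtype.ext (by simp)⟩
    exact isCyclic_of_surjective (Cj_equiv u G).symm (Cj_equiv u G).symm.surjective

end PD
end

section
open Matrix MulAction OnePoint

section PE0

lemma dihedral_iso {H : Type*} [Group H] [Finite H] {n : ℕ} (R S : H) (hR : R ^ n = 1)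
    (hS : S * S = 1) (hSR : S * R * S = R⁻¹) (hall : ∀ h : H, ∃ k : ℕ, h = R ^ k ∨ h = R ^ k * S)
    (hcard : Nat.card H = 2 * n) : Nonempty (H ≃* DihedralGroup n) := by
  have hfR : (zmultiplesHom (Additive H) (Additive.ofMul R)) (n : ℤ) = 0 := by
    simp only [zmultiplesHom_apply, natCast_zsmul, ← ofMul_pow, hR]; rfl
  let F : ZMod n →+ Additive H := ZMod.lift n ⟨zmultiplesHom (Additive H) (Additive.ofMul R), hfR⟩
  let f : ZMod n → H := fun i => (F i).toMul
  have hfk : ∀ k : ℤ, f (k : ZMod n) = R ^ k := by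
    intro k
    simp only [f, F]
    rw [ZMod.lift_coe]
    simp
  have hadd : ∀ i j, f (i + j) = f i * f j := fun i j => by simp [f]
  have hneg : ∀ i, f (-i) = (f i)⁻¹ := fun i => by simp [f]
  have hSf : ∀ i, S * f i * S = (f i)⁻¹ := by
    intro i
    obtain ⟨k, rfl⟩ := ZMod.intCast_surjective i
    rw [hfk]
    have hS' : S⁻¹ = S := inv_eq_of_mul_eq_one_left hS
    have : S * R ^ k * S⁻¹ = (S * R * S⁻¹) ^ k := (conj_zpow).symm
    rw [hS', hSR] at this
    rw [this, _root_.inv_zpow]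
  have hSf' : ∀ i, f i * S = S * (f i)⁻¹ := by
    intro i
    rw [← hSf i, ← mul_assoc, ← mul_assoc, hS, one_mul]
  let φ : DihedralGroup n →* H := 
    { toFun := fun d => match d with
        | .r i => f i
        | .sr i => S * f i
      map_one' := by
        change f 0 = 1
        simp [f]
      map_mul' := by
        rintro (i | i) (j | j)
        · rw [DihedralGroup.r_mul_r]
          exact hadd i j
        · rw [DihedralGroup.r_mul_sr]
          change S * f (j - i) = f i * (S * f j)
          rw [← mul_assoc, hSf', sub_eq_neg_add, hadd, hneg, mul_assoc]
        · rw [DihedralGroup.sr_mul_r]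
          change S * f (i + j) = S * f i * f j
          rw [hadd, mul_assoc]
        · rw [DihedralGroup.sr_mul_sr]
          change f (j - i) = S * f i * (S * f j)
          rw [← mul_assoc, hSf, sub_eq_neg_add, hadd, hneg] }
  have hsur : Function.Surjective φ := by
    intro h
    obtain ⟨k, rfl | rfl⟩ := hall h
    · refine ⟨.r (k : ℤ), ?_⟩
      change f _ = _
      rw [hfk]; simp
    · refine ⟨.sr (-((k : ℤ) : ZMod n)), ?_⟩
      change S * f _ = _
      rw [hneg, ← hSf', hfk]; simp
  have hn : n ≠ 0 := by
    rintro rfl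
    have := Nat.card_pos (α := H)
    omega
  have : NeZero n := ⟨hn⟩
  have hb : Function.Bijective φ := by
    rw [Nat.bijective_iff_surjective_and_card]
    exact ⟨hsur, by rw [hcard, DihedralGroup.nat_card]⟩
  exact ⟨(MulEquiv.ofBijective φ hb).symm⟩
end PE0

section PE
variable {K : Type*} [Field K]

lemma swap_setup [IsAlgClosed K] (h2 : (2 : K) ≠ 0) {G : Subgroup (PGL2 K)}
    (hc : (Nat.card G : K) ≠ 0) {x x' : OnePoint K} (hx : 1 < eS G x) (hne : x' ≠ x)
    (h1 : ∀ g : G, g • x = x ↔ g • x' = x')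
    (h3 : ∀ g : G, g ≠ 1 → g • x = x → ∀ z, g • z = z → z = x ∨ z = x')
    (ho : x' ∈ orbit G x) (c : Kˣ) :
    ∃ u ζ, u • x = ∞ ∧ u • x' = ((0 : K) : OnePoint K) ∧ Nrm (Cj u G) (eS G x) ζ ∧
      swp (c ^ 2) ∈ Cj u G := by
  have := finite_hc hc
  obtain ⟨s, hs⟩ := ho
  change s • x = x' at hs
  have hs' : s • x' = x := TwoFix.partner_map h1 h3 (eS_gt_one.1 hx) hne hs
  obtain ⟨z, hz⟩ := exists_fix h2 (s : PGL2 K)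
  have hz : s • z = z := hz
  have hzx : z ≠ x := by rintro rfl; exact hne (hs.symm.trans hz)
  have hzx' : z ≠ x' := by rintro rfl; exact hne (hz.symm.trans hs')
  obtain ⟨u, hu, hu', huz⟩ := exists_to_three hne.symm hzx hzx' c.ne_zero
  obtain ⟨ζ, hN⟩ := Nrm.of h2 hc h1 hu hu'
  refine ⟨u, ζ, hu, hu', hN, ?_⟩
  have hm := Cj_mem (u := u) s.2
  have tr : ∀ y y' : OnePoint K, s • y = y' → (u * s * u⁻¹) • u • y = u • y' := by
    intro y y' h
    have h : (s : PGL2 K) • y = y' := h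
    rw [mul_smul, mul_smul, inv_smul_smul, h]
  have a1 := tr _ _ hs
  have a2 := tr _ _ hs'
  have a3 := tr _ _ hz
  rw [hu, hu'] at a1 a2
  rw [huz] at a3
  obtain ⟨k, hk⟩ := swap_form a1 a2
  rw [hk] at hm a3
  rw [swp_def, act_coe_coe] at a3
  convert hm using 2
  ext
  simp at a3 ⊢
  rw [a3]; ring

lemma mem_GD2n {ζ : Kˣ} {g : PGL2 K} :
    g ∈ GD2n K (ζ : K) ↔ ∃ k : ℕ, g = rot (ζ ^ k) ∨ g = swp (ζ ^ k) := by
  constructor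
  · intro h
    obtain ⟨A, ⟨r, rfl | rfl⟩, h, rfl⟩ := img_elim h
    · refine ⟨r, Or.inl ?_⟩
      rw [rot_def]
      simp only [Units.val_pow_eq_pow_val]
      rfl
    · refine ⟨r, Or.inr ?_⟩
      rw [swp_def]
      simp only [Units.val_pow_eq_pow_val]
      rfl
  · rintro ⟨k, rfl | rfl⟩
    · rw [rot_def]
      exact img_intro ⟨k, by simp⟩
    · rw [swp_def]
      exact img_intro ⟨k, by simp⟩

lemma GV4_eq : GV4 K = GD2n K (-1) := by
  unfold GV4 GD2n
  congr 1
  ext A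
  constructor
  · rintro (h | h | h | h)
    · exact ⟨0, Or.inl (by simpa using h)⟩
    · exact ⟨1, Or.inl (by simpa using h)⟩
    · exact ⟨0, Or.inr (by simpa using h)⟩
    · exact ⟨1, Or.inr (by simpa using h)⟩
  · rintro ⟨k, h⟩
    rcases neg_one_pow_eq_or K k with e | e <;> rw [e] at h <;> rcases h with h | h <;> simp [h]

lemma dih_case [IsAlgClosed K] (h2 : (2 : K) ≠ 0) {G : Subgroup (PGL2 K)}
    (hc : (Nat.card G : K) ≠ 0) {x : OnePoint K} {n : ℕ} (hn : 2 ≤ n) (hG : Nat.card G = 2 * n)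
    (hx : eS G x = n) :
    (∃ u : PGL2 K, ∃ ζ : K, IsPrimitiveRoot ζ n ∧
        (Cj u G : Set (PGL2 K)) = GD2n K ζ) ∧ Nonempty (G ≃* DihedralGroup n) := by
  have := finite_hc hc
  have hx1 : 1 < eS G x := by omega
  obtain ⟨x', hne, h1, h3⟩ := (twoFix h2 G hc).partner hx1
  have ho2 : (orbit G x).ncard = 2 := by
    have := eS_orbit_mul (G := G) x
    rw [hx, hG] at this
    exact Nat.eq_of_mul_eq_mul_right (by omega) this
  obtain ⟨y, hy, hyx⟩ : ∃ y ∈ orbit G x, y ≠ x :=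
    Set.exists_ne_of_one_lt_ncard (by omega) x
  have horb : orbit G x = {x, y} := by
    symm
    apply Set.eq_of_subset_of_ncard_le
    · intro w hw
      rcases hw with rfl | rfl
      · exact mem_orbit_self _
      · exact hy
    · rw [ho2, Set.ncard_pair hyx.symm]
    · exact orbit_finite x
  have hyx' : y = x' := by
    obtain ⟨g, hg, hgx⟩ := eS_gt_one.1 hx1
    have hgy : g • y ∈ orbit G x := (orbit G x).mem_of_eq_of_mem rfl (by
      obtain ⟨k, rfl⟩ := hy
      exact ⟨g * k, by simp [mul_smul]⟩)
    rw [horb] at hgy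
    rcases hgy with h | h
    · exfalso
      rw [← hgx] at h
      apply hyx
      exact smul_left_cancel _ h
    · exact (h3 g hg hgx y h).resolve_left hyx
  subst hyx'
  obtain ⟨u, ζ, hu, hu', hN, hs⟩ := swap_setup h2 hc hx1 hne h1 h3 hy 1
  rw [one_pow] at hs
  rw [hx] at hN
  have key : ∀ g ∈ Cj u G, ∃ k : ℕ, g = rot (ζ ^ k) ∨ g = swp (ζ ^ k) := by
    intro g hg
    have : g • (∞ : OnePoint K) = ∞ ∨ g • (∞ : OnePoint K) = ((0 : K) : OnePoint K) := by
      have h4 : (u⁻¹ * g * u) • x ∈ orbit G x := mem_orb.2 ⟨_, mem_Cj.1 hg, rfl⟩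
      rw [horb] at h4
      rcases h4 with h4 | h4
      · left; rwa [mul_smul, mul_smul, inv_smul_eq_iff, hu] at h4
      · right
        have h4 : _ = _ := h4
        rwa [mul_smul, mul_smul, inv_smul_eq_iff, hu, hu'] at h4
    rcases this with h | h
    · obtain ⟨k, hk⟩ := hN.stab g hg h
      exact ⟨k, Or.inl hk⟩
    · obtain ⟨k, hk⟩ := hN.swp_of hs hg h
      exact ⟨k, Or.inr (by rwa [mul_one] at hk)⟩
  refine ⟨⟨u, ζ, IsPrimitiveRoot.coe_units_iff.2 hN.prim, ?_⟩, ?_⟩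
  · ext g
    rw [mem_GD2n]
    constructor
    · exact key g
    · rintro ⟨k, rfl | rfl⟩
      · exact hN.pow_mem k
      · have := mul_mem (hN.pow_mem k) hs
        rwa [rot_mul_swp, mul_one] at this
  · have hfin := hN.fin
    have : Nonempty (Cj u G ≃* DihedralGroup n) := by
      refine dihedral_iso ⟨_, hN.mem⟩ ⟨_, hs⟩ ?_ ?_ ?_ ?_ (by rw [Cj_card, hG])
      · apply Subtype.ext
        change rot ζ ^ n = 1
        rw [← map_pow, hN.prim.pow_eq_one, map_one]
      · exact Subtype.ext (swp_sq 1)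
      · apply Subtype.ext
        change swp 1 * rot ζ * swp 1 = (rot ζ)⁻¹
        rw [swp_mul_rot, swp_mul_swp, ← map_inv]; simp
      · rintro ⟨g, hg⟩
        obtain ⟨k, rfl | rfl⟩ := key g hg
        · exact ⟨k, Or.inl (Subtype.ext (by simp))⟩
        · refine ⟨k, Or.inr (Subtype.ext ?_)⟩
          change swp (ζ ^ k) = rot ζ ^ k * swp 1
          rw [← map_pow, rot_mul_swp, mul_one]
    exact ⟨(Cj_equiv u G).trans this.some⟩

end PE
end

section
open Matrix MulAction OnePoint

section PF
variable {K : Type*} [Field K]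

lemma mem_conv {H : Subgroup (PGL2 K)} {a b c d a' b' c' d' : K} {h}
    (hm : mo a b c d h ∈ H) (h' : (!![a', b'; c', d']).det ≠ 0) (l : K) (hl : l ≠ 0)
    (ha : a' = l * a) (hb : b' = l * b) (hc : c' = l * c) (hd : d' = l * d) :
    toPGL2 K (GeneralLinearGroup.mkOfDetNeZero !![a', b'; c', d'] h') ∈ H := by
  have : toPGL2 K (GeneralLinearGroup.mkOfDetNeZero !![a', b'; c', d'] h') =
    mo a' b' c' d' (by rwa [det_fin_two_of] at h') := rfl
  rw [this, ← mo_eq_mo h _ l hl ha hb hc hd]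
  exact hm

lemma mem_conv' {H : Subgroup (PGL2 K)} {a b c d a' b' c' d' : K} {h}
    (hm : mo a b c d h ∈ H) (l : K) (hl : l ≠ 0) {h'}
    (ha : a' = l * a) (hb : b' = l * b) (hc : c' = l * c) (hd : d' = l * d) :
    mo a' b' c' d' h' ∈ H := by
  rw [← mo_eq_mo h _ l hl ha hb hc hd]
  exact hm

/-- partner transport -/
lemma Nrm.part {H : Subgroup (PGL2 K)} {e ζ} (hN : Nrm H e ζ) {g k : PGL2 K} (hg : g ∈ H)
    (hk : k ∈ H) (hk1 : k ≠ 1) {p p' : OnePoint K} (hp : k • p = p) (hp' : k • p' = p')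
    (hne : p' ≠ p) (hgp : g • (∞ : OnePoint K) = p) : g • ((0 : K) : OnePoint K) = p' := by
  have e1 : (g⁻¹ * k * g) • (∞ : OnePoint K) = ∞ := by
    rw [mul_smul, mul_smul, hgp, hp, ← hgp, inv_smul_smul]
  have hm : g⁻¹ * k * g ∈ H := mul_mem (mul_mem (inv_mem hg) hk) hg
  obtain ⟨n, hn⟩ := hN.stab _ hm e1
  have ha : (ζ ^ n : Kˣ) ≠ 1 := by
    intro h0
    rw [h0, map_one, mul_assoc, inv_mul_eq_one] at hn
    apply hk1
    simpa using hn.symm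
  have e2 : (g⁻¹ * k * g) • g⁻¹ • p' = g⁻¹ • p' := by
    rw [mul_smul, mul_smul, smul_inv_smul, hp']
  rw [hn] at e2
  have hni : g⁻¹ • p' ≠ ∞ := by
    rw [Ne, inv_smul_eq_iff, hgp]; exact hne
  obtain ⟨z, hz⟩ := OnePoint.ne_infty_iff_exists.1 hni
  rw [← hz, rot_coe, OnePoint.coe_eq_coe] at e2
  have hz0 : z = 0 := by
    have h1 : (((ζ ^ n : Kˣ) : K) - 1) * z = 0 := by linear_combination e2
    rcases mul_eq_zero.1 h1 with h | h
    · exfalso; apply ha; ext; simpa using sub_eq_zero.1 h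
    · exact h
  subst hz0
  rw [hz, smul_inv_smul]

lemma Nrm.coset {H : Subgroup (PGL2 K)} {e ζ} (hN : Nrm H e ζ) {g k : PGL2 K} (hg : g ∈ H)
    (hk : k ∈ H) (h : g • (∞ : OnePoint K) = k • ∞) : ∃ n : ℕ, g = k * rot (ζ ^ n) := by
  obtain ⟨n, hn⟩ := hN.stab (k⁻¹ * g) (mul_mem (inv_mem hk) hg) (by
    rw [mul_smul, h, inv_smul_smul])
  exact ⟨n, by rw [← hn, mul_inv_cancel_left]⟩

lemma Nrm.orb_card {H : Subgroup (PGL2 K)} {e ζ} (hN : Nrm H e ζ) :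
    (orbit H (∞ : OnePoint K)).ncard * e = Nat.card H := by
  have := hN.fin
  rw [← hN.es, eS_orbit_mul]

lemma Nrm.pows {H : Subgroup (PGL2 K)} {e ζ} (hN : Nrm H e ζ) {a b c : ℕ}
    (ht : Tri H (OnePoint K) a b c) {g : PGL2 K} (hg : g ∈ H) (hg1 : g ≠ 1) :
    g ^ a = 1 ∨ g ^ b = 1 ∨ g ^ c = 1 := by
  have hg1' : (⟨g, hg⟩ : H) ≠ 1 := fun h => hg1 (congrArg Subtype.val h)
  obtain ⟨x, y, -, hf⟩ := hN.two.two ⟨g, hg⟩ hg1'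
  have hx : (⟨g, hg⟩ : H) • x = x := (hf x).2 (Or.inl rfl)
  have hp := congrArg Subtype.val (pow_eS hx)
  simp only [SubmonoidClass.mk_pow, Subgroup.coe_one] at hp
  rcases ht.eS_mem hg1' hx with h | h | h <;> rw [h] at hp <;> tauto

lemma prim4 (h2 : (2 : K) ≠ 0) {i : K} (hi : i ^ 2 = -1) : IsPrimitiveRoot i 4 := by
  have := orderOf_eq_prime_pow (x := i) (p := 2) (n := 1) (by
    rw [pow_one, hi]; intro h; apply h2; linear_combination -h) (by
    rw [show 2 ^ (1 + 1) = 2 * 2 from rfl, pow_mul, hi]; norm_num)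
  rw [show 4 = orderOf i by rw [this]; rfl]
  exact IsPrimitiveRoot.orderOf i

lemma prim2 {z : Kˣ} (h : IsPrimitiveRoot z 2) : z = -1 := by
  have := (IsPrimitiveRoot.coe_units_iff.2 h).eq_neg_one_of_two_right
  ext; simpa using this

lemma partner_eS {G X : Type*} [Group G] [MulAction G X] {x x' : X}
    (h : ∀ g : G, g • x = x ↔ g • x' = x') : eS G x' = eS G x := by
  unfold eS
  rw [show stabilizer G x' = stabilizer G x by ext g; simp [mem_stabilizer_iff, h]]

/-- the orbit -/
lemma A4_orb (h2 : (2 : K) ≠ 0) {i : K} (hi : i ^ 2 = -1) {H : Subgroup (PGL2 K)} {ζ}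
    (hN : Nrm H 2 ζ) (hs : ∀ κ : Kˣ, κ ^ 2 = 1 → swp κ ∈ H)
    (hcard : Nat.card H = 12) (ht : Tri H (OnePoint K) 2 3 3) (w : OnePoint K) :
    w ∈ orbit H (∞ : OnePoint K) ↔ w = ∞ ∨ w = ((0 : K) : OnePoint K) ∨
      ∃ q : K, q ^ 4 = 1 ∧ w = (q : OnePoint K) := by
  have := hN.fin
  have key : ∀ q : K, q ^ 4 = 1 → (q : OnePoint K) ∈ orbit H (∞ : OnePoint K) := by
    intro q hq
    have hq0 : q ≠ 0 := by rintro rfl; simp at hq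
    have hm := hs (Units.mk0 q hq0 ^ 2) (by ext; push_cast; rw [Units.val_mk0]; linear_combination hq)
    have hf : swp (Units.mk0 q hq0 ^ 2) • (q : OnePoint K) = q := swp_coe _ (by push_cast; rw [Units.val_mk0]; ring)
    have hne : (⟨_, hm⟩ : H) ≠ 1 := fun h => swp_ne _ (congrArg Subtype.val h)
    have hf' : (⟨_, hm⟩ : H) • (q : OnePoint K) = q := hf
    have h2' : eS H (q : OnePoint K) = 2 := by
      have h3 : ¬ eS H (q : OnePoint K) = 3 := by
        intro h3
        have := congrArg Subtype.val (pow_eS hf')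
        rw [h3] at this
        simp only [SubmonoidClass.mk_pow, Subgroup.coe_one] at this
        rw [pow_succ, pow_two, swp_sq, one_mul] at this
        exact swp_ne _ this
      have := ht.eS_mem hne hf'
      tauto
    exact ht.orb (by norm_num) (by norm_num) (by norm_num) hN.es h2'
  have h0 : ((0 : K) : OnePoint K) ∈ orbit H (∞ : OnePoint K) :=
    mem_orb.2 ⟨_, hs 1 (by simp), swp_inf 1⟩
  have hi0 : i ≠ 0 := by rintro rfl; simp at hi
  have h11 : (1 : K) ≠ -1 := by intro h; apply h2; linear_combination h
  have hi1 : i ≠ 1 := by rintro rfl; apply h11; linear_combination hi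
  have hi1' : i ≠ -1 := by rintro rfl; apply h11; linear_combination hi
  have hii : i ≠ -i := by
    intro h
    have : 2 * i = 0 := by linear_combination h
    simp [h2, hi0] at this
  have hn : ({∞, ((0 : K) : OnePoint K), ((1 : K) : OnePoint K), ((-1 : K) : OnePoint K),
      (i : OnePoint K), ((-i : K) : OnePoint K)} : Set (OnePoint K)).ncard = 6 := by
    classical
    have e : ({∞, ((0 : K) : OnePoint K), ((1 : K) : OnePoint K), ((-1 : K) : OnePoint K),
      (i : OnePoint K), ((-i : K) : OnePoint K)} : Set (OnePoint K)) = 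
      (({∞, ((0 : K) : OnePoint K), ((1 : K) : OnePoint K), ((-1 : K) : OnePoint K),
      (i : OnePoint K), ((-i : K) : OnePoint K)} : Finset (OnePoint K)) : Set (OnePoint K)) := by
      simp
    rw [e, Set.ncard_coe_finset]
    have a1 : ¬ (-1 : K) = i := fun h => hi1' h.symm
    have a2 : ¬ (1 : K) = i := fun h => hi1 h.symm
    have a3 : ¬ (1 : K) = -i := by intro h; apply hi1'; linear_combination h
    have a5 : ¬ (0 : K) = i := fun h => hi0 h.symm
    have a6 : ¬ (0 : K) = 1 := zero_ne_one
    have a7 : ∀ z : K, ¬ (∞ : OnePoint K) = z := fun z => OnePoint.infty_ne_coe z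
    simp only [Finset.card_insert_eq_ite, Finset.mem_insert, Finset.mem_singleton, 
      OnePoint.coe_eq_coe, a1, a2, a3, a5, a7, h11, hii, Finset.card_singleton,
      zero_eq_neg, one_ne_zero, a6, neg_inj, hi0]
    norm_num
  have hO := hN.orb_card
  rw [hcard] at hO
  have hsub : ({∞, ((0 : K) : OnePoint K), ((1 : K) : OnePoint K), ((-1 : K) : OnePoint K),
      (i : OnePoint K), ((-i : K) : OnePoint K)} : Set (OnePoint K)) = orbit H (∞ : OnePoint K) := by
    apply Set.eq_of_subset_of_ncard_le
    · rintro w (rfl | rfl | rfl | rfl | rfl | rfl)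
      · exact mem_orbit_self _
      · exact h0
      · exact key _ (by simp)
      · exact key _ (by norm_num)
      · exact key _ (by rw [show 4 = 2 * 2 from rfl, pow_mul, hi]; norm_num)
      · exact key _ (by rw [show 4 = 2 * 2 from rfl, pow_mul, neg_sq, hi]; norm_num)
    · rw [hn]; omega
    · exact orbit_finite _
  constructor
  · intro hw
    rw [← hsub] at hw
    rcases hw with rfl | rfl | rfl | rfl | rfl | rfl
    · tauto
    · tauto
    · exact Or.inr (Or.inr ⟨_, by simp, rfl⟩)
    · exact Or.inr (Or.inr ⟨_, by norm_num, rfl⟩)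
    · exact Or.inr (Or.inr ⟨_, by rw [show 4 = 2 * 2 from rfl, pow_mul, hi]; norm_num, rfl⟩)
    · exact Or.inr (Or.inr ⟨_, by rw [show 4 = 2 * 2 from rfl, pow_mul, neg_sq, hi]; norm_num, rfl⟩)
  · rintro (rfl | rfl | ⟨q, hq, rfl⟩)
    · exact mem_orbit_self _
    · exact h0
    · exact key q hq

end PF
end

section
open Matrix MulAction OnePoint

section PG
variable {K : Type*} [Field K]

lemma units_sq_one {κ : Kˣ} (h : κ ^ 2 = 1) : κ = 1 ∨ κ = -1 := by
  have : (κ : K) ^ 2 = 1 := by rw [← Units.val_pow_eq_pow_val, h]; simp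
  rcases sq_eq_one_iff.1 this with h | h
  · left; ext; simpa using h
  · right; ext; simpa using h

lemma A4_nf (h2 : (2 : K) ≠ 0) {i : K} (hi : i ^ 2 = -1) {H : Subgroup (PGL2 K)} {ζ}
    (hN : Nrm H 2 ζ) (hs1 : swp 1 ∈ H)
    (hcard : Nat.card H = 12) (ht : Tri H (OnePoint K) 2 3 3) :
    (H : Set (PGL2 K)) = GA4 K i := by
  have := hN.fin
  obtain rfl := prim2 hN.prim
  have hr : rot (-1) ∈ H := hN.mem
  have hsm : swp (-1) ∈ H := by
    have := mul_mem hr hs1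
    rwa [rot_mul_swp, mul_one] at this
  have hs : ∀ κ : Kˣ, κ ^ 2 = 1 → swp κ ∈ H := by
    intro κ hκ
    rcases units_sq_one hκ with rfl | rfl
    · exact hs1
    · exact hsm
  have horb := A4_orb h2 hi hN hs hcard ht
  have hi0 : i ≠ 0 := by rintro rfl; simp at hi
  have h11 : (1 : K) ≠ -1 := by intro h; apply h2; linear_combination h
  have hi3 : i ^ 3 = -i := by linear_combination i * hi
  have hd : (1 : K) * i - (-i) * 1 ≠ 0 := by
    rw [show (1 : K) * i - (-i) * 1 = 2 * i by ring]; exact mul_ne_zero h2 hi0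
  have hrd : rot (-1 : Kˣ) = mo (-1 : K) 0 0 1 (by simp) := by rw [rot_def]; simp
  -- the basic element
  have hg1 : mo 1 (-i) 1 i hd ∈ H := by
    obtain ⟨g, hg, hgi⟩ := mem_orb.1 ((horb ((1 : K) : OnePoint K)).2
      (Or.inr (Or.inr ⟨1, by simp, rfl⟩)))
    have hg0 : g • ((0 : K) : OnePoint K) = ((-1 : K) : OnePoint K) := by
      refine hN.part hg hs1 (swp_ne 1) (swp_coe _ (by simp)) (swp_coe _ (by simp)) ?_ hgi
      rw [Ne, OnePoint.coe_eq_coe]; exact h11.symm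
    obtain ⟨a, b, c, d, hdet, rfl⟩ := exists_mo g
    rw [act_inf_coe] at hgi
    rw [act_coe_coe] at hg0
    have hc : c ≠ 0 := by
      rintro rfl
      apply hdet; rw [hgi]; ring
    have hinv : (mo a b c d hdet) • ((-(d / c) : K) : OnePoint K) = ∞ := by
      rw [act_coe_inf]; field_simp; ring
    have hmem : ((-(d / c) : K) : OnePoint K) ∈ orbit H (∞ : OnePoint K) :=
      mem_orb.2 ⟨_, inv_mem hg, by rw [← hinv, inv_smul_smul]⟩
    have ht4 : (d / c) ^ 4 = 1 := by
      rcases (horb _).1 hmem with h | h | ⟨q, hq, h⟩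
      · exact absurd h (OnePoint.coe_ne_infty _)
      · rw [OnePoint.coe_eq_coe] at h
        exfalso
        have : d = 0 := by simpa [hc] using h
        apply hdet
        rw [this] at hg0 ⊢
        have : b = 0 := by linear_combination hg0
        rw [this]; ring
      · rw [OnePoint.coe_eq_coe] at h
        rw [← hq, ← h]; ring
    generalize hT : d / c = t at *
    have hd' : d = t * c := by rw [← hT]; field_simp
    have ha' : a = c := by linear_combination hgi
    have hb' : b = - (t * c) := by linear_combination hg0 - hd'
    subst hd' ha' hb'
    have ht0 : t ≠ 0 := by rintro rfl; simp at ht4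
    have hdt : (1 : K) * t - (-t) * 1 ≠ 0 := by
      rw [show (1 : K) * t - (-t) * 1 = 2 * t by ring]; exact mul_ne_zero h2 ht0
    have hgt : mo 1 (-t) 1 t hdt ∈ H := by
      refine mem_conv' hg a⁻¹ (inv_ne_zero hc) ?_ ?_ ?_ ?_ <;> field_simp
    have hdt' : (1 : K) * (-t) - t * 1 ≠ 0 := by
      rw [show (1 : K) * (-t) - t * 1 = - (2 * t) by ring]; exact neg_ne_zero.2 (mul_ne_zero h2 ht0)
    have hgt' : mo 1 t 1 (-t) hdt' ∈ H := by
      have := mul_mem hgt hr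
      rw [hrd, mo_mul] at this
      refine mem_conv' this (-1) (by simp) ?_ ?_ ?_ ?_ <;> ring
    have ht2 : (t ^ 2 - 1) * (t ^ 2 + 1) = 0 := by linear_combination ht4
    rcases mul_eq_zero.1 ht2 with h | h
    · exfalso
      have h1m : (1 : K) * 1 - (-1) * 1 ≠ 0 := by
        rw [show (1 : K) * 1 - (-1) * 1 = 2 by ring]; exact h2
      have hk : mo 1 (-1) 1 1 h1m ∈ H := by
        have h' : (t - 1) * (t + 1) = 0 := by linear_combination h
        rcases mul_eq_zero.1 h' with h | h
        · refine mem_conv' hgt 1 (by simp) ?_ ?_ ?_ ?_ <;> grind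
        · refine mem_conv' hgt' 1 (by simp) ?_ ?_ ?_ ?_ <;> grind
      have hp := hN.pows ht hk (by rw [Ne, mo_eq_one_iff]; simp)
      rw [or_self, pow_succ _ 2, pow_two, mo_mul, mo_mul, mo_eq_one_iff, mo_eq_one_iff] at hp
      rcases hp with h | h
      · apply h2; linear_combination - h.1
      · apply h2; linear_combination - h.1
    · have h' : (t - i) * (t + i) = 0 := by linear_combination h - hi
      rcases mul_eq_zero.1 h' with h | h
      · refine mem_conv' hgt 1 (by simp) ?_ ?_ ?_ ?_ <;> grind
      · refine mem_conv' hgt' 1 (by simp) ?_ ?_ ?_ ?_ <;> grind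
  have hL : ∀ {a b c d : K} {h}, mo a b c d h ∈ H → ∀ {h'}, mo (-a) (-b) c d h' ∈ H := by
    intro a b c d h hm h'
    have := mul_mem hr hm
    rw [hrd, mo_mul] at this
    refine mem_conv' this 1 (by simp) ?_ ?_ ?_ ?_ <;> ring
  have hR : ∀ {a b c d : K} {h}, mo a b c d h ∈ H → ∀ {h'}, mo a (-b) c (-d) h' ∈ H := by
    intro a b c d h hm h'
    have := mul_mem hm hr
    rw [hrd, mo_mul] at this
    refine mem_conv' this (-1) (by simp) ?_ ?_ ?_ ?_ <;> ring
  have hdq : ∀ q : K, q = i ∨ q = -i → q ≠ 0 ∧ q ^ 2 = -1 := by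
    rintro q (rfl | rfl)
    · exact ⟨hi0, hi⟩
    · exact ⟨neg_ne_zero.2 hi0, by rw [neg_sq, hi]⟩
  have f1 : ∀ q : K, q = i ∨ q = -i → ∀ {h}, mo 1 q 1 (-q) h ∈ H := by
    rintro q (rfl | rfl) h
    · have := hR hg1 (h' := by rwa [neg_neg])
      refine mem_conv' this 1 (by simp) ?_ ?_ ?_ ?_ <;> ring
    · refine mem_conv' hg1 1 (by simp) ?_ ?_ ?_ ?_ <;> ring
  have f2 : ∀ q : K, q = i ∨ q = -i → ∀ {h}, mo (-1) (-q) 1 (-q) h ∈ H := by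
    intro q hq h
    exact hL (f1 q hq (h := by intro h0; apply h; linear_combination -h0))
  have f3 : ∀ q : K, q = i ∨ q = -i → ∀ {h}, mo q q 1 (-1) h ∈ H := by
    intro q hq h
    obtain ⟨q0, q2⟩ := hdq q hq
    have hd' : (1 : K) * (-q) - q * 1 ≠ 0 := by
      intro h0; apply h; linear_combination h0
    have := inv_mem (f1 q hq (h := hd'))
    rw [mo_inv] at this
    refine mem_conv' this (-1) (by simp) ?_ ?_ ?_ ?_ <;> ring
  have f4 : ∀ q : K, q = i ∨ q = -i → ∀ {h}, mo q (-q) 1 1 h ∈ H := by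
    intro q hq h
    have := hR (f3 q hq (h := by intro h0; apply h; linear_combination -h0)) (h' := by rwa [neg_neg])
    refine mem_conv' this 1 (by simp) ?_ ?_ ?_ ?_ <;> ring
  have hpow : ∀ q : K, q = i ∨ q = -i → ∃ ν ∈ ({1, 3} : Set ℕ), i ^ ν = q := by
    rintro q (rfl | rfl)
    · exact ⟨1, by simp, by simp⟩
    · exact ⟨3, by simp, hi3⟩
  have hpow' : ∀ ν ∈ ({1, 3} : Set ℕ), i ^ ν = i ∨ i ^ ν = -i := by
    rintro ν (rfl | rfl)
    · left; simp
    · right; exact hi3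
  have hcos : ∀ g ∈ H, ∀ a b c d h, mo a b c d h ∈ H → g • (∞ : OnePoint K) = mo a b c d h • ∞ →
      g = mo a b c d h ∨ ∃ h', g = mo a (-b) c (-d) h' := by
    intro g hg a b c d h hm he
    obtain ⟨n, hn⟩ := hN.coset hg hm he
    rcases neg_one_pow_eq_or Kˣ n with e | e <;> rw [e] at hn
    · left; simpa using hn
    · right
      rw [hrd, mo_mul] at hn
      refine ⟨by intro h0; apply h; linear_combination -h0, ?_⟩
      rw [hn]
      apply mo_eq_mo _ _ (-1) (by simp) <;> ring
  apply Set.Subset.antisymm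
  · intro g hg
    rcases (horb (g • ∞)).1 (mem_orb.2 ⟨g, hg, rfl⟩) with h | h | ⟨q, hq, h⟩
    · obtain ⟨k, rfl⟩ := hN.stab g hg h
      rcases neg_one_pow_eq_or Kˣ k with e | e <;> rw [e, rot_def]
      · exact img_intro (Or.inl (Or.inl (by simp)))
      · exact img_intro (Or.inl (Or.inr (Or.inl (by simp))))
    · obtain ⟨k, rfl⟩ := hN.swp_of hs1 hg h
      rcases neg_one_pow_eq_or Kˣ k with e | e <;> rw [e, swp_def]
      · exact img_intro (Or.inl (Or.inr (Or.inr (Or.inl (by simp)))))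
      · exact img_intro (Or.inl (Or.inr (Or.inr (Or.inr (by simp)))))
    · have hq' : (q - 1) * ((q + 1) * ((q - i) * (q + i))) = 0 := by
        linear_combination hq - (q ^ 2 - 1) * hi
      have hdi : (1 : K) * (-i) - i * 1 ≠ 0 := by
        rw [show (1 : K) * (-i) - i * 1 = - (2 * i) by ring]
        exact neg_ne_zero.2 (mul_ne_zero h2 hi0)
      have hdi' : (-1 : K) * (-i) - (-i) * 1 ≠ 0 := by
        rw [show (-1 : K) * (-i) - (-i) * 1 = 2 * i by ring]
        exact mul_ne_zero h2 hi0
      have hsgn : ∀ q : K, q = i ∨ q = -i → -q = i ∨ -q = -i := by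
        rintro q (rfl | rfl)
        · right; rfl
        · left; simp
      have c3 : (q = i ∨ q = -i) → g ∈ GA4 K i := by
        intro hqi
        obtain ⟨q0, q2⟩ := hdq q hqi
        have hd3 : q * (-1) - q * 1 ≠ 0 := by
          rw [show q * (-1) - q * 1 = - (2 * q) by ring]
          exact neg_ne_zero.2 (mul_ne_zero h2 q0)
        obtain ⟨ν, hν, rfl⟩ := hpow q hqi
        rcases hcos g hg _ _ _ _ _ (f3 _ hqi (h := hd3)) (by
          rw [h, eq_comm, act_inf_coe]; simp) with rfl | ⟨h', rfl⟩
        · exact img_intro (Or.inr ⟨ν, hν, Or.inl rfl⟩)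
        · exact img_intro (Or.inr ⟨ν, hν, Or.inr (Or.inl (by simp))⟩)
      rcases mul_eq_zero.1 hq' with hq1 | hq1
      · obtain rfl : q = 1 := by linear_combination hq1
        rcases hcos g hg _ _ _ _ _ (f1 i (Or.inl rfl) (h := hdi)) (by
          rw [h, eq_comm, act_inf_coe]; simp) with rfl | ⟨h', rfl⟩
        · obtain ⟨ν, hν, e⟩ := hpow i (Or.inl rfl)
          exact img_intro (Or.inr ⟨ν, hν, Or.inr (Or.inr (Or.inl (by simp [e])))⟩)
        · obtain ⟨ν, hν, e⟩ := hpow (-i) (Or.inr rfl)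
          exact img_intro (Or.inr ⟨ν, hν, Or.inr (Or.inr (Or.inl (by simp [e])))⟩)
      rcases mul_eq_zero.1 hq1 with hq1 | hq1
      · obtain rfl : q = -1 := by linear_combination hq1
        rcases hcos g hg _ _ _ _ _ (f2 i (Or.inl rfl) (h := hdi')) (by
          rw [h, eq_comm, act_inf_coe]; simp) with rfl | ⟨h', rfl⟩
        · obtain ⟨ν, hν, e⟩ := hpow i (Or.inl rfl)
          exact img_intro (Or.inr ⟨ν, hν, Or.inr (Or.inr (Or.inr (by simp [e])))⟩)
        · obtain ⟨ν, hν, e⟩ := hpow (-i) (Or.inr rfl)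
          exact img_intro (Or.inr ⟨ν, hν, Or.inr (Or.inr (Or.inr (by simp [e])))⟩)
      rcases mul_eq_zero.1 hq1 with hq1 | hq1
      · exact c3 (Or.inl (by linear_combination hq1))
      · exact c3 (Or.inr (by linear_combination hq1))
  · intro g hg
    obtain ⟨A, hA, h, rfl⟩ := img_elim hg
    rcases hA with (rfl | rfl | rfl | rfl) | ⟨ν, hν, rfl | rfl | rfl | rfl⟩
    · have := H.one_mem
      rw [← map_one rot, rot_def] at this
      exact mem_conv this h 1 (by simp) (by simp) (by simp) (by simp) (by simp)
    · rw [rot_def] at hr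
      exact mem_conv hr h 1 (by simp) (by simp) (by simp) (by simp) (by simp)
    · rw [swp_def] at hs1
      exact mem_conv hs1 h 1 (by simp) (by simp) (by simp) (by simp) (by simp)
    · rw [swp_def] at hsm
      exact mem_conv hsm h 1 (by simp) (by simp) (by simp) (by simp) (by simp)
    all_goals have hh := h; rw [det_fin_two_of] at hh
    · exact f3 _ (hpow' ν hν) (h := hh)
    · exact f4 _ (hpow' ν hν) (h := hh)
    · exact f1 _ (hpow' ν hν) (h := hh)
    · exact f2 _ (hpow' ν hν) (h := hh)

lemma A4_case [IsAlgClosed K] (h2 : (2 : K) ≠ 0) {G : Subgroup (PGL2 K)}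
    (hc : (Nat.card G : K) ≠ 0) (hG : Nat.card G = 12) (ht : Tri G (OnePoint K) 2 3 3) :
    ∃ u : PGL2 K, ∃ i : K, IsPrimitiveRoot i 4 ∧ (Cj u G : Set (PGL2 K)) = GA4 K i := by
  have := finite_hc hc
  obtain ⟨x, -, -, hx, -⟩ := id ht
  obtain ⟨x', hne, h1, h3⟩ := (twoFix h2 G hc).partner (y := x) (by omega)
  have ho : x' ∈ orbit G x := ht.orb (by norm_num) (by norm_num) (by norm_num) hx
    (by rw [partner_eS h1, hx])
  obtain ⟨u, ζ, hu, hu', hN, hs⟩ := swap_setup h2 hc (by omega) hne h1 h3 ho 1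
  obtain ⟨i, hi⟩ := IsAlgClosed.exists_pow_nat_eq (-1 : K) (n := 2) (by norm_num)
  rw [one_pow] at hs
  rw [hx] at hN
  exact ⟨u, i, prim4 h2 hi, A4_nf h2 hi hN hs (by rw [Cj_card, hG]) (Cj_Tri ht)⟩
end PG
end

section
open Matrix MulAction OnePoint

section PH
variable {K : Type*} [Field K]

def ray (ζ : Kˣ) (a : K) : Set (OnePoint K) := Set.range (fun k : ℕ => (((ζ : K) ^ k * a : K) : OnePoint K))

lemma ray_ncard {ζ : Kˣ} {e : ℕ} (he : e ≠ 0) (h : IsPrimitiveRoot ζ e) {a : K} (ha : a ≠ 0) :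
    (ray ζ a).ncard = e ∧ (ray ζ a).Finite := by
  have hk : IsPrimitiveRoot (ζ : K) e := IsPrimitiveRoot.coe_units_iff.2 h
  have e1 : ray ζ a = (fun k : ℕ => (((ζ : K) ^ k * a : K) : OnePoint K)) '' (Finset.range e : Set ℕ) := by
    ext w
    constructor
    · rintro ⟨k, rfl⟩
      refine ⟨k % e, by simpa using Nat.mod_lt _ (Nat.pos_of_ne_zero he), ?_⟩
      simp only
      rw [show (ζ : K) ^ (k % e) = (ζ : K) ^ k by rw [hk.eq_orderOf, pow_mod_orderOf]]
    · rintro ⟨k, -, rfl⟩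
      exact ⟨k, rfl⟩
  have hinj : Set.InjOn (fun k : ℕ => (((ζ : K) ^ k * a : K) : OnePoint K)) (Finset.range e : Set ℕ) := by
    intro k hk1 l hl h
    simp only [OnePoint.coe_eq_coe] at h
    have := mul_right_cancel₀ ha h
    exact hk.pow_inj (by simpa using hk1) (by simpa using hl) this
  rw [e1, Set.ncard_image_of_injOn hinj, Set.ncard_coe_finset]
  exact ⟨by simp, (Finset.finite_toSet _).image _⟩

lemma ray_ne {ζ : Kˣ} {a : K} (ha : a ≠ 0) {w : OnePoint K} (h : w ∈ ray ζ a) :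
    w ≠ ∞ ∧ w ≠ ((0 : K) : OnePoint K) := by
  obtain ⟨k, rfl⟩ := h
  refine ⟨OnePoint.coe_ne_infty _, ?_⟩
  simp only [Ne, OnePoint.coe_eq_coe]
  simp [ha]

lemma Nrm.ray_sub {H : Subgroup (PGL2 K)} {e ζ} (hN : Nrm H e ζ) {a : K}
    (ha : (a : OnePoint K) ∈ orbit H (∞ : OnePoint K)) : ray ζ a ⊆ orbit H (∞ : OnePoint K) := by
  rintro _ ⟨k, rfl⟩
  obtain ⟨g, hg, hga⟩ := mem_orb.1 ha
  exact mem_orb.2 ⟨_, mul_mem (hN.pow_mem k) hg, by rw [mul_smul, hga, rot_coe]; simp⟩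

lemma two_ncard : ({∞, ((0 : K) : OnePoint K)} : Set (OnePoint K)).ncard = 2 :=
  Set.ncard_pair (OnePoint.infty_ne_coe 0)

lemma Nrm.orb1 {H : Subgroup (PGL2 K)} {e ζ} (hN : Nrm H e ζ) (he : e ≠ 0)
    (h0 : ((0 : K) : OnePoint K) ∈ orbit H (∞ : OnePoint K)) {a : K} (ha : a ≠ 0)
    (ha' : (a : OnePoint K) ∈ orbit H (∞ : OnePoint K))
    (hn : (orbit H (∞ : OnePoint K)).ncard = e + 2) {w : OnePoint K}
    (hw : w ∈ orbit H (∞ : OnePoint K)) : w = ∞ ∨ w = ((0 : K) : OnePoint K) ∨ w ∈ ray ζ a := by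
  have := hN.fin
  have hr := ray_ncard he hN.prim ha
  have hd : Disjoint ({∞, ((0 : K) : OnePoint K)} : Set (OnePoint K)) (ray ζ a) := by
    rw [Set.disjoint_left]
    rintro w (rfl | rfl) hw
    · exact (ray_ne ha hw).1 rfl
    · exact (ray_ne ha hw).2 rfl
  have hs : ({∞, ((0 : K) : OnePoint K)} : Set (OnePoint K)) ∪ ray ζ a = orbit H (∞ : OnePoint K) := by
    apply Set.eq_of_subset_of_ncard_le
    · rintro w ((rfl | rfl) | hw)
      · exact mem_orbit_self _
      · exact h0
      · exact hN.ray_sub ha' hw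
    · rw [Set.ncard_union_eq hd (Set.toFinite _) hr.2, two_ncard, hr.1]; omega
    · exact orbit_finite _
  rw [← hs] at hw
  rcases hw with (rfl | rfl) | hw <;> tauto

lemma Nrm.orb2 {H : Subgroup (PGL2 K)} {e ζ} (hN : Nrm H e ζ) (he : e ≠ 0)
    (h0 : ((0 : K) : OnePoint K) ∈ orbit H (∞ : OnePoint K)) {a : K} (ha : a ≠ 0)
    (ha' : (a : OnePoint K) ∈ orbit H (∞ : OnePoint K)) {b : K} (hb : b ≠ 0)
    (hb' : (b : OnePoint K) ∈ orbit H (∞ : OnePoint K))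
    (hab : ∀ k : ℕ, b ≠ (ζ : K) ^ k * a)
    (hn : (orbit H (∞ : OnePoint K)).ncard = e + e + 2) {w : OnePoint K}
    (hw : w ∈ orbit H (∞ : OnePoint K)) :
    w = ∞ ∨ w = ((0 : K) : OnePoint K) ∨ w ∈ ray ζ a ∨ w ∈ ray ζ b := by
  have := hN.fin
  have hr := ray_ncard he hN.prim ha
  have hr' := ray_ncard he hN.prim hb
  have hζ : (ζ : K) ^ e = 1 := by
    rw [← Units.val_pow_eq_pow_val, hN.prim.pow_eq_one]; simp
  have hd0 : Disjoint (ray ζ a) (ray ζ b) := by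
    rw [Set.disjoint_left]
    rintro w ⟨k, rfl⟩ ⟨l, hl⟩
    simp only [OnePoint.coe_eq_coe] at hl
    apply hab (l * (e - 1) + k)
    rw [pow_add, mul_assoc, ← hl, ← mul_assoc, ← pow_add]
    have : l * (e - 1) + l = e * l := by
      obtain ⟨e, rfl⟩ := Nat.exists_eq_succ_of_ne_zero he
      simp; ring
    rw [this, pow_mul, hζ]; simp
  have hd : Disjoint ({∞, ((0 : K) : OnePoint K)} : Set (OnePoint K)) (ray ζ a ∪ ray ζ b) := by
    rw [Set.disjoint_left]
    rintro w (rfl | rfl) (hw | hw)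
    · exact (ray_ne ha hw).1 rfl
    · exact (ray_ne hb hw).1 rfl
    · exact (ray_ne ha hw).2 rfl
    · exact (ray_ne hb hw).2 rfl
  have hs : ({∞, ((0 : K) : OnePoint K)} : Set (OnePoint K)) ∪ (ray ζ a ∪ ray ζ b) = orbit H (∞ : OnePoint K) := by
    apply Set.eq_of_subset_of_ncard_le
    · rintro w ((rfl | rfl) | (hw | hw))
      · exact mem_orbit_self _
      · exact h0
      · exact hN.ray_sub ha' hw
      · exact hN.ray_sub hb' hw
    · rw [Set.ncard_union_eq hd (Set.toFinite _) (hr.2.union hr'.2), two_ncard,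
        Set.ncard_union_eq hd0 hr.2 hr'.2, hr.1, hr'.1]; omega
    · exact orbit_finite _
  rw [← hs] at hw
  rcases hw with (rfl | rfl) | hw | hw <;> tauto

lemma S4_nf (h2 : (2 : K) ≠ 0) {H : Subgroup (PGL2 K)} {ζ}
    (hN : Nrm H 4 ζ) (hcard : Nat.card H = 24)
    (h0 : ((0 : K) : OnePoint K) ∈ orbit H (∞ : OnePoint K))
    (h1 : ((1 : K) : OnePoint K) ∈ orbit H (∞ : OnePoint K)) :
    (H : Set (PGL2 K)) = GS4 K (ζ : K) := by
  have := hN.fin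
  have hO := hN.orb_card
  rw [hcard] at hO
  have horb : ∀ {w : OnePoint K}, w ∈ orbit H (∞ : OnePoint K) → _ :=
    fun {w} => hN.orb1 (by norm_num) h0 one_ne_zero h1 (by omega)
  have h4 : (ζ : K) ^ 4 = 1 := by
    rw [← Units.val_pow_eq_pow_val, hN.prim.pow_eq_one]; simp
  have h11 : (1 : K) ≠ -1 := by intro h; apply h2; linear_combination h
  have hζ1 : rot ζ ≠ 1 := by
    intro h
    rw [← map_one rot] at h
    have := hN.prim
    rw [rot_inj h] at this
    have := this.unique IsPrimitiveRoot.one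
    omega
  have hs1 : swp 1 ∈ H := by
    obtain ⟨g, hg, hg0⟩ := mem_orb.1 h0
    have hg' := hN.part hg hN.mem hζ1 (p := ((0 : K) : OnePoint K)) (p' := ∞)
      (by rw [rot_coe, mul_zero]) (rot_inf _) (OnePoint.infty_ne_coe 0) hg0
    obtain ⟨κ, rfl⟩ := swap_form hg0 hg'
    obtain ⟨k, hk, hk1⟩ := mem_orb.1 h1
    have hm : ((κ : K) : OnePoint K) ∈ orbit H (∞ : OnePoint K) :=
      mem_orb.2 ⟨_, mul_mem hg hk, by rw [mul_smul, hk1]; exact swp_coe _ (by simp)⟩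
    rcases horb hm with h | h | ⟨n, h⟩
    · exact absurd h (OnePoint.coe_ne_infty _)
    · rw [OnePoint.coe_eq_coe] at h; exact absurd h κ.ne_zero
    · simp only [OnePoint.coe_eq_coe, mul_one] at h
      have h' : κ = ζ ^ n := by ext; simpa using h.symm
      have := mul_mem (inv_mem (hN.pow_mem n)) hg
      rw [← map_inv, rot_mul_swp, h', inv_mul_cancel] at this
      exact this
  have hd1 : (1 : K) * 1 - (-1) * 1 ≠ 0 := by
    rw [show (1 : K) * 1 - (-1) * 1 = 2 by ring]; exact h2
  have hg1 : mo 1 (-1) 1 1 hd1 ∈ H := by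
    obtain ⟨g, hg, hgi⟩ := mem_orb.1 h1
    have hg0 : g • ((0 : K) : OnePoint K) = ((-1 : K) : OnePoint K) := by
      refine hN.part hg hs1 (swp_ne 1) (swp_coe _ (by simp)) (swp_coe _ (by simp)) ?_ hgi
      rw [Ne, OnePoint.coe_eq_coe]; exact h11.symm
    obtain ⟨a, b, c, d, hdet, rfl⟩ := exists_mo g
    rw [act_inf_coe] at hgi
    rw [act_coe_coe] at hg0
    have hc : c ≠ 0 := by
      rintro rfl
      apply hdet; rw [hgi]; ring
    have hinv : (mo a b c d hdet) • ((-(d / c) : K) : OnePoint K) = ∞ := by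
      rw [act_coe_inf]; field_simp; ring
    have hmem : ((-(d / c) : K) : OnePoint K) ∈ orbit H (∞ : OnePoint K) :=
      mem_orb.2 ⟨_, inv_mem hg, by rw [← hinv, inv_smul_smul]⟩
    have hinv2 : ((-(d / c) : K) : OnePoint K) ≠ ((0 : K) : OnePoint K) := by
      intro h
      rw [OnePoint.coe_eq_coe] at h
      have : d = 0 := by simpa [hc] using h
      apply hdet
      rw [this] at hg0 ⊢
      have : b = 0 := by linear_combination hg0
      rw [this]; ring
    rcases horb hmem with h | h | ⟨n, h⟩
    · exact absurd h (OnePoint.coe_ne_infty _)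
    · exact absurd h hinv2
    · simp only [OnePoint.coe_eq_coe, mul_one] at h
      have hi2 : (ζ : K) ^ 2 = -1 := by
        have := hN.prim
        have hk : IsPrimitiveRoot (ζ : K) 4 := IsPrimitiveRoot.coe_units_iff.2 this
        have := hk.pow_ne_one_of_pos_of_lt (l := 2) (by norm_num) (by norm_num)
        have h' : ((ζ : K) ^ 2 - 1) * ((ζ : K) ^ 2 + 1) = 0 := by linear_combination h4
        rcases mul_eq_zero.1 h' with h | h
        · exact absurd (sub_eq_zero.1 h) this
        · linear_combination h
      have h' : d = (ζ : K) ^ (n + 2) * c := by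
        rw [pow_add, hi2, h]; field_simp
      have := mul_mem hg (hN.pow_mem (n + 2))
      rw [rot_def, mo_mul] at this
      have hz : (ζ : K) ^ (n + 2) ≠ 0 := by simp
      refine mem_conv' this (((ζ : K) ^ (n + 2) * c)⁻¹) (by simp [hc]) ?_ ?_ ?_ ?_
      all_goals
        push_cast
        generalize (ζ : K) ^ (n + 2) = t at *
        field_simp
        grind
  have hall : ∀ ν μ : ℕ, ∀ {h}, mo ((ζ : K) ^ ν) (-(ζ : K) ^ (ν + μ)) 1 ((ζ : K) ^ μ) h ∈ H := by
    intro ν μ h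
    have := mul_mem (mul_mem (hN.pow_mem ν) hg1) (inv_mem (hN.pow_mem μ))
    rw [rot_def, rot_def, mo_inv, mo_mul, mo_mul] at this
    refine mem_conv' this 1 (by simp) ?_ ?_ ?_ ?_ <;> push_cast <;> ring
  have hdet : ∀ ν μ : ℕ, (ζ : K) ^ ν * (ζ : K) ^ μ - (-(ζ : K) ^ (ν + μ)) * 1 ≠ 0 := by
    intro ν μ
    rw [show (ζ : K) ^ ν * (ζ : K) ^ μ - (-(ζ : K) ^ (ν + μ)) * 1 = 2 * (ζ : K) ^ (ν + μ) by ring]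
    simp [h2]
  apply Set.Subset.antisymm
  · intro g hg
    rcases horb (w := g • ∞) (mem_orb.2 ⟨g, hg, rfl⟩) with h | h | ⟨n, h⟩
    · obtain ⟨k, rfl⟩ := hN.stab g hg h
      rw [rot_def]
      exact img_intro ⟨k, 0, Or.inl (by simp)⟩
    · obtain ⟨k, rfl⟩ := hN.swp_of hs1 hg h
      rw [swp_def]
      exact img_intro ⟨k, 0, Or.inr (Or.inl (by simp))⟩
    · simp only [mul_one] at h
      obtain ⟨m, rfl⟩ := hN.coset hg (hall n 0 (h := hdet n 0)) (by
        rw [← h, eq_comm, act_inf_coe]; simp)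
      rw [rot_def, mo_mul]
      have e3 : (ζ : K) ^ m * (ζ : K) ^ (3 * m) = 1 := by
        rw [← pow_add, show m + 3 * m = 4 * m by ring, pow_mul, h4, one_pow]
      have : GS4 K (ζ : K) = imgSet _ := rfl
      rw [mo_eq_mo _ (hdet n (3 * m)) ((ζ : K) ^ (3 * m)) (by simp)]
      · exact img_intro ⟨n, 3 * m, Or.inr (Or.inr rfl)⟩
      · push_cast; linear_combination - (ζ : K) ^ n * e3
      · push_cast; ring
      · push_cast; linear_combination - e3
      · push_cast; ring
  · intro g hg
    obtain ⟨A, ⟨ν, μ, rfl | rfl | rfl⟩, h, rfl⟩ := img_elim hg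
    · have := hN.pow_mem ν
      rw [rot_def] at this
      exact mem_conv this h 1 (by simp) (by simp) (by simp) (by simp) (by simp)
    · have := mul_mem (hN.pow_mem ν) hs1
      rw [rot_mul_swp, swp_def] at this
      exact mem_conv this h 1 (by simp) (by simp) (by simp) (by simp) (by simp)
    · exact hall ν μ (h := by rwa [det_fin_two_of] at h)

lemma S4_case [IsAlgClosed K] (h2 : (2 : K) ≠ 0) {G : Subgroup (PGL2 K)}
    (hc : (Nat.card G : K) ≠ 0) (hG : Nat.card G = 24) (ht : Tri G (OnePoint K) 2 3 4) :
    ∃ u : PGL2 K, ∃ i : K, IsPrimitiveRoot i 4 ∧ (Cj u G : Set (PGL2 K)) = GS4 K i := by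
  have := finite_hc hc
  have ht' := ht.rot3
  obtain ⟨x, -, -, hx, -⟩ := id ht'
  obtain ⟨x', hne, h1, h3⟩ := (twoFix h2 G hc).partner (y := x) (by omega)
  have ho : x' ∈ orbit G x := ht'.orb (by norm_num) (by norm_num) (by norm_num) hx
    (by rw [partner_eS h1, hx])
  have hcd := eS_orbit_mul (G := G) x
  rw [hx, hG] at hcd
  obtain ⟨z, hz, hzn⟩ : ∃ z ∈ orbit G x, z ∉ ({x, x'} : Set (OnePoint K)) := by
    refine Set.exists_mem_notMem_of_ncard_lt_ncard ?_ (Set.toFinite _)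
    have := Set.ncard_insert_le x ({x'} : Set (OnePoint K))
    rw [Set.ncard_singleton] at this
    omega
  simp only [Set.mem_insert_iff, Set.mem_singleton_iff, not_or] at hzn
  obtain ⟨u, hu, hu', hu1⟩ := exists_to_three (c := (1 : K)) hne.symm hzn.1 hzn.2 one_ne_zero
  obtain ⟨ζ, hN⟩ := Nrm.of h2 hc h1 hu hu'
  rw [hx] at hN
  refine ⟨u, ζ, IsPrimitiveRoot.coe_units_iff.2 hN.prim, S4_nf h2 hN (by rw [Cj_card, hG]) ?_ ?_⟩
  · rw [← hu', ← hu]; exact Cj_orb ho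
  · rw [← hu1, ← hu]; exact Cj_orb hz
end PH
end

section
open Matrix MulAction OnePoint

section PI
variable {K : Type*} [Field K]

lemma tr_pow {H : Subgroup (PGL2 K)} {e ζ} (hN : Nrm H e ζ) (ht : Tri H (OnePoint K) 2 3 5)
    {a b c d : K} {h} (hm : mo a b c d h ∈ H) (hc : c ≠ 0) :
    a + d = 0 ∨ (a + d) ^ 2 = a * d - b * c ∨
      (a + d) ^ 4 - 3 * (a + d) ^ 2 * (a * d - b * c) + (a * d - b * c) ^ 2 = 0 := by
  have h1 : mo a b c d h ≠ 1 := by rw [Ne, mo_eq_one_iff]; tauto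
  rcases hN.pows ht hm h1 with h | h | h
  · left
    rw [pow_two, mo_mul, mo_eq_one_iff] at h
    apply mul_left_cancel₀ hc
    linear_combination h.2.1
  · right; left
    rw [pow_succ, pow_two, mo_mul, mo_mul, mo_eq_one_iff] at h
    apply mul_left_cancel₀ hc
    linear_combination h.2.1
  · right; right
    rw [pow_succ, pow_succ, pow_succ, pow_two, mo_mul, mo_mul, mo_mul, mo_mul, mo_eq_one_iff] at h
    apply mul_left_cancel₀ hc
    linear_combination h.2.1

lemma A5_inv {H : Subgroup (PGL2 K)} {ζ} (hN : Nrm H 5 ζ) (hs : swp (-1) ∈ H)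
    {a : K} (ha : a ≠ 0) (hO : (a : OnePoint K) ∈ orbit H (∞ : OnePoint K)) (k : ℕ) :
    -a⁻¹ ≠ (ζ : K) ^ k * a := by
  intro h
  have := hN.fin
  have hm := mul_mem (inv_mem (hN.pow_mem k)) hs
  rw [← map_inv, rot_mul_swp] at hm
  have hf : swp ((ζ ^ k)⁻¹ * -1) • (a : OnePoint K) = a := by
    apply swp_coe
    push_cast
    have : (ζ : K) ^ k ≠ 0 := by simp
    field_simp
    field_simp at h
    linear_combination -h
  have hf' : (⟨_, hm⟩ : H) • (a : OnePoint K) = a := hf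
  have he : eS H (a : OnePoint K) = 5 := by rw [← hN.es]; exact eS_of_mem_orbit hO
  have := congrArg Subtype.val (pow_eS hf')
  rw [he] at this
  simp only [SubmonoidClass.mk_pow, Subgroup.coe_one] at this
  rw [show 5 = 2 * 2 + 1 from rfl, pow_succ, pow_mul, pow_two (swp _), swp_sq, one_pow, one_mul] at this
  exact swp_ne _ this

lemma A5_orb {H : Subgroup (PGL2 K)} {ζ} (hN : Nrm H 5 ζ) (hs : swp (-1) ∈ H)
    (hcard : Nat.card H = 60)
    {a : K} (ha : a ≠ 0) (hO : (a : OnePoint K) ∈ orbit H (∞ : OnePoint K)) {w : OnePoint K}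
    (hw : w ∈ orbit H (∞ : OnePoint K)) :
    w = ∞ ∨ w = ((0 : K) : OnePoint K) ∨ w ∈ ray ζ a ∨ w ∈ ray ζ (-a⁻¹) := by
  have hc := hN.orb_card
  rw [hcard] at hc
  refine hN.orb2 (by norm_num) (mem_orb.2 ⟨_, hs, swp_inf _⟩) ha hO (by simp [ha]) ?_ 
    (A5_inv hN hs ha hO) (by omega) hw
  obtain ⟨g, hg, hga⟩ := mem_orb.1 hO
  exact mem_orb.2 ⟨_, mul_mem hs hg, by rw [mul_smul, hga]; exact swp_coe _ (by push_cast; field_simp)⟩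

/-- an element with g ∞ = a, g 0 = -1/a -/
lemma A5_g {H : Subgroup (PGL2 K)} {ζ} (hN : Nrm H 5 ζ) (hs : swp (-1) ∈ H)
    (hcard : Nat.card H = 60) :
    ∃ a : K, a ≠ 0 ∧ ∃ g ∈ H, g • (∞ : OnePoint K) = a ∧
      g • ((0 : K) : OnePoint K) = ((-a⁻¹ : K) : OnePoint K) := by
  have := hN.fin
  have hc := hN.orb_card
  rw [hcard] at hc
  have h5 : (ζ : K) ^ 5 = 1 := by
    rw [← Units.val_pow_eq_pow_val, hN.prim.pow_eq_one]; simp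
  have hζ1 : rot ζ ≠ 1 := by
    intro h
    rw [← map_one rot] at h
    have := hN.prim
    rw [rot_inj h] at this
    have := this.unique IsPrimitiveRoot.one
    omega
  obtain ⟨z, hz, hzn⟩ : ∃ z ∈ orbit H (∞ : OnePoint K), z ∉ ({∞, ((0 : K) : OnePoint K)} : Set (OnePoint K)) := by
    refine Set.exists_mem_notMem_of_ncard_lt_ncard ?_ (Set.toFinite _)
    rw [two_ncard]
    omega
  simp only [Set.mem_insert_iff, Set.mem_singleton_iff, not_or] at hzn
  obtain ⟨a, rfl⟩ := OnePoint.ne_infty_iff_exists.1 hzn.1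
  have ha : a ≠ 0 := by rintro rfl; exact hzn.2 rfl
  obtain ⟨g, hg, hga⟩ := mem_orb.1 hz
  have hk := mul_mem (mul_mem hg hN.mem) (inv_mem hg)
  have hk1 : g * rot ζ * g⁻¹ ≠ 1 := by
    intro h
    exact hζ1 (by simpa [mul_inv_eq_one] using h)
  have hka : (g * rot ζ * g⁻¹) • (a : OnePoint K) = a := by
    rw [← hga, mul_smul, inv_smul_smul, mul_smul, rot_inf]
  have hkp : (g * rot ζ * g⁻¹) • (g • ((0 : K) : OnePoint K)) = g • ((0 : K) : OnePoint K) := by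
    rw [mul_smul, inv_smul_smul, mul_smul, rot_coe, mul_zero]
  have hpa : g • ((0 : K) : OnePoint K) ≠ a := by
    rw [← hga]; intro h
    exact OnePoint.coe_ne_infty _ (MulAction.injective g h)
  have hpO : g • ((0 : K) : OnePoint K) ∈ orbit H (∞ : OnePoint K) :=
    mem_orb.2 ⟨_, mul_mem hg hs, by rw [mul_smul, swp_inf]⟩
  generalize hp : g • ((0 : K) : OnePoint K) = p at *
  generalize hk' : g * rot ζ * g⁻¹ = k at *
  have hki : k • (∞ : OnePoint K) ≠ ∞ := by
    intro h
    obtain ⟨n, rfl⟩ := hN.stab k hk h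
    rw [rot_coe, OnePoint.coe_eq_coe] at hka
    apply hk1
    rw [← map_one rot]
    congr 1
    ext
    exact mul_right_cancel₀ ha (by simpa using hka)
  rcases A5_orb hN hs hcard ha hz hpO with rfl | rfl | ⟨n, rfl⟩ | ⟨n, rfl⟩
  · exact absurd hkp hki
  · exact absurd ((hN.iff k hk).2 hkp) hki
  · exfalso
    simp only at *
    have := hN.part (mul_mem (hN.pow_mem n) hg) hk hk1 hkp hka hpa.symm (by
      rw [mul_smul, hga, rot_coe]; simp)
    rw [mul_smul, hp, rot_coe, OnePoint.coe_eq_coe] at this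
    push_cast at this
    have e2 : ((ζ : K) ^ n) ^ 2 = 1 := mul_right_cancel₀ ha (by linear_combination this)
    have e5 : ((ζ : K) ^ n) ^ 5 = 1 := by rw [← pow_mul, mul_comm, pow_mul, h5, one_pow]
    apply hpa
    have e1 : ((ζ : K) ^ n) = 1 := by
      generalize (ζ : K) ^ n = t at *
      linear_combination e5 - t * (t ^ 2 + 1) * e2
    rw [e1, one_mul]
  · refine ⟨(ζ : K) ^ (2 * n) * a, by simp [ha], _, mul_mem (hN.pow_mem (2 * n)) hg, ?_, ?_⟩
    · rw [mul_smul, hga, rot_coe]; simp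
    · rw [mul_smul, hp, rot_coe, OnePoint.coe_eq_coe]
      push_cast
      have hz : (ζ : K) ^ n ≠ 0 := by simp
      have e5 : ((ζ : K) ^ n) ^ 5 = 1 := by rw [← pow_mul, mul_comm, pow_mul, h5, one_pow]
      rw [mul_comm 2 n, pow_mul]
      generalize (ζ : K) ^ n = t at *
      field_simp
      linear_combination -e5

lemma A5_a (h2 : (2 : K) ≠ 0) {H : Subgroup (PGL2 K)} {ζ} (hN : Nrm H 5 ζ) (hs : swp (-1) ∈ H)
    (hcard : Nat.card H = 60) (ht : Tri H (OnePoint K) 2 3 5) :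
    ∃ a : K, a ≠ 0 ∧ ∃ h, mo a 1 1 (-a) h ∈ H := by
  have := hN.fin
  obtain ⟨a, ha, g, hg, hgi, hg0⟩ := A5_g hN hs hcard
  refine ⟨a, ha, ?_⟩
  have h5 : (ζ : K) ^ 5 = 1 := by
    rw [← Units.val_pow_eq_pow_val, hN.prim.pow_eq_one]; simp
  have hζ1 : rot ζ ≠ 1 := by
    intro h
    rw [← map_one rot] at h
    have := hN.prim
    rw [rot_inj h] at this
    have := this.unique IsPrimitiveRoot.one
    omega
  have hO : (a : OnePoint K) ∈ orbit H (∞ : OnePoint K) := mem_orb.2 ⟨g, hg, hgi⟩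
  have hba := A5_inv hN hs ha hO 0
  rw [pow_zero, one_mul] at hba
  have hk := mul_mem (mul_mem hg hN.mem) (inv_mem hg)
  have hk1 : g * rot ζ * g⁻¹ ≠ 1 := by
    intro h
    exact hζ1 (by simpa [mul_inv_eq_one] using h)
  have hka : (g * rot ζ * g⁻¹) • (a : OnePoint K) = a := by
    rw [← hgi, mul_smul, inv_smul_smul, mul_smul, rot_inf]
  have hkp : (g * rot ζ * g⁻¹) • ((-a⁻¹ : K) : OnePoint K) = ((-a⁻¹ : K) : OnePoint K) := by
    rw [← hg0, mul_smul, inv_smul_smul, mul_smul, rot_coe, mul_zero]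
  -- normalise
  have key : ∀ n : ℕ, ∀ t : K, t ≠ 0 → g⁻¹ • (∞ : OnePoint K) = (((ζ : K) ^ n * t : K) : OnePoint K) →
      ∃ h, mo a (a⁻¹ * t) 1 (-t) h ∈ H := by
    intro n t ht0 hgt
    rw [inv_smul_eq_iff] at hgt
    obtain ⟨p, q, r, s, hdet, rfl⟩ := exists_mo g
    rw [act_inf_coe] at hgi
    rw [act_coe_coe] at hg0
    rw [eq_comm, act_coe_inf] at hgt
    have hr : r ≠ 0 := by
      rintro rfl
      apply hdet; rw [hgi]; ring
    have hz : (ζ : K) ^ n ≠ 0 := by simp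
    have hmem := mul_mem hg (hN.pow_mem n)
    rw [rot_def, mo_mul] at hmem
    push_cast at hmem
    set c := (ζ : K) ^ n with hcdef
    refine ⟨?_, mem_conv' hmem (r * c)⁻¹ (by simp [hr, hz]) ?_ ?_ ?_ ?_⟩
    · intro h0
      apply hdet
      have hs' : s = -(r * (c * t)) := by linear_combination hgt
      have hq' : q = -a⁻¹ * s := by linear_combination hg0
      rw [hgi, hq', hs']
      linear_combination r * r * c * h0
    · rw [hgi]; field_simp; ring
    · have hs' : s = -(r * (c * t)) := by linear_combination hgt
      have hq' : q = -a⁻¹ * s := by linear_combination hg0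
      rw [hq', hs']; field_simp; ring
    · field_simp; ring
    · have hs' : s = -(r * (c * t)) := by linear_combination hgt
      rw [hs']; field_simp; ring
  have hmem : g⁻¹ • (∞ : OnePoint K) ∈ orbit H (∞ : OnePoint K) := mem_orb.2 ⟨_, inv_mem hg, rfl⟩
  rcases A5_orb hN hs hcard ha hO hmem with h | h | ⟨n, h⟩ | ⟨n, h⟩
  · rw [inv_smul_eq_iff, hgi] at h
    exact absurd h (OnePoint.infty_ne_coe _)
  · rw [inv_smul_eq_iff, hg0] at h
    exact absurd h (OnePoint.infty_ne_coe _)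
  · obtain ⟨hd, hm⟩ := key n a ha h.symm
    have hd' : a * (-a) - 1 * 1 ≠ 0 := by
      rwa [inv_mul_cancel₀ ha] at hd
    exact ⟨hd', mem_conv' hm 1 (by simp) (by simp) (by field_simp) (by simp) (by simp)⟩
  · exfalso
    obtain ⟨hd, hm⟩ := key n (-a⁻¹) (by simp [ha]) h.symm
    -- inverse sends infinity to -1/a
    have hi : (mo a (a⁻¹ * -a⁻¹) 1 (- -a⁻¹) hd)⁻¹ • (∞ : OnePoint K) = ((-a⁻¹ : K) : OnePoint K) := by
      rw [inv_smul_eq_iff, eq_comm, act_coe_inf]; ring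
    have h0 := hN.part (inv_mem hm) hk hk1 hkp hka (by
      rw [Ne, OnePoint.coe_eq_coe]; exact hba.symm) hi
    rw [inv_smul_eq_iff, eq_comm, act_coe_coe] at h0
    have e : (a ^ 2 - 1) * (a ^ 2 + 1) = 0 := by
      field_simp at h0
      linear_combination h0
    rcases mul_eq_zero.1 e with e | e
    · have := tr_pow hN ht hm one_ne_zero
      have e' : a⁻¹ = a := by field_simp; linear_combination -e
      rw [e'] at this
      have h1 : a ^ 2 = 1 := by linear_combination e
      rcases this with h | h | h
      · have : 2 * a = 0 := by linear_combination h
        simp [h2, ha] at this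
      · apply h2; linear_combination h - 2 * h1
      · have : (2 : K) * 2 = 0 := by linear_combination -h - 4 * (a ^ 2 + 1) * h1
        simp [h2] at this
    · apply hba; field_simp; linear_combination -e
end PI
end

section
open Matrix MulAction OnePoint

section PJ
variable {K : Type*} [Field K]

lemma A5_val_aux {a t R P : K} (hP0 : P ≠ 0) (ht : t ^ 2 + t - 1 = 0)
    (h : P = 0 ∨ -P = -R ∨ P ^ 2 - 3 * P * R + R ^ 2 = 0) :
    P = R ∨ P = (2 + t) * R ∨ P = (1 - t) * R := by
  rcases h with h | h | h
  · exact absurd h hP0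
  · left; linear_combination -h
  · right
    have : (P - (2 + t) * R) * (P - (1 - t) * R) = 0 := by
      linear_combination h - R ^ 2 * ht
    rcases mul_eq_zero.1 this with h | h
    · left; linear_combination h
    · right; linear_combination h

lemma A5_val_one {H : Subgroup (PGL2 K)} {ζ : Kˣ} (hN : Nrm H 5 ζ) (ht : Tri H (OnePoint K) 2 3 5)
    {a c d : K} (ha : a ≠ 0) {h} (hm : mo a 1 1 (-a) h ∈ H) (n : ℕ) (hc : c = (ζ : K) ^ n)
    (hc1 : c ≠ 1) (hcd : c * d = 1) {t : K} (ht : t ^ 2 + t - 1 = 0) :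
    a ^ 2 * (2 - (c + d)) = a ^ 2 + 1 ∨ a ^ 2 * (2 - (c + d)) = (2 + t) * (a ^ 2 + 1) ∨
      a ^ 2 * (2 - (c + d)) = (1 - t) * (a ^ 2 + 1) := by
  have hc0 : c ≠ 0 := by rintro rfl; simp at hcd
  have hm' := mul_mem hm (hN.pow_mem n)
  rw [rot_def, mo_mul] at hm'
  push_cast at hm'
  have := tr_pow hN ‹_› hm' (by rw [← hc]; simpa using hc0)
  rw [← hc] at this
  have hP0 : a ^ 2 * (2 - (c + d)) ≠ 0 := by
    intro h0
    have : (a * (c - 1)) ^ 2 = 0 := by linear_combination -c * h0 - a ^ 2 * hcd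
    have := pow_eq_zero_iff (two_ne_zero) |>.1 this
    rcases mul_eq_zero.1 this with h | h
    · exact ha h
    · exact hc1 (by linear_combination h)
  refine A5_val_aux (a := a) hP0 ht ?_
  rcases this with h | h | h
  · exfalso
    have : a * (c - 1) = 0 := by linear_combination h
    rcases mul_eq_zero.1 this with h | h
    · exact ha h
    · exact hc1 (by linear_combination h)
  · right; left
    apply mul_left_cancel₀ hc0
    linear_combination h + a ^ 2 * hcd
  · right; right
    have e : (a * (c - 1)) ^ 2 = - c * (a ^ 2 * (2 - (c + d))) := by linear_combination - a ^ 2 * hcd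
    generalize a ^ 2 * (2 - (c + d)) = P at *
    apply mul_left_cancel₀ (pow_ne_zero 2 hc0)
    have e4 : (a * (c - 1)) ^ 4 = c ^ 2 * P ^ 2 := by
      rw [show 4 = 2 * 2 from rfl, pow_mul, e]; ring
    linear_combination h - e4 - 3 * c * (a ^ 2 + 1) * e

lemma A5_val (h2 : (2 : K) ≠ 0) (h5 : (5 : K) ≠ 0) {H : Subgroup (PGL2 K)} {ζ : Kˣ} (hN : Nrm H 5 ζ)
    (ht : Tri H (OnePoint K) 2 3 5)
    {a : K} (ha : a ≠ 0) {h} (hm : mo a 1 1 (-a) h ∈ H) :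
    a ^ 2 + a - 1 = 0 ∨ a ^ 2 - a - 1 = 0 := by
  have hk : IsPrimitiveRoot (ζ : K) 5 := IsPrimitiveRoot.coe_units_iff.2 hN.prim
  have e5 : (ζ : K) ^ 5 = 1 := hk.pow_eq_one
  have n1 : (ζ : K) ≠ 1 := hk.ne_one (by norm_num)
  have n2 : (ζ : K) ^ 2 ≠ 1 := hk.pow_ne_one_of_pos_of_lt (by norm_num) (by norm_num)
  generalize hz : (ζ : K) = z at *
  have hcyc : 1 + z + z ^ 2 + z ^ 3 + z ^ 4 = 0 := by
    apply mul_left_cancel₀ (sub_ne_zero.2 n1)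
    linear_combination e5
  have htau : (z + z ^ 4) ^ 2 + (z + z ^ 4) - 1 = 0 := by
    linear_combination hcyc + (2 + z ^ 3) * e5
  have hA := A5_val_one hN ht (c := z) (d := z ^ 4) ha hm 1 (by rw [hz, pow_one]) n1
    (by linear_combination e5) htau
  have hB := A5_val_one hN ht (c := z ^ 2) (d := z ^ 3) ha hm 2 (by rw [hz]) n2
    (by linear_combination e5) htau
  rw [show z ^ 2 + z ^ 3 = -1 - (z + z ^ 4) by linear_combination hcyc] at hB
  generalize z + z ^ 4 = t at *
  have hR : a ^ 2 + 1 ≠ 0 := by intro h0; apply h; linear_combination -h0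
  have fin : a ^ 2 = 2 + t ∨ a ^ 2 = 1 - t := by
    rcases hA with hA | hA | hA
    · left
      linear_combination (2 + t) * (hA) + a ^ 2 * htau
    · exfalso
      have hB' : (2 + t) ^ 2 * (a ^ 2 + 1) = a ^ 2 * (3 + t) := by
        linear_combination -(2 + t) * hA - a ^ 2 * htau
      rcases hB with hB | hB | hB
      · have e : 4 + 3 * t = 0 := by
          apply mul_left_cancel₀ hR
          linear_combination hB' + hB - (a ^ 2 + 1) * htau
        apply h5
        linear_combination -9 * htau + (3 * t - 1) * e
      · have e : 3 + 2 * t = 0 := by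
          apply mul_left_cancel₀ hR
          linear_combination hB' + hB - (a ^ 2 + 1) * htau
        have : (1 : K) = 0 := by linear_combination -4 * htau + (2 * t - 1) * e
        exact one_ne_zero this
      · have e : 4 * (1 + t) = 0 := by
          apply mul_left_cancel₀ hR
          linear_combination hB' + hB - (a ^ 2 + 1) * htau
        have e : (2 * 2) * (1 + t) = 0 := by linear_combination e
        have e : 1 + t = 0 := by simpa [h2] using e
        have : (1 : K) = 0 := by linear_combination - htau + t * e
        exact one_ne_zero this
    · right; linear_combination hA
  rcases fin with h | h
  · have : (a - (1 + t)) * (a + (1 + t)) = 0 := by linear_combination h - htau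
    rcases mul_eq_zero.1 this with h | h
    · right
      have : a = 1 + t := by linear_combination h
      rw [this]; linear_combination htau
    · left
      have : a = -(1 + t) := by linear_combination h
      rw [this]; linear_combination htau
  · have : (a - t) * (a + t) = 0 := by linear_combination h - htau
    rcases mul_eq_zero.1 this with h | h
    · left
      have : a = t := by linear_combination h
      rw [this]; linear_combination htau
    · right
      have : a = -t := by linear_combination h
      rw [this]; linear_combination htau

lemma Nrm.conj [IsAlgClosed K] (h2 : (2 : K) ≠ 0) {H : Subgroup (PGL2 K)} {e ζ} (hN : Nrm H e ζ)
    (c : Kˣ) : Nrm (Cj (rot c) H) e ζ := by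
  have hc' := Cj_hc hN.card (rot c)
  have hcom : ∀ a : Kˣ, rot c * rot a * (rot c)⁻¹ = rot a := by
    intro a
    rw [← map_mul, mul_comm, map_mul, mul_inv_cancel_right]
  have hi : (rot c)⁻¹ • (∞ : OnePoint K) = ∞ := by rw [← map_inv, rot_inf]
  have h0 : (rot c)⁻¹ • ((0 : K) : OnePoint K) = ((0 : K) : OnePoint K) := by
    rw [← map_inv, rot_coe, mul_zero]
  have f1 : ∀ g, ((rot c)⁻¹ * g * rot c) • (∞ : OnePoint K) = ∞ ↔ g • (∞ : OnePoint K) = ∞ := by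
    intro g
    rw [mul_smul, mul_smul, rot_inf, inv_smul_eq_iff, rot_inf]
  have f2 : ∀ g, ((rot c)⁻¹ * g * rot c) • ((0 : K) : OnePoint K) = ((0 : K) : OnePoint K) ↔
      g • ((0 : K) : OnePoint K) = ((0 : K) : OnePoint K) := by
    intro g
    rw [mul_smul, mul_smul, rot_coe, mul_zero, inv_smul_eq_iff, rot_coe, mul_zero]
  refine ⟨twoFix h2 _ hc', finite_hc hc', hc', ?_, hN.prim, ?_, ?_, ?_⟩
  · rw [← hN.es, ← Cj_eS (rot c) H, rot_inf]
  · have := Cj_mem (u := rot c) hN.mem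
    rwa [hcom] at this
  · intro g hg
    rw [← f1, ← f2]
    exact hN.iff _ (mem_Cj.1 hg)
  · intro g hg h
    obtain ⟨k, hk⟩ := hN.stab _ (mem_Cj.1 hg) ((f1 g).2 h)
    refine ⟨k, ?_⟩
    rw [← hcom, ← hk]
    group

lemma A5_nf {H : Subgroup (PGL2 K)} {ζ} (hN : Nrm H 5 ζ) (hs : swp (-1) ∈ H)
    (hcard : Nat.card H = 60) {a : K} (ha : a ^ 2 + a - 1 = 0) {h} (hm : mo a 1 1 (-a) h ∈ H) :
    -a⁻¹ ≠ a ∧ (H : Set (PGL2 K)) = GA5 K (ζ : K) a (-a⁻¹) := by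
  have := hN.fin
  have h5 : (ζ : K) ^ 5 = 1 := by
    rw [← Units.val_pow_eq_pow_val, hN.prim.pow_eq_one]; simp
  have ha0 : a ≠ 0 := by rintro rfl; simp at ha
  have hO : (a : OnePoint K) ∈ orbit H (∞ : OnePoint K) :=
    mem_orb.2 ⟨_, hm, by rw [act_inf_coe]; simp⟩
  have hba := A5_inv hN hs ha0 hO 0
  rw [pow_zero, one_mul] at hba
  refine ⟨hba, ?_⟩
  have hR : a ^ 2 + 1 ≠ 0 := by intro h0; apply h; linear_combination -h0
  have hdb : (-a⁻¹) * (-(-a⁻¹)) - 1 * 1 ≠ 0 := by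
    intro h0
    field_simp at h0
    apply hR
    linear_combination -h0
  have hmb : mo (-a⁻¹) 1 1 (-(-a⁻¹)) hdb ∈ H := by
    have := mul_mem hs hm
    rw [swp_def, mo_mul] at this
    refine mem_conv' this a⁻¹ (by simp [ha0]) ?_ ?_ ?_ ?_ <;> push_cast <;> field_simp <;> ring
  have hall : ∀ w : K, ∀ {h}, mo w 1 1 (-w) h ∈ H → ∀ r s : ℕ, ∀ {h'},
      mo ((ζ : K) ^ r * w) ((ζ : K) ^ r * ((ζ : K) ^ s)⁻¹) 1 (-(((ζ : K) ^ s)⁻¹ * w)) h' ∈ H := by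
    intro w h hw r s h'
    have := mul_mem (mul_mem (hN.pow_mem r) hw) (hN.pow_mem s)
    rw [rot_def, rot_def, mo_mul, mo_mul] at this
    refine mem_conv' this ((ζ : K) ^ s)⁻¹ (by simp) ?_ ?_ ?_ ?_ <;> push_cast <;> field_simp <;> ring
  have hcos : ∀ w : K, ∀ {h}, mo w 1 1 (-w) h ∈ H → ∀ g ∈ H, ∀ n : ℕ,
      g • (∞ : OnePoint K) = (((ζ : K) ^ n * w : K) : OnePoint K) → 
      ∃ s, ∃ h', g = mo ((ζ : K) ^ n * w) ((ζ : K) ^ n * ((ζ : K) ^ s)⁻¹) 1 (-(((ζ : K) ^ s)⁻¹ * w)) h' := by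
    intro w h hw g hg n hgi
    obtain ⟨s, hs⟩ := hN.coset hg (mul_mem (hN.pow_mem n) hw) (by
      rw [hgi, eq_comm, mul_smul, (act_inf_coe h (w := w)).2 (by simp), rot_coe]; simp)
    refine ⟨s, ?_, ?_⟩
    · intro h0
      apply h
      have hz : (ζ : K) ^ n ≠ 0 := by simp
      have hz' : (ζ : K) ^ s ≠ 0 := by simp
      apply mul_left_cancel₀ hz
      apply mul_left_cancel₀ (inv_ne_zero hz')
      linear_combination h0
    · rw [hs, rot_def, rot_def, mo_mul, mo_mul]
      apply mo_eq_mo _ _ ((ζ : K) ^ s)⁻¹ (by simp) <;> push_cast <;> field_simp <;> ring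
  apply Set.Subset.antisymm
  · intro g hg
    rcases A5_orb hN hs hcard ha0 hO (w := g • ∞) (mem_orb.2 ⟨g, hg, rfl⟩) with h | h | ⟨n, h⟩ | ⟨n, h⟩
    · obtain ⟨k, rfl⟩ := hN.stab g hg h
      rw [rot_def]
      exact img_intro ⟨k, 0, Or.inl (by simp)⟩
    · obtain ⟨k, rfl⟩ := hN.swp_of hs hg h
      rw [swp_def]
      rw [mo_eq_mo _ (a' := 0) (b' := (ζ : K) ^ k) (c' := -1) (d' := 0) (by simp) (-1) (by simp) (by simp) (by simp) (by simp) (by simp)]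
      exact img_intro ⟨k, 0, Or.inr (Or.inl rfl)⟩
    · obtain ⟨s, h', rfl⟩ := hcos _ hm g hg n h.symm
      exact img_intro ⟨n, s, Or.inr (Or.inr (Or.inl rfl))⟩
    · obtain ⟨s, h', rfl⟩ := hcos _ hmb g hg n h.symm
      exact img_intro ⟨n, s, Or.inr (Or.inr (Or.inr rfl))⟩
  · intro g hg
    obtain ⟨A, ⟨r, s, rfl | rfl | rfl | rfl⟩, h, rfl⟩ := img_elim hg
    · have := hN.pow_mem r
      rw [rot_def] at this
      exact mem_conv this h 1 (by simp) (by simp) (by simp) (by simp) (by simp)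
    · have := mul_mem (hN.pow_mem r) hs
      rw [rot_mul_swp, swp_def] at this
      exact mem_conv this h (-1) (by simp) (by simp) (by simp) (by simp) (by simp)
    · exact hall a hm r s (h' := by rwa [det_fin_two_of] at h)
    · exact hall (-a⁻¹) hmb r s (h' := by rwa [det_fin_two_of] at h)

lemma A5_case [IsAlgClosed K] (h2 : (2 : K) ≠ 0) {G : Subgroup (PGL2 K)}
    (hc : (Nat.card G : K) ≠ 0) (hG : Nat.card G = 60) (ht : Tri G (OnePoint K) 2 3 5) :
    ∃ u : PGL2 K, ∃ ε ω ωb : K, IsPrimitiveRoot ε 5 ∧ ω ^ 2 + ω - 1 = 0 ∧ ωb ^ 2 + ωb - 1 = 0 ∧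
      ω ≠ ωb ∧ (Cj u G : Set (PGL2 K)) = GA5 K ε ω ωb := by
  have := finite_hc hc
  have ht' := ht.rot3
  obtain ⟨x, -, -, hx, -⟩ := id ht'
  obtain ⟨x', hne, h1, h3⟩ := (twoFix h2 G hc).partner (y := x) (by omega)
  have ho : x' ∈ orbit G x := ht'.orb (by norm_num) (by norm_num) (by norm_num) hx
    (by rw [partner_eS h1, hx])
  obtain ⟨i, hi⟩ := IsAlgClosed.exists_pow_nat_eq (-1 : K) (n := 2) (by norm_num)
  have hi0 : i ≠ 0 := by rintro rfl; simp at hi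
  obtain ⟨u, ζ, hu, hu', hN, hs⟩ := swap_setup h2 hc (by omega) hne h1 h3 ho (Units.mk0 i hi0)
  rw [show Units.mk0 i hi0 ^ 2 = -1 by ext; simpa using hi] at hs
  rw [hx] at hN
  have h5 : (5 : K) ≠ 0 := by
    intro h
    apply hc
    rw [hG]
    push_cast
    linear_combination 12 * h
  have hcard : Nat.card (Cj u G) = 60 := by rw [Cj_card, hG]
  obtain ⟨a, ha0, hd, hm⟩ := A5_a h2 hN hs hcard (Cj_Tri ht)
  have fin : ∀ v : PGL2 K, Nrm (Cj v G) 5 ζ → swp (-1) ∈ Cj v G → ∀ a : K, a ^ 2 + a - 1 = 0 →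
      ∀ h, mo a 1 1 (-a) h ∈ Cj v G → ∃ u : PGL2 K, ∃ ε ω ωb : K, IsPrimitiveRoot ε 5 ∧
      ω ^ 2 + ω - 1 = 0 ∧ ωb ^ 2 + ωb - 1 = 0 ∧
      ω ≠ ωb ∧ (Cj u G : Set (PGL2 K)) = GA5 K ε ω ωb := by
    intro v hN hs a ha h hm
    have ha0 : a ≠ 0 := by rintro rfl; simp at ha
    obtain ⟨e1, e2⟩ := A5_nf hN hs (by rw [Cj_card, hG]) ha hm
    refine ⟨v, ζ, a, -a⁻¹, IsPrimitiveRoot.coe_units_iff.2 hN.prim, ha, ?_, e1.symm, e2⟩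
    field_simp
    linear_combination -ha
  rcases A5_val h2 h5 hN (Cj_Tri ht) ha0 hm with ha | ha
  · exact fin u hN hs a ha hd hm
  · have hr : ((rot (-1 : Kˣ))⁻¹ : PGL2 K) = rot (-1) := by rw [← map_inv]; simp
    refine fin (rot (-1) * u) ?_ ?_ (-a) (by linear_combination ha) (by
      intro h0; apply hd; linear_combination h0) ?_
    · rw [← Cj_Cj]; exact hN.conj h2 (-1)
    · rw [← Cj_Cj]
      have := Cj_mem (u := rot (-1)) hs
      rw [hr, rot_mul_swp, swp_mul_rot] at this
      simpa using this
    · rw [← Cj_Cj]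
      have := Cj_mem (u := rot (-1)) hm
      rw [hr, rot_def, mo_mul, mo_mul] at this
      refine mem_conv' this (-1) (by simp) ?_ ?_ ?_ ?_ <;> push_cast <;> ring
end PJ
end

/-- Any finite subgroup of `PGL₂(K̄)` of order prime to the characteristic
(`p = 0` or `p > 2`) is conjugate to one of `G_{C_n}` (`n ≥ 1`), `G_{D_{2n}}` (`n > 2`),
`G_{V₄}`, `G_{A₄}`, `G_{S₄}` or `G_{A₅}`; in particular it is cyclic, dihedral, or isomorphic
to `A₄`, `S₄` or `A₅`. -/
theorem finite_subgroups_PGL2 (K : Type*) [Field K] [IsAlgClosed K]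
    (hchar : ringChar K = 0 ∨ 2 < ringChar K)
    (G : Subgroup (PGL2 K)) (hfin : Finite G)
    (hcop : ringChar K = 0 ∨ Nat.Coprime (Nat.card G) (ringChar K)) :
    (∃ u : PGL2 K,
      (∃ n : ℕ, 1 ≤ n ∧ ∃ ζ : K, IsPrimitiveRoot ζ n ∧
        (fun g => u * g * u⁻¹) '' (G : Set (PGL2 K)) = GCn K ζ) ∨
      (∃ n : ℕ, 2 < n ∧ ∃ ζ : K, IsPrimitiveRoot ζ n ∧
        (fun g => u * g * u⁻¹) '' (G : Set (PGL2 K)) = GD2n K ζ) ∨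
      ((fun g => u * g * u⁻¹) '' (G : Set (PGL2 K)) = GV4 K) ∨
      (∃ i : K, IsPrimitiveRoot i 4 ∧
        (fun g => u * g * u⁻¹) '' (G : Set (PGL2 K)) = GA4 K i) ∨
      (∃ i : K, IsPrimitiveRoot i 4 ∧
        (fun g => u * g * u⁻¹) '' (G : Set (PGL2 K)) = GS4 K i) ∨
      (∃ ε ω ωb : K, IsPrimitiveRoot ε 5 ∧ ω ^ 2 + ω - 1 = 0 ∧ ωb ^ 2 + ωb - 1 = 0 ∧ ω ≠ ωb ∧
        (fun g => u * g * u⁻¹) '' (G : Set (PGL2 K)) = GA5 K ε ω ωb)) ∧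
    (IsCyclic G ∨ (∃ n : ℕ, Nonempty (G ≃* DihedralGroup n)) ∨
      Nonempty (G ≃* alternatingGroup (Fin 4)) ∨
      Nonempty (G ≃* Equiv.Perm (Fin 4)) ∨
      Nonempty (G ≃* alternatingGroup (Fin 5))) := by
  have hc : (Nat.card G : K) ≠ 0 := by
    intro h
    have hd := (ringChar.spec K (Nat.card G)).1 h
    have hpos : 0 < Nat.card G := Nat.card_pos
    rcases hcop with h0 | h0
    · rw [h0, zero_dvd_iff] at hd
      omega
    · have h1 : ringChar K = 1 := Nat.eq_one_of_dvd_coprimes h0 hd dvd_rfl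
      omega
  have h2 : (2 : K) ≠ 0 := by
    intro h
    have hd := (ringChar.spec K 2).1 (by exact_mod_cast h)
    have := Nat.le_of_dvd (by norm_num) hd
    rcases hchar with h0 | h0
    · rw [h0, zero_dvd_iff] at hd
      omega
    · omega
  have halt : Alt G (OnePoint K) := by
    rcases Nat.lt_or_ge 1 (Nat.card G) with h | h
    · exact (twoFix h2 G hc).alt h
    · refine Or.inl ⟨OnePoint.infty, ?_⟩
      have h1 : 0 < Nat.card G := Nat.card_pos
      have h3 := eS_pos (G := G) (OnePoint.infty : OnePoint K)
      have h4 : eS G (OnePoint.infty : OnePoint K) ∣ Nat.card G := Subgroup.card_subgroup_dvd_card _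
      have := Nat.le_of_dvd h1 h4
      omega
  rcases halt with ⟨x, hx⟩ | ⟨n, hn, hG, x, hx⟩ | ⟨hG, ht⟩ | ⟨hG, ht⟩ | ⟨hG, ht⟩
  · obtain ⟨⟨u, h⟩, hcyc⟩ := cyc_case h2 hc hx
    exact ⟨⟨u, Or.inl h⟩, Or.inl hcyc⟩
  · obtain ⟨⟨u, ζ, hζ, h⟩, hiso⟩ := dih_case h2 hc hn hG hx
    refine ⟨⟨u, ?_⟩, Or.inr (Or.inl ⟨n, hiso⟩)⟩
    rcases Nat.lt_or_ge 2 n with hn' | hn'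
    · exact Or.inr (Or.inl ⟨n, hn', ζ, hζ, h⟩)
    · obtain rfl : n = 2 := by omega
      rw [hζ.eq_neg_one_of_two_right, ← GV4_eq] at h
      exact Or.inr (Or.inr (Or.inl h))
  · obtain ⟨u, h⟩ := A4_case h2 hc hG ht
    exact ⟨⟨u, Or.inr (Or.inr (Or.inr (Or.inl h)))⟩,
      Or.inr (Or.inr (Or.inl (iso_A4 (twoFix h2 G hc) hG ht)))⟩
  · obtain ⟨u, h⟩ := S4_case h2 hc hG ht
    exact ⟨⟨u, Or.inr (Or.inr (Or.inr (Or.inr (Or.inl h))))⟩,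
      Or.inr (Or.inr (Or.inr (Or.inl (iso_S4 (twoFix h2 G hc) hG ht))))⟩
  · obtain ⟨u, h⟩ := A5_case h2 hc hG ht
    exact ⟨⟨u, Or.inr (Or.inr (Or.inr (Or.inr (Or.inr h))))⟩,
      Or.inr (Or.inr (Or.inr (Or.inr (iso_A5 (twoFix h2 G hc) hG ht))))⟩
end

section
/- Let K̄ be an algebraically closed field of characteristic p, where p = 0 or p > 2. The centralizer of G_{V₄} in PGL₂(K̄) equals G_{V₄}. -/
open Matrix

theorem toPGL2_eq_iff' {K : Type*} [Field K] (A B : GL (Fin 2) K) :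
    toPGL2 K A = toPGL2 K B ↔ ∃ c : K, c ≠ 0 ∧
      (A : Matrix (Fin 2) (Fin 2) K) = c • (B : Matrix (Fin 2) (Fin 2) K) := by
  rw [eq_comm]
  unfold toPGL2
  rw [QuotientGroup.mk'_eq_mk']
  constructor
  · rintro ⟨z, hz, h⟩
    rw [Matrix.GeneralLinearGroup.center_eq_range_scalar] at hz
    obtain ⟨u, rfl⟩ := hz
    refine ⟨u, u.ne_zero, ?_⟩
    rw [← h]
    ext i j
    simp [mul_comm]
  · rintro ⟨c, hc, h⟩
    refine ⟨Matrix.GeneralLinearGroup.scalar (Fin 2) (Units.mk0 c hc), ?_, ?_⟩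
    · rw [Matrix.GeneralLinearGroup.center_eq_range_scalar]
      exact ⟨_, rfl⟩
    · apply Units.ext
      rw [h]
      ext i j
      simp [mul_comm]

theorem GV4_comm {K : Type*} [Field K] {x y : PGL2 K} (hx : x ∈ GV4 K) (hy : y ∈ GV4 K) :
    x * y = y * x := by
  obtain ⟨M, hM, rfl⟩ := hx
  obtain ⟨N, hN, rfl⟩ := hy
  rw [← map_mul, ← map_mul, toPGL2_eq_iff']
  have h1 : (1 : K) ≠ 0 := one_ne_zero
  have h2 : (-1 : K) ≠ 0 := neg_ne_zero.mpr h1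
  rw [Units.val_mul, Units.val_mul]
  rcases hM with h | h | h | h <;> rcases hN with h' | h' | h' | h' <;> rw [h, h'] <;>
  first
  | (refine ⟨1, h1, ?_⟩; ext i j; fin_cases i <;> fin_cases j <;> simp [Matrix.mul_apply]; done)
  | (refine ⟨-1, h2, ?_⟩; ext i j; fin_cases i <;> fin_cases j <;> simp [Matrix.mul_apply]; done)

theorem mem_GV4_of {K : Type*} [Field K] (g : GL (Fin 2) K) (A : Matrix (Fin 2) (Fin 2) K)
    (hA : A = !![(1 : K), 0; 0, 1] ∨ A = !![(-1 : K), 0; 0, 1] ∨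
    A = !![(0 : K), 1; 1, 0] ∨ A = !![(0 : K), -1; 1, 0]) (c : K) (hc : c ≠ 0)
    (h : (g : Matrix (Fin 2) (Fin 2) K) = c • A) : toPGL2 K g ∈ GV4 K := by
  have hd : A.det ≠ 0 := by
    rcases hA with h | h | h | h <;> simp [h, Matrix.det_fin_two]
  refine ⟨Matrix.GeneralLinearGroup.mkOfDetNeZero A hd, hA, ?_⟩
  rw [toPGL2_eq_iff']
  exact ⟨c, hc, h⟩

/-- The centralizer of `G_{V₄}` in `PGL₂(K̄)` equals `G_{V₄}`. -/
theorem centralizer_GV4 (K : Type*) [Field K] [IsAlgClosed K]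
    (hchar : ringChar K = 0 ∨ 2 < ringChar K) :
    (Subgroup.centralizer (GV4 K) : Set (PGL2 K)) = GV4 K := by
  have h2 : (2 : K) ≠ 0 := by
    apply Ring.two_ne_zero
    rcases hchar with h | h <;> omega
  ext x
  rw [SetLike.mem_coe, Subgroup.mem_centralizer_iff]
  constructor
  swap
  · intro hx y hy
    exact GV4_comm hy hx
  intro H
  obtain ⟨g, rfl⟩ := QuotientGroup.mk'_surjective _ x
  change toPGL2 K g ∈ _
  have hdetg : (g : Matrix (Fin 2) (Fin 2) K).det ≠ 0 :=
    ((Matrix.isUnit_iff_isUnit_det _).mp g.isUnit).ne_zero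
  have key : ∀ A : Matrix (Fin 2) (Fin 2) K, (A = !![(1 : K), 0; 0, 1] ∨
      A = !![(-1 : K), 0; 0, 1] ∨ A = !![(0 : K), 1; 1, 0] ∨ A = !![(0 : K), -1; 1, 0]) →
      ∃ c : K, c ≠ 0 ∧ A * (g : Matrix (Fin 2) (Fin 2) K) = c • ((g : Matrix _ _ K) * A) := by
    intro A hA
    have hd : A.det ≠ 0 := by
      rcases hA with h | h | h | h <;> simp [h, Matrix.det_fin_two]
    have := H (toPGL2 K (Matrix.GeneralLinearGroup.mkOfDetNeZero A hd)) 
      ⟨Matrix.GeneralLinearGroup.mkOfDetNeZero A hd, hA, rfl⟩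
    change _ * toPGL2 K g = toPGL2 K g * _ at this
    rw [← map_mul, ← map_mul, toPGL2_eq_iff'] at this
    exact this
  obtain ⟨s, hs, e1⟩ := key _ (Or.inr (Or.inl rfl))
  obtain ⟨t, ht, e2⟩ := key _ (Or.inr (Or.inr (Or.inl rfl)))
  have hmem := mem_GV4_of g
  generalize (g : Matrix (Fin 2) (Fin 2) K) = G at *
  obtain ⟨a, b, c, d, rfl⟩ : ∃ a b c d, G = !![a, b; c, d] := ⟨_, _, _, _, G.eta_fin_two⟩
  simp [Matrix.det_fin_two] at hdetg
  simp [← Matrix.ext_iff, Fin.forall_fin_two, Matrix.mul_apply] at e1 e2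
  obtain ⟨⟨e11, e12⟩, e13, e14⟩ := e1
  obtain ⟨⟨e21, e22⟩, e23, e24⟩ := e2
  by_cases hs1 : s = 1
  · have hb : b = 0 := by grind
    have hc : c = 0 := by grind
    have hd : d ≠ 0 := by grind
    have ht : (a - d) * (a + d) = 0 := by grind
    rcases mul_eq_zero.mp ht with h | h
    · refine hmem _ (Or.inl rfl) d hd ?_
      simp [hb, hc]; grind
    · refine hmem _ (Or.inr (Or.inl rfl)) d hd ?_
      simp [hb, hc]; grind
  · have hb : a = 0 := by grind
    have hc : d = 0 := by grind
    have hd : c ≠ 0 := by grind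
    have ht : (b - c) * (b + c) = 0 := by grind
    rcases mul_eq_zero.mp ht with h | h
    · refine hmem _ (Or.inr (Or.inr (Or.inl rfl))) c hd ?_
      simp [hb, hc]; grind
    · refine hmem _ (Or.inr (Or.inr (Or.inr rfl))) c hd ?_
      simp [hb, hc]; grind
end

section
/- Let K be a field of characteristic not equal to 2 and let L/K be a finite field extension of odd degree. Let q be a nondegenerate quadratic form on a 3-dimensional K-vector space V (so that q = 0 defines a smooth plane conic, i.e. a curve of genus 0, over K). If the base change of q to L has a nonzero isotropic vector (equivalently, the conic has an L-rational point), then q has a nonzero isotropic vector over K (the conic has a K-rational point). -/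
open scoped TensorProduct

theorem aux_norm (K L : Type*) [Field K] [Field L] [Algebra K L] [FiniteDimensional K L]
    (d : K) (x y : L) :
    ∃ u v : K, Algebra.norm K (x ^ 2 - algebraMap K L d * y ^ 2) = u ^ 2 - d * v ^ 2 := by
  classical
  let b := Module.finBasis K L
  let F := QuadraticAlgebra K d 0
  let w : F := ⟨0, 1⟩
  let φ := (algebraMap K F).mapMatrix (m := Fin (Module.finrank K L))
  let X := Algebra.leftMulMatrix b x
  let Y := Algebra.leftMulMatrix b y
  let s : F →+* F := starRingEnd F
  have hww : w * w = algebraMap K F d := by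
    ext <;> simp [w, F]
  have hsw : s w = - w := by
    ext <;> simp [w, s, F, starRingEnd_apply]
  have hsc : ∀ k : K, s (algebraMap K F k) = algebraMap K F k := by
    intro k
    ext <;> simp [s, F, starRingEnd_apply]
  have hXY : X * Y = Y * X := by
    simp only [X, Y, ← map_mul, mul_comm]
  let M := φ X + w • φ Y
  have hconj : s.mapMatrix M = φ X - w • φ Y := by
    ext1 i j
    simp [M, φ, hsw, hsc, sub_eq_add_neg]
    exact neg_mul _ _
  have hmul : M * s.mapMatrix M = φ (Algebra.leftMulMatrix b (x ^ 2 - algebraMap K L d * y ^ 2)) := by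
    have e1 : Algebra.leftMulMatrix b (x ^ 2 - algebraMap K L d * y ^ 2) = X * X - d • (Y * Y) := by
      rw [← Algebra.smul_def, map_sub, map_smul, map_pow, map_pow, sq, sq]
    have e2 : φ (d • (Y * Y)) = algebraMap K F d • (φ Y * φ Y) := by
      have e0 : ∀ Z, φ (d • Z) = algebraMap K F d • φ Z := by
        intro Z
        ext1 i j
        simp [φ]
      rw [e0, map_mul φ Y Y]
    have e3 : φ X * φ Y = φ Y * φ X := by rw [← map_mul, hXY, map_mul]
    rw [hconj, e1, map_sub, e2, map_mul, ← hww]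
    simp only [M, add_mul, mul_sub, smul_mul_assoc, mul_smul_comm, e3, smul_add, mul_smul]
    abel
  have hdet : M.det * s M.det = algebraMap K F (Algebra.norm K (x ^ 2 - algebraMap K L d * y ^ 2)) := by
    rw [RingHom.map_det, ← Matrix.det_mul, hmul, Algebra.norm_eq_matrix_det b, RingHom.map_det]
  refine ⟨M.det.re, M.det.im, ?_⟩
  have := congrArg QuadraticAlgebra.re hdet
  simp [s, F, starRingEnd_apply] at this
  rw [← this]; ring

theorem aux_diag (K L : Type*) [Field K] [Field L] [Algebra K L] [FiniteDimensional K L]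
    (hodd : Odd (Module.finrank K L)) (d e : K) (x y z : L) (h0 : ¬ (x = 0 ∧ y = 0 ∧ z = 0))
    (h : x ^ 2 - algebraMap K L d * y ^ 2 = algebraMap K L e * z ^ 2) :
    ∃ x y z : K, ¬ (x = 0 ∧ y = 0 ∧ z = 0) ∧ x ^ 2 - d * y ^ 2 = e * z ^ 2 := by
  obtain ⟨k, hk⟩ := hodd
  by_cases hd : d = 0
  · exact ⟨0, 1, 0, by simp, by simp [hd]⟩
  by_cases he : e = 0
  · exact ⟨0, 0, 1, by simp, by simp [he]⟩
  by_cases hz : z = 0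
  · have hy : y ≠ 0 := by
      rintro rfl
      apply h0
      simp_all
    have hh : algebraMap K L d = (x / y) ^ 2 := by
      subst hz
      field_simp
      linear_combination -h
    have := congrArg (Algebra.norm K) hh
    rw [Algebra.norm_algebraMap, map_pow, hk] at this
    refine ⟨Algebra.norm K (x / y), d ^ k, 0, by simp [hd], ?_⟩
    rw [← this]; ring
  · have hh : algebraMap K L e = (x / z) ^ 2 - algebraMap K L d * (y / z) ^ 2 := by
      field_simp
      linear_combination -h
    obtain ⟨u, v, huv⟩ := aux_norm K L d (x / z) (y / z)
    rw [← hh, Algebra.norm_algebraMap, hk] at huv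
    refine ⟨u, v, e ^ k, by simp [he], ?_⟩
    rw [← huv]; ring

/-- **Lemma on odd-degree points on conics.** Let `L/K` be a finite extension of
odd degree with `char K ≠ 2`, and let `Q` be a nondegenerate quadratic form on a 3-dimensional
`K`-vector space `V` (a smooth conic, i.e. genus-0 curve).  If `Q` has a nonzero isotropic
vector after base change to `L` (an `L`-rational point), then it already has one over `K`
(a `K`-rational point). -/
theorem conic_point_odd_degree (K L : Type*) [Field K] [Field L] [Algebra K L]
    [Invertible (2 : K)] (hchar : ringChar K ≠ 2)
    [FiniteDimensional K L] (hodd : Odd (Module.finrank K L))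
    (V : Type*) [AddCommGroup V] [Module K V] [FiniteDimensional K V]
    (hdim : Module.finrank K V = 3)
    (Q : QuadraticForm K V) (hQ : LinearMap.BilinForm.Nondegenerate Q.polarBilin)
    (hL : ∃ v : L ⊗[K] V, v ≠ 0 ∧ Q.baseChange L v = 0) :
    ∃ v : V, v ≠ 0 ∧ Q v = 0 := by
  obtain ⟨b', hb'⟩ := LinearMap.BilinForm.exists_orthogonal_basis
    (B := QuadraticMap.associated (R := K) Q) ⟨QuadraticMap.associated_isSymm K Q⟩
  obtain ⟨b, hb⟩ : ∃ b : Module.Basis (Fin 3) K V,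
      (QuadraticMap.associated (R := K) Q).IsOrthoᵢ b := by
    rw [← hdim]; exact ⟨b', hb'⟩
  let : Invertible (2 : L) := (Invertible.map (algebraMap K L) 2).copy 2 (map_ofNat _ _).symm
  have hbL : (QuadraticMap.associated (R := L) (Q.baseChange L)).IsOrthoᵢ (b.baseChange L) := by
    intro i j hij
    have := hb hij
    simp only [Function.onFun] at this ⊢
    rw [QuadraticForm.associated_baseChange, Module.Basis.baseChange_apply,
      Module.Basis.baseChange_apply, LinearMap.BilinForm.baseChange_tmul, this, zero_smul]
  obtain ⟨v, hv0, hv⟩ := hL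
  have key := fun w => DFunLike.congr_fun (QuadraticMap.basisRepr_eq_of_iIsOrtho Q b hb) w
  have keyL := DFunLike.congr_fun
    (QuadraticMap.basisRepr_eq_of_iIsOrtho (Q.baseChange L) (b.baseChange L) hbL)
    ((b.baseChange L).equivFun v)
  rw [QuadraticMap.basisRepr_apply, Module.Basis.sum_equivFun, hv] at keyL
  simp only [QuadraticMap.basisRepr_apply, QuadraticMap.weightedSumSquares_apply,
    Fin.sum_univ_three, Module.Basis.baseChange_apply, QuadraticForm.baseChange_tmul,
    smul_eq_mul, Algebra.smul_def, mul_one] at key keyL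
  by_cases ha : Q (b 0) = 0
  · exact ⟨b 0, b.ne_zero 0, ha⟩
  set l := (b.baseChange L).equivFun v with hl
  have hl0 : l ≠ 0 := by simpa [hl] using hv0
  have ha' : algebraMap K L (Q (b 0)) ≠ 0 := by simpa using ha
  obtain ⟨x, y, z, h0, h⟩ := aux_diag K L hodd (-(Q (b 1)) / Q (b 0)) (-(Q (b 2)) / Q (b 0))
    (l 0) (l 1) (l 2) (by
      rintro ⟨h0, h1, h2⟩
      apply hl0
      ext i
      fin_cases i <;> simp [h0, h1, h2]) (by
      simp only [map_div₀, map_neg]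
      field_simp
      linear_combination -keyL)
  have hk := key ![x, y, z]
  refine ⟨_, ?_, hk.trans ?_⟩
  · intro hzero
    have := Fintype.linearIndependent_iff.1 b.linearIndependent ![x, y, z]
      (by rw [Fin.sum_univ_three]; simpa [Algebra.smul_def] using hzero)
    exact h0 ⟨this 0, this 1, this 2⟩
  · field_simp at h
    simp
    linear_combination h
end

section
/- Let p > 2 be a prime, let r ≥ 1, let q = p^r, and let K be a field of characteristic p containing 𝔽_q. Let g(X) = ((X^q − X)^{q−1} + 1)^{(q+1)/2} / (X^q − X)^{(q²−q)/2} in the field K(X) of rational functions. Then g(−1/X) = g(X), and g(X + a) = g(X) for every a ∈ 𝔽_q (i.e., for every a ∈ K with a^q = a). -/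
/-- The rational function `g(Y) = ((Y^q − Y)^{q−1} + 1)^{(q+1)/2} / (Y^q − Y)^{(q²−q)/2}`
evaluated at an element `Y` of `K(X)`. -/
noncomputable def gRat (K : Type*) [Field K] (q : ℕ) (Y : RatFunc K) : RatFunc K :=
  ((Y ^ q - Y) ^ (q - 1) + 1) ^ ((q + 1) / 2) / (Y ^ q - Y) ^ ((q ^ 2 - q) / 2)

theorem key_aux {L : Type*} [Field L] (m : ℕ) (x : L) (hx : x ≠ 0)
    (hD : (x ^ (2*m+1) - x) ^ (2*m+1) = (x ^ (2*m+1)) ^ (2*m+1) - x ^ (2*m+1))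
    (hD' : ((-x⁻¹) ^ (2*m+1) - (-x⁻¹)) ^ (2*m+1)
      = ((-x⁻¹) ^ (2*m+1)) ^ (2*m+1) - (-x⁻¹) ^ (2*m+1)) :
    (((-x⁻¹) ^ (2*m+1) - (-x⁻¹)) ^ (2*m) + 1) ^ (m+1) /
      ((-x⁻¹) ^ (2*m+1) - (-x⁻¹)) ^ (m*(2*m+1))
    = ((x ^ (2*m+1) - x) ^ (2*m) + 1) ^ (m+1) / (x ^ (2*m+1) - x) ^ (m*(2*m+1)) := by
  have hodd : Odd (2*m+1) := ⟨m, rfl⟩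
  have h1 : (-x⁻¹) ^ (2*m+1) - (-x⁻¹) = (x ^ (2*m+1) - x) / x ^ (2*m+2) := by
    rw [hodd.neg_pow, inv_pow]
    field_simp
    ring
  have h2 : ((-x⁻¹) ^ (2*m+1)) ^ (2*m+1) - (-x⁻¹)
      = ((x ^ (2*m+1)) ^ (2*m+1) - x) / (x ^ (2*m+1) * x ^ (2*m+1)) ^ m / (x ^ (2*m+1) * x) := by
    rw [hodd.neg_pow, hodd.neg_pow, inv_pow, inv_pow]
    have e : (x ^ (2*m+1)) ^ (2*m+1) = (x ^ (2*m+1) * x ^ (2*m+1)) ^ m * x ^ (2*m+1) := by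
      rw [← pow_two, ← pow_mul (x ^ (2*m+1)), ← pow_succ]
    rw [e]
    have hA : (x ^ (2*m+1) * x ^ (2*m+1)) ^ m ≠ 0 := pow_ne_zero _ (mul_ne_zero (pow_ne_zero _ hx) (pow_ne_zero _ hx))
    have hB : x ^ (2*m+1) ≠ 0 := pow_ne_zero _ hx
    generalize (x ^ (2*m+1) * x ^ (2*m+1)) ^ m = A at *
    generalize x ^ (2*m+1) = B at *
    field_simp
    ring
  by_cases h0 : x ^ (2*m+1) - x = 0
  · rw [h1, h0, zero_div]
  have h3 : ((-x⁻¹) ^ (2*m+1) - (-x⁻¹)) ^ (2*m) + 1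
      = ((x ^ (2*m+1) - x) ^ (2*m) + 1) / x ^ (2*m*(2*m+1)) := by
    have hE : (-x⁻¹) ^ (2*m+1) - (-x⁻¹) ≠ 0 := by
      rw [h1]; exact div_ne_zero h0 (pow_ne_zero _ hx)
    apply mul_right_cancel₀ hE
    have e1 : (((-x⁻¹) ^ (2*m+1) - (-x⁻¹)) ^ (2*m) + 1) * ((-x⁻¹) ^ (2*m+1) - (-x⁻¹))
        = ((-x⁻¹) ^ (2*m+1)) ^ (2*m+1) - (-x⁻¹) := by
      rw [add_mul, ← pow_succ, hD']; ring
    have e2 : ((x ^ (2*m+1) - x) ^ (2*m) + 1) * (x ^ (2*m+1) - x)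
        = (x ^ (2*m+1)) ^ (2*m+1) - x := by
      rw [add_mul, ← pow_succ, hD]; ring
    rw [e1, h2, h1, ← e2, ← pow_succ,
      show (x ^ (2*m+1) * x ^ (2*m+1)) ^ m = x ^ (2*m*(2*m+1)) by
        rw [← pow_two, ← pow_mul, ← pow_mul]; congr 1; ring]
    rw [div_mul_div_comm, div_div]
  rw [h3, h1, div_pow, div_pow, ← pow_mul, ← pow_mul,
    show 2*m*(2*m+1)*(m+1) = (2*m+2)*(m*(2*m+1)) by ring]
  exact div_div_div_cancel_right₀ (pow_ne_zero _ hx) _ _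

/-- For `q = p^r` with `p > 2` prime and `K ⊇ 𝔽_q` of characteristic `p`,
the rational function `g(X) = ((X^q − X)^{q−1} + 1)^{(q+1)/2} / (X^q − X)^{(q²−q)/2} ∈ K(X)`
satisfies `g(−1/X) = g(X)` and `g(X + a) = g(X)` for every `a ∈ 𝔽_q` (i.e. every `a ∈ K` with
`a^q = a`). -/
theorem gRat_invariant (p r : ℕ) (hp : p.Prime) (hp2 : 2 < p) (hr : 1 ≤ r) (q : ℕ)
    (hq : q = p ^ r) (F K : Type*) [Field F] [Fintype F] (hF : Fintype.card F = q)
    [Field K] (hK : ringChar K = p) (f : F →+* K) :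
    gRat K q (-(RatFunc.X)⁻¹) = gRat K q RatFunc.X ∧
      ∀ a : K, a ^ q = a → gRat K q (RatFunc.X + RatFunc.C a) = gRat K q RatFunc.X := by
  have : Fact p.Prime := ⟨hp⟩
  have : CharP K p := hK ▸ ringChar.charP K
  have : CharP (RatFunc K) p := charP_of_injective_algebraMap
    (algebraMap K (RatFunc K)).injective p
  have hodd : Odd q := by
    rw [hq]; exact (hp.odd_of_ne_two (by omega)).pow
  constructor
  · obtain ⟨m, hm⟩ := hodd
    have hsub : ∀ u v : RatFunc K, (u - v) ^ (2*m+1) = u ^ (2*m+1) - v ^ (2*m+1) := by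
      intro u v
      rw [← hm, hq]; exact sub_pow_char_pow u v r
    have a1 : (2*m+1+1)/2 = m+1 := by omega
    have a2 : ((2*m+1)^2 - (2*m+1))/2 = m*(2*m+1) := by
      rw [show (2*m+1)^2 = 2*(m*(2*m+1)) + (2*m+1) by ring]; omega
    unfold gRat
    rw [hm, a1, a2, Nat.add_sub_cancel]
    exact key_aux m _ RatFunc.X_ne_zero (hsub _ _) (hsub _ _)
  · intro a ha
    have e : (RatFunc.X + RatFunc.C a) ^ q - (RatFunc.X + RatFunc.C a)
        = (RatFunc.X : RatFunc K) ^ q - RatFunc.X := by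
      have : (RatFunc.X + RatFunc.C a) ^ q = (RatFunc.X : RatFunc K) ^ q + RatFunc.C a ^ q := by
        rw [hq]; exact add_pow_char_pow _ _ p r
      rw [this, ← map_pow, ha]; ring
    unfold gRat
    rw [e]
end

section
/- Let K be a field of characteristic not equal to 2 or 3. The images in PGL₂(K) of the six matrices [[1,0],[0,1]], [[−1,0],[0,1]], [[2,12],[1,−2]], [[2,−12],[−1,−2]], [[2,−12],[1,2]], [[2,12],[−1,2]] (corresponding to the fractional linear transformations t, −t, (2t+12)/(t−2), (2t−12)/(−t−2), (2t−12)/(t+2), (2t+12)/(−t+2)) form a subgroup of PGL₂(K) under composition that is isomorphic to the symmetric group S₃. -/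
open Matrix

/-- The six matrices corresponding to the fractional linear transformations
`t`, `−t`, `(2t+12)/(t−2)`, `(2t−12)/(−t−2)`, `(2t−12)/(t+2)`, `(2t+12)/(−t+2)`. -/
def sixMats (K : Type*) [Field K] : Set (Matrix (Fin 2) (Fin 2) K) :=
  { !![(1 : K), 0; 0, 1], !![(-1 : K), 0; 0, 1], !![(2 : K), 12; 1, -2],
    !![(2 : K), -12; -1, -2], !![(2 : K), -12; 1, 2], !![(2 : K), 12; -1, 2] }


/-- helper -/
def pR (K : Type*) [Field K] : Matrix (Fin 2) (Fin 3) K :=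
  !![0, 1/2, -1/2; 1/6, -1/12, -1/12]

def qR (K : Type*) [Field K] : Matrix (Fin 3) (Fin 2) K :=
  !![0, 4; 1, -2; -1, -2]

def permM (K : Type*) [Field K] (σ : Equiv.Perm (Fin 3)) : Matrix (Fin 3) (Fin 3) K :=
  Matrix.of fun i j => if σ j = i then 1 else 0

def fM (K : Type*) [Field K] (σ : Equiv.Perm (Fin 3)) : Matrix (Fin 2) (Fin 2) K :=
  pR K * permM K σ * qR K

lemma permM_mul (K : Type*) [Field K] (σ τ : Equiv.Perm (Fin 3)) :
    permM K (σ * τ) = permM K σ * permM K τ := by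
  ext i j
  simp [permM, Matrix.mul_apply]
  congr

lemma permM_one (K : Type*) [Field K] : permM K 1 = 1 := by
  ext i j
  simp [permM, Matrix.one_apply, eq_comm]

lemma pq_one (K : Type*) [Field K] (h2 : (2:K) ≠ 0) (h3 : (3:K) ≠ 0) : pR K * qR K = 1 := by
  have h6 : (6:K) ≠ 0 := by rw [show (6:K) = 2*3 by norm_num]; exact mul_ne_zero h2 h3
  have h12 : (12:K) ≠ 0 := by rw [show (12:K) = 2*6 by norm_num]; exact mul_ne_zero h2 h6
  ext i j
  fin_cases i <;> fin_cases j <;> simp [pR, qR, Matrix.mul_apply, Fin.sum_univ_three] <;>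
    field_simp <;> norm_num

def jM (K : Type*) [Field K] : Matrix (Fin 3) (Fin 3) K := Matrix.of fun _ _ => 1

lemma qp (K : Type*) [Field K] (h2 : (2:K) ≠ 0) (h3 : (3:K) ≠ 0) :
    qR K * pR K = 1 - (1/3 : K) • jM K := by
  have h6 : (6:K) ≠ 0 := by rw [show (6:K) = 2*3 by norm_num]; exact mul_ne_zero h2 h3
  have h12 : (12:K) ≠ 0 := by rw [show (12:K) = 2*6 by norm_num]; exact mul_ne_zero h2 h6
  ext i j
  fin_cases i <;> fin_cases j <;> simp [pR, qR, jM, Matrix.mul_apply, Fin.sum_univ_two] <;>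
    field_simp <;> norm_num

lemma jM_perm (K : Type*) [Field K] (σ : Equiv.Perm (Fin 3)) : jM K * permM K σ = jM K := by
  ext i j
  simp [jM, permM, Matrix.mul_apply]

lemma jM_q (K : Type*) [Field K] : jM K * qR K = 0 := by
  ext i j
  fin_cases j <;> simp [jM, qR, Matrix.mul_apply, Fin.sum_univ_three] <;> norm_num

lemma fM_mul (K : Type*) [Field K] (h2 : (2:K) ≠ 0) (h3 : (3:K) ≠ 0)
    (σ τ : Equiv.Perm (Fin 3)) : fM K (σ * τ) = fM K σ * fM K τ := by
  have e : fM K σ * fM K τ = pR K * permM K σ * (qR K * pR K) * permM K τ * qR K := by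
    simp only [fM, Matrix.mul_assoc]
  rw [e, qp K h2 h3, Matrix.mul_sub, Matrix.sub_mul, Matrix.sub_mul, Matrix.mul_smul,
    Matrix.smul_mul, Matrix.smul_mul, Matrix.mul_assoc _ (jM K), jM_perm,
    Matrix.mul_assoc _ (jM K), jM_q, fM, permM_mul]
  simp [Matrix.mul_assoc]

lemma fM_one (K : Type*) [Field K] (h2 : (2:K) ≠ 0) (h3 : (3:K) ≠ 0) : fM K 1 = 1 := by
  rw [fM, permM_one, Matrix.mul_one, pq_one K h2 h3]

def fMHom (K : Type*) [Field K] (h2 : (2:K) ≠ 0) (h3 : (3:K) ≠ 0) :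
    Equiv.Perm (Fin 3) →* Matrix (Fin 2) (Fin 2) K where
  toFun := fM K
  map_one' := fM_one K h2 h3
  map_mul' := fM_mul K h2 h3

def fG (K : Type*) [Field K] (h2 : (2:K) ≠ 0) (h3 : (3:K) ≠ 0) :
    Equiv.Perm (Fin 3) →* GL (Fin 2) K := (fMHom K h2 h3).toHomUnits

lemma fG_val (K : Type*) [Field K] (h2 : (2:K) ≠ 0) (h3 : (3:K) ≠ 0) (σ) :
    (fG K h2 h3 σ : Matrix (Fin 2) (Fin 2) K) = fM K σ := rfl

lemma perm_cases (σ : Equiv.Perm (Fin 3)) : σ = 1 ∨ σ = Equiv.swap 1 2 ∨ σ = Equiv.swap 0 1 ∨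
    σ = Equiv.swap 0 2 ∨ σ = Equiv.swap 0 1 * Equiv.swap 1 2 ∨
    σ = Equiv.swap 1 2 * Equiv.swap 0 1 := by
  revert σ; decide

lemma fM_entries (K : Type*) [Field K] (σ : Equiv.Perm (Fin 3)) (a b c : Fin 3)
   (ha : σ 0 = a) (hb : σ 1 = b) (hc : σ 2 = c) : fM K σ =
   !![pR K 0 b - pR K 0 c, 4 * pR K 0 a - 2 * pR K 0 b - 2 * pR K 0 c;
      pR K 1 b - pR K 1 c, 4 * pR K 1 a - 2 * pR K 1 b - 2 * pR K 1 c] := by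
  have h : ∀ i j, (pR K * permM K σ) i j = pR K i (σ j) := by
    intro i j
    simp [permM, Matrix.mul_apply]
  ext i j
  rw [fM, Matrix.mul_apply, Fin.sum_univ_three, h, h, h, ha, hb, hc]
  fin_cases i <;> fin_cases j <;> simp [qR] <;> ring

lemma fM_all (K : Type*) [Field K] (h2 : (2:K) ≠ 0) (h3 : (3:K) ≠ 0) :
    fM K (Equiv.swap 1 2) = !![(-1 : K), 0; 0, 1] ∧
    (4:K) • fM K (Equiv.swap 0 1) = !![(2 : K), 12; 1, -2] ∧
    (4:K) • fM K (Equiv.swap 0 2) = !![(2 : K), -12; -1, -2] ∧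
    (-4:K) • fM K (Equiv.swap 0 1 * Equiv.swap 1 2) = !![(2 : K), -12; 1, 2] ∧
    (-4:K) • fM K (Equiv.swap 1 2 * Equiv.swap 0 1) = !![(2 : K), 12; -1, 2] := by
  have h6 : (6:K) ≠ 0 := by rw [show (6:K) = 2*3 by norm_num]; exact mul_ne_zero h2 h3
  have h12 : (12:K) ≠ 0 := by rw [show (12:K) = 2*6 by norm_num]; exact mul_ne_zero h2 h6
  refine ⟨?_, ?_, ?_, ?_, ?_⟩
  · rw [fM_entries K _ 0 2 1 (by decide) (by decide) (by decide)]
    ext i j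
    fin_cases i <;> fin_cases j <;> simp [pR] <;> field_simp <;> norm_num
  · rw [fM_entries K _ 1 0 2 (by decide) (by decide) (by decide)]
    ext i j
    fin_cases i <;> fin_cases j <;> simp [pR] <;> field_simp <;> norm_num
  · rw [fM_entries K _ 2 1 0 (by decide) (by decide) (by decide)]
    ext i j
    fin_cases i <;> fin_cases j <;> simp [pR] <;> field_simp <;> norm_num
  · rw [fM_entries K _ 1 2 0 (by decide) (by decide) (by decide)]
    ext i j
    fin_cases i <;> fin_cases j <;> simp [pR] <;> field_simp <;> norm_num
  · rw [fM_entries K _ 2 0 1 (by decide) (by decide) (by decide)]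
    ext i j
    fin_cases i <;> fin_cases j <;> simp [pR] <;> field_simp <;> norm_num

lemma toPGL2_eq (K : Type*) [Field K] (M g : GL (Fin 2) K) (c : K)
    (h : c • (g : Matrix (Fin 2) (Fin 2) K) = M) : toPGL2 K g = toPGL2 K M := by
  refine (QuotientGroup.eq (s := Subgroup.center (GL (Fin 2) K))).2 ?_
  rw [Matrix.GeneralLinearGroup.mem_center_iff_val_mem_range_scalar]
  refine ⟨c, ?_⟩
  rw [Units.val_mul, ← h, Matrix.mul_smul, ← Units.val_mul, inv_mul_cancel, Units.val_one,
    Matrix.smul_one_eq_diagonal]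
  rfl

lemma exists_GL (K : Type*) [Field K] (g : GL (Fin 2) K) (c : K) (hc : c ≠ 0) :
    ∃ M : GL (Fin 2) K, (M : Matrix (Fin 2) (Fin 2) K) = c • (g : Matrix (Fin 2) (Fin 2) K) :=
  ⟨Units.mk0 c hc • g, rfl⟩

lemma fG_inj (K : Type*) [Field K] (h2 : (2:K) ≠ 0) (h3 : (3:K) ≠ 0) :
    Function.Injective ((toPGL2 K).comp (fG K h2 h3)) := by
  have h12 : (12:K) ≠ 0 := by
    rw [show (12:K) = 2*(2*3) by norm_num]; exact mul_ne_zero h2 (mul_ne_zero h2 h3)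
  rw [injective_iff_map_eq_one]
  intro σ hσ
  have hc : fG K h2 h3 σ ∈ Subgroup.center (GL (Fin 2) K) :=
    (QuotientGroup.eq_one_iff _).1 hσ
  rw [Matrix.GeneralLinearGroup.mem_center_iff_val_mem_range_scalar] at hc
  obtain ⟨a, ha⟩ := hc
  rw [fG_val] at ha
  obtain ⟨e1, e2, e3, e4, e5⟩ := fM_all K h2 h3
  rcases perm_cases σ with rfl | rfl | rfl | rfl | rfl | rfl
  · rfl
  · rw [← ha] at e1
    have p := congrFun (congrFun e1 0) 0
    have q := congrFun (congrFun e1 1) 1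
    simp at p q
    exact absurd (by linear_combination p - q : (2:K) = 0) h2
  · rw [← ha] at e2
    have p := congrFun (congrFun e2 1) 0
    simp at p
  · rw [← ha] at e3
    have p := congrFun (congrFun e3 1) 0
    simp at p
  · rw [← ha] at e4
    have p := congrFun (congrFun e4 1) 0
    simp at p
  · rw [← ha] at e5
    have p := congrFun (congrFun e5 1) 0
    simp at p

lemma fG_range (K : Type*) [Field K] (h2 : (2:K) ≠ 0) (h3 : (3:K) ≠ 0) :
    (((toPGL2 K).comp (fG K h2 h3)).range : Set (PGL2 K)) = imgSet (sixMats K) := by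
  have h4 : (4:K) ≠ 0 := by rw [show (4:K) = 2*2 by norm_num]; exact mul_ne_zero h2 h2
  have h4' : (-4:K) ≠ 0 := neg_ne_zero.2 h4
  obtain ⟨e1, e2, e3, e4, e5⟩ := fM_all K h2 h3
  have e0 : (1:K) • fM K 1 = !![(1 : K), 0; 0, 1] := by
    rw [fM_one K h2 h3, one_smul, Matrix.one_fin_two]
  rw [← one_smul K (fM K (Equiv.swap 1 2))] at e1
  have key : ∀ σ (c : K) (_ : c ≠ 0) A, c • fM K σ = A → A ∈ sixMats K →
      toPGL2 K (fG K h2 h3 σ) ∈ imgSet (sixMats K) := by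
    intro σ c hc A h hA
    obtain ⟨M, hM⟩ := exists_GL K (fG K h2 h3 σ) c hc
    exact ⟨M, by rw [hM, fG_val, h]; exact hA, toPGL2_eq K _ _ c hM.symm⟩
  ext x
  constructor
  · rintro ⟨σ, rfl⟩
    show toPGL2 K (fG K h2 h3 σ) ∈ _
    rcases perm_cases σ with rfl | rfl | rfl | rfl | rfl | rfl
    · exact key _ _ one_ne_zero _ e0 (by simp [sixMats])
    · exact key _ _ one_ne_zero _ e1 (by simp [sixMats])
    · exact key _ _ h4 _ e2 (by simp [sixMats])
    · exact key _ _ h4 _ e3 (by simp [sixMats])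
    · exact key _ _ h4' _ e4 (by simp [sixMats])
    · exact key _ _ h4' _ e5 (by simp [sixMats])
  · rintro ⟨M, hM, rfl⟩
    rcases hM with h | h | h | h | h | h
    · exact ⟨_, toPGL2_eq K M (fG K h2 h3 _) _ (e0.trans h.symm)⟩
    · exact ⟨_, toPGL2_eq K M (fG K h2 h3 _) _ (e1.trans h.symm)⟩
    · exact ⟨_, toPGL2_eq K M (fG K h2 h3 _) _ (e2.trans h.symm)⟩
    · exact ⟨_, toPGL2_eq K M (fG K h2 h3 _) _ (e3.trans h.symm)⟩
    · exact ⟨_, toPGL2_eq K M (fG K h2 h3 _) _ (e4.trans h.symm)⟩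
    · exact ⟨_, toPGL2_eq K M (fG K h2 h3 _) _ (e5.trans h.symm)⟩

lemma prime_ne (K : Type*) [Field K] (p : ℕ) (hp : p.Prime) (h : ringChar K ≠ p) :
    (p : K) ≠ 0 := by
  intro h0
  rcases (Nat.dvd_prime hp).1 (ringChar.dvd h0) with h1 | h1
  · exact CharP.ringChar_ne_one h1
  · exact h h1

/-- Over a field of characteristic not `2` or `3`, the images in `PGL₂(K)`
of the six listed matrices form a subgroup isomorphic to the symmetric group `S₃`. -/
theorem sixMats_subgroup_iso_S3 (K : Type*) [Field K]
    (h2 : ringChar K ≠ 2) (h3 : ringChar K ≠ 3) :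
    ∃ H : Subgroup (PGL2 K), (H : Set (PGL2 K)) = imgSet (sixMats K) ∧
      Nonempty (H ≃* Equiv.Perm (Fin 3)) := by
  have h2' : (2:K) ≠ 0 := by exact_mod_cast prime_ne K 2 Nat.prime_two h2
  have h3' : (3:K) ≠ 0 := by exact_mod_cast prime_ne K 3 Nat.prime_three h3
  exact ⟨_, fG_range K h2' h3', ⟨(MonoidHom.ofInjective (fG_inj K h2' h3')).symm⟩⟩
end

section
/- Let K̄ be an algebraically closed field of characteristic p, where p = 0 or p > 2, and let i ∈ K̄ satisfy i² = −1. Let t(X) = (X¹² − 33X⁸ − 33X⁴ + 1)/(−X¹⁰ + 2X⁶ − X²) in the field K̄(X) of rational functions. Then t(−X) = t(X), t(1/X) = t(X), and t(i(X+1)/(X−1)) = t(X); that is, t is invariant under the action of the group G_{A₄} on K̄(X) by fractional linear substitutions. -/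
/-- The rational function `t(Y) = (Y¹² − 33Y⁸ − 33Y⁴ + 1)/(−Y¹⁰ + 2Y⁶ − Y²)` evaluated at an
element `Y` of `K̄(X)`. -/
noncomputable def tRat (K : Type*) [Field K] (Y : RatFunc K) : RatFunc K :=
  (Y ^ 12 - 33 * Y ^ 8 - 33 * Y ^ 4 + 1) / (-Y ^ 10 + 2 * Y ^ 6 - Y ^ 2)

theorem t_aux {F : Type*} [Field F] (j x : F) (hj : j ^ 2 = -1) (hx : x - 1 ≠ 0) (h2 : (2 : F) ≠ 0) :
    ((j * (x + 1) / (x - 1)) ^ 12 - 33 * (j * (x + 1) / (x - 1)) ^ 8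
      - 33 * (j * (x + 1) / (x - 1)) ^ 4 + 1) /
      (-(j * (x + 1) / (x - 1)) ^ 10 + 2 * (j * (x + 1) / (x - 1)) ^ 6
        - (j * (x + 1) / (x - 1)) ^ 2) =
    (x ^ 12 - 33 * x ^ 8 - 33 * x ^ 4 + 1) / (-x ^ 10 + 2 * x ^ 6 - x ^ 2) := by
  set y := j * (x + 1) / (x - 1) with hy
  have hyx : y ^ 2 = -((x + 1) ^ 2 / (x - 1) ^ 2) := by
    rw [hy, div_pow, mul_pow, hj]; ring
  have h64 : (-64 : F) / (x - 1) ^ 12 ≠ 0 := by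
    have : (-64 : F) = -(2 ^ 6) := by norm_num
    rw [this]
    exact div_ne_zero (neg_ne_zero.mpr (pow_ne_zero _ h2)) (pow_ne_zero _ hx)
  have hN : y ^ 12 - 33 * y ^ 8 - 33 * y ^ 4 + 1 =
      (-64 : F) / (x - 1) ^ 12 * (x ^ 12 - 33 * x ^ 8 - 33 * x ^ 4 + 1) := by
    have : y ^ 12 - 33 * y ^ 8 - 33 * y ^ 4 + 1 =
      (y ^ 2) ^ 6 - 33 * (y ^ 2) ^ 4 - 33 * (y ^ 2) ^ 2 + 1 := by ring
    rw [this, hyx]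
    field_simp
    ring
  have hD : -y ^ 10 + 2 * y ^ 6 - y ^ 2 =
      (-64 : F) / (x - 1) ^ 12 * (-x ^ 10 + 2 * x ^ 6 - x ^ 2) := by
    have : -y ^ 10 + 2 * y ^ 6 - y ^ 2 =
      -(y ^ 2) ^ 5 + 2 * (y ^ 2) ^ 3 - y ^ 2 := by ring
    rw [this, hyx]
    field_simp
    ring
  rw [hN, hD, mul_div_mul_left _ _ h64]

theorem t_inv {F : Type*} [Field F] (x : F) (hx : x ≠ 0) :
    (x⁻¹ ^ 12 - 33 * x⁻¹ ^ 8 - 33 * x⁻¹ ^ 4 + 1) / (-x⁻¹ ^ 10 + 2 * x⁻¹ ^ 6 - x⁻¹ ^ 2) =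
    (x ^ 12 - 33 * x ^ 8 - 33 * x ^ 4 + 1) / (-x ^ 10 + 2 * x ^ 6 - x ^ 2) := by
  have h : (x ^ 12)⁻¹ ≠ 0 := inv_ne_zero (pow_ne_zero _ hx)
  have hN : x⁻¹ ^ 12 - 33 * x⁻¹ ^ 8 - 33 * x⁻¹ ^ 4 + 1 =
      (x ^ 12)⁻¹ * (x ^ 12 - 33 * x ^ 8 - 33 * x ^ 4 + 1) := by
    field_simp
    ring
  have hD : -x⁻¹ ^ 10 + 2 * x⁻¹ ^ 6 - x⁻¹ ^ 2 =
      (x ^ 12)⁻¹ * (-x ^ 10 + 2 * x ^ 6 - x ^ 2) := by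
    field_simp
    ring
  rw [hN, hD, mul_div_mul_left _ _ h]

/-- Over an algebraically closed field of characteristic `0` or `p > 2`,
with `i² = −1`, the rational function `t(X) = (X¹² − 33X⁸ − 33X⁴ + 1)/(−X¹⁰ + 2X⁶ − X²)`
satisfies `t(−X) = t(X)`, `t(1/X) = t(X)` and `t(i(X+1)/(X−1)) = t(X)`; that is, `t` is
invariant under the action of `G_{A₄}` by fractional linear substitutions. -/
theorem tRat_invariant (K : Type*) [Field K] [IsAlgClosed K]
    (hchar : ringChar K = 0 ∨ 2 < ringChar K) (i : K) (hi : i ^ 2 = -1) :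
    tRat K (-RatFunc.X) = tRat K RatFunc.X ∧
    tRat K (RatFunc.X)⁻¹ = tRat K RatFunc.X ∧
    tRat K (RatFunc.C i * (RatFunc.X + 1) / (RatFunc.X - 1)) = tRat K RatFunc.X := by
  have h2 : (2 : K) ≠ 0 := Ring.two_ne_zero (by omega)
  have h2' : (2 : RatFunc K) ≠ 0 := by
    have := (map_ne_zero (RatFunc.C (K := K))).mpr h2
    rwa [map_ofNat] at this
  have hX : (RatFunc.X : RatFunc K) - 1 ≠ 0 := by
    intro h
    have h1 : algebraMap (Polynomial K) (RatFunc K) (Polynomial.X - Polynomial.C 1) = 0 := by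
      simpa using h
    exact Polynomial.X_sub_C_ne_zero (1 : K) (RatFunc.algebraMap_injective K (by simpa using h1))
  refine ⟨?_, ?_, ?_⟩
  · unfold tRat
    congr 1 <;> ring
  · exact t_inv _ RatFunc.X_ne_zero
  · refine t_aux _ _ ?_ hX h2'
    rw [← map_pow, hi]; simp
end
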